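/- Let n ≥ 2 be an integer and let μ be a Borel probability measure on [0,1) which is invariant and ergodic under x ↦ n·x mod 1 and exact dimensional of some dimension κ > 0. For t ∈ ℝ and s ∈ ℝ set a_t = diag(e^t, e^{−t}) and u_s = [[1, −s],[0, 1]], and let Λ_{t,s} = a_t u_s ℤ² be the corresponding lattice in ℝ², i.e. the set of vectors (e^t(m − k·s), e^{−t}k) with (m,k) ∈ ℤ². Assume there is no escape of mass on average: for every ε > 0 there exists δ > 0 such that liminf_{T→∞} (1/T)∫₀^T μ{s : every nonzero vector of Λ_{t,s} has sup-norm ≥ δ} dt ≥ 1 − ε. Then for μ-almost every s ∈ [0,1), the continued fraction expansion of s contains all patterns. -/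

import Mathlib

open MeasureTheory Filter

/-- The Gauss map `G(x) = 1/x − ⌊1/x⌋`. -/
noncomputable def gaussMap (x : ℝ) : ℝ := Int.fract x⁻¹

/-- The `k`-th continued fraction coefficient `a_k(x) = ⌊1/G^(k−1)(x)⌋` (for `k ≥ 1`). -/
noncomputable def cfCoeff (x : ℝ) (k : ℕ) : ℤ := ⌊(gaussMap^[k - 1] x)⁻¹⌋

/-- The continued fraction expansion of `x` contains all patterns: every finite sequence of
positive integers appears as a block of consecutive coefficients. -/
def ContainsAllPatterns (x : ℝ) : Prop :=
  ∀ (k : ℕ) (b : Fin k → ℕ), (∀ i, 0 < b i) →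
    ∃ m : ℕ, ∀ i : Fin k, cfCoeff x (m + (i : ℕ) + 1) = (b i : ℤ)

/-- A measure `μ` is exact dimensional of dimension `κ`: for `μ`-a.e. `x`,
`log μ(B(x,r))/log r → κ` as `r → 0⁺`. -/
def ExactDimensional {X : Type*} [MetricSpace X] [MeasurableSpace X]
    (μ : Measure X) (κ : ℝ) : Prop :=
  ∀ᵐ x ∂μ, Tendsto (fun r : ℝ => Real.log (μ (Metric.ball x r)).toReal / Real.log r)
    (nhdsWithin 0 (Set.Ioi 0)) (nhds κ)

namespace CFP
open Finset Topology

/-- Limit along a fixed nonprincipal ultrafilter on `ℕ`. -/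
noncomputable def ulim (f : ℕ → ℝ) : ℝ := limUnder (hyperfilter ℕ : Filter ℕ) f

lemma tendsto_ulim {f : ℕ → ℝ} {C : ℝ} (h : ∀ I, |f I| ≤ C) :
    Tendsto f (hyperfilter ℕ : Filter ℕ) (𝓝 (ulim f)) := by
  have hc : IsCompact (Set.Icc (-C) C) := isCompact_Icc
  have : ((hyperfilter ℕ).map f : Filter ℝ) ≤ 𝓟 (Set.Icc (-C) C) := by
    rw [le_principal_iff, Ultrafilter.mem_coe, Ultrafilter.mem_map]
    exact univ_mem' fun I => abs_le.mp (h I)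
  obtain ⟨x, -, hx⟩ := hc.ultrafilter_le_nhds _ this
  exact tendsto_nhds_limUnder ⟨x, by simpa [Tendsto] using hx⟩

/-- Bounded functions on `ℝ × ℤ`, measurable in the first variable. -/
structure Adm (F : ℝ → ℤ → ℝ) : Prop where
  bdd : ∃ C, ∀ s i, |F s i| ≤ C
  meas : ∀ i, Measurable fun s => F s i

namespace Adm
variable {F G : ℝ → ℤ → ℝ}

lemma const (c : ℝ) : Adm fun _ _ => c := ⟨⟨|c|, fun _ _ => le_rfl⟩, fun _ => measurable_const⟩

lemma add (hF : Adm F) (hG : Adm G) : Adm fun s i => F s i + G s i := by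
  obtain ⟨⟨C, hC⟩, hm⟩ := hF
  obtain ⟨⟨D, hD⟩, hm'⟩ := hG
  exact ⟨⟨C + D, fun s i => (abs_add_le _ _).trans (add_le_add (hC s i) (hD s i))⟩,
    fun i => (hm i).add (hm' i)⟩

lemma mul (hF : Adm F) (hG : Adm G) : Adm fun s i => F s i * G s i := by
  obtain ⟨⟨C, hC⟩, hm⟩ := hF
  obtain ⟨⟨D, hD⟩, hm'⟩ := hG
  refine ⟨⟨C * D, fun s i => ?_⟩, fun i => (hm i).mul (hm' i)⟩
  rw [abs_mul]
  exact mul_le_mul (hC s i) (hD s i) (abs_nonneg _) ((abs_nonneg _).trans (hC s i))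

lemma const_mul (c : ℝ) (hF : Adm F) : Adm fun s i => c * F s i := (const c).mul hF

lemma neg (hF : Adm F) : Adm fun s i => - F s i := by
  simpa using hF.const_mul (-1)

lemma sub (hF : Adm F) (hG : Adm G) : Adm fun s i => F s i - G s i := by
  simpa [sub_eq_add_neg] using hF.add hG.neg

lemma abs (hF : Adm F) : Adm fun s i => |F s i| := by
  obtain ⟨⟨C, hC⟩, hm⟩ := hF
  exact ⟨⟨C, fun s i => by simpa using hC s i⟩, fun i => (hm i).abs⟩

lemma sq (hF : Adm F) : Adm fun s i => F s i ^ 2 := by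
  simpa [pow_two] using hF.mul hF

lemma sum {ι : Type*} {t : Finset ι} {F : ι → ℝ → ℤ → ℝ} (h : ∀ j ∈ t, Adm (F j)) :
    Adm fun s i => ∑ j ∈ t, F j s i := by
  classical
  induction t using Finset.induction_on with
  | empty => simpa using const 0
  | insert a t ha ih =>
    simp only [Finset.sum_insert ha]
    exact (h a (mem_insert_self _ _)).add (ih fun j hj => h j (mem_insert_of_mem hj))

lemma comp (hF : Adm F) {g : ℝ → ℝ} (hg : Measurable g) (k : ℤ) :
    Adm fun s i => F (g s) (i - k) := by
  obtain ⟨⟨C, hC⟩, hm⟩ := hF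
  exact ⟨⟨C, fun s i => hC _ _⟩, fun i => (hm _).comp hg⟩

end Adm

open Classical in
/-- Indicator function of a property. -/
noncomputable def ind (P : ℝ → ℤ → Prop) (s : ℝ) (i : ℤ) : ℝ := if P s i then 1 else 0

/-- Space-time average up to time `I`. -/
noncomputable def avg (μ : Measure ℝ) (F : ℝ → ℤ → ℝ) (I : ℕ) : ℝ :=
  (∑ i ∈ range I, ∫ s, F s i ∂μ) / I

/-- Limiting space-time average. -/
noncomputable def mean (μ : Measure ℝ) (F : ℝ → ℤ → ℝ) : ℝ := ulim (avg μ F)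

section
variable {μ : Measure ℝ} [IsProbabilityMeasure μ] {F G : ℝ → ℤ → ℝ}

lemma Adm.integrable (hF : Adm F) (i : ℤ) : Integrable (fun s => F s i) μ := by
  obtain ⟨⟨C, hC⟩, hm⟩ := hF
  exact Integrable.of_bound (hm i).aestronglyMeasurable C (Eventually.of_forall fun s => hC s i)

lemma Adm.abs_avg_le (hF : Adm F) {C : ℝ} (hC : ∀ s i, |F s i| ≤ C) (I : ℕ) :
    |avg μ F I| ≤ C := by
  have hC0 : 0 ≤ C := (abs_nonneg _).trans (hC 0 0)
  have h1 : ∀ i : ℤ, |∫ s, F s i ∂μ| ≤ C := fun i => by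
    have := norm_integral_le_of_norm_le_const (μ := μ) (f := fun s => F s i) (C := C)
      (Eventually.of_forall fun s => hC s i)
    simpa using this
  unfold avg
  rw [abs_div, Nat.abs_cast]
  refine div_le_of_le_mul₀ (by positivity) hC0 ?_
  calc _ ≤ ∑ i ∈ range I, |∫ s, F s i ∂μ| := abs_sum_le_sum_abs _ _
    _ ≤ ∑ i ∈ range I, C := sum_le_sum fun i _ => h1 i
    _ = C * I := by simp [mul_comm]

lemma Adm.tendsto (hF : Adm F) :
    Tendsto (avg μ F) (hyperfilter ℕ : Filter ℕ) (𝓝 (mean μ F)) := by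
  obtain ⟨C, hC⟩ := hF.bdd
  exact tendsto_ulim (hF.abs_avg_le hC)

lemma hyper_le : (hyperfilter ℕ : Filter ℕ) ≤ atTop := Nat.hyperfilter_le_atTop

lemma avg_add (hF : Adm F) (hG : Adm G) (I : ℕ) :
    avg μ (fun s i => F s i + G s i) I = avg μ F I + avg μ G I := by
  unfold avg
  rw [← add_div, ← sum_add_distrib]
  congr 1
  exact sum_congr rfl fun i _ => integral_add (hF.integrable i) (hG.integrable i)

lemma avg_const_mul (c : ℝ) (I : ℕ) :
    avg μ (fun s i => c * F s i) I = c * avg μ F I := by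
  unfold avg
  simp_rw [integral_const_mul, ← mul_sum, mul_div_assoc]

lemma avg_mono (hF : Adm F) (hG : Adm G) (h : ∀ s i, F s i ≤ G s i) (I : ℕ) :
    avg μ F I ≤ avg μ G I := by
  unfold avg
  exact div_le_div_of_nonneg_right (sum_le_sum fun i _ =>
    integral_mono (hF.integrable _) (hG.integrable _) fun s => h s _) (by positivity)

lemma mean_add (hF : Adm F) (hG : Adm G) :
    mean μ (fun s i => F s i + G s i) = mean μ F + mean μ G := by
  refine tendsto_nhds_unique (hF.add hG).tendsto ?_
  simpa [funext (avg_add (μ := μ) hF hG)] using hF.tendsto.add hG.tendsto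

lemma mean_const_mul (c : ℝ) (hF : Adm F) :
    mean μ (fun s i => c * F s i) = c * mean μ F := by
  refine tendsto_nhds_unique (hF.const_mul c).tendsto ?_
  simpa [funext (avg_const_mul (μ := μ) (F := F) c)] using hF.tendsto.const_mul c

lemma mean_neg (hF : Adm F) : mean μ (fun s i => - F s i) = - mean μ F := by
  simpa using mean_const_mul (μ := μ) (-1) hF

lemma mean_sub (hF : Adm F) (hG : Adm G) :
    mean μ (fun s i => F s i - G s i) = mean μ F - mean μ G := by
  simpa [sub_eq_add_neg, mean_neg hG] using mean_add (μ := μ) hF hG.neg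

lemma mean_le_of_avg (hF : Adm F) (hG : Adm G) (h : ∀ᶠ I in atTop, avg μ F I ≤ avg μ G I) :
    mean μ F ≤ mean μ G :=
  le_of_tendsto_of_tendsto hF.tendsto hG.tendsto (hyper_le h)

lemma mean_mono (hF : Adm F) (hG : Adm G) (h : ∀ s i, F s i ≤ G s i) : mean μ F ≤ mean μ G :=
  mean_le_of_avg hF hG (Eventually.of_forall (avg_mono hF hG h))

lemma mean_const (c : ℝ) : mean μ (fun _ _ => c) = c := by
  refine tendsto_nhds_unique (Adm.const c).tendsto ?_
  refine tendsto_const_nhds.congr' (hyper_le ?_)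
  filter_upwards [eventually_gt_atTop 0] with I hI
  unfold avg
  have : (I : ℝ) ≠ 0 := by positivity
  simp [this]

lemma mean_nonneg (hF : Adm F) (h : ∀ s i, 0 ≤ F s i) : 0 ≤ mean μ F :=
  (mean_const (μ := μ) 0).symm.trans_le (mean_mono (Adm.const 0) hF h)

lemma mean_sum {ι : Type*} {t : Finset ι} {F : ι → ℝ → ℤ → ℝ} (h : ∀ j ∈ t, Adm (F j)) :
    mean μ (fun s i => ∑ j ∈ t, F j s i) = ∑ j ∈ t, mean μ (F j) := by
  classical
  induction t using Finset.induction_on with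
  | empty => simpa using mean_const (μ := μ) 0
  | insert a t ha ih =>
    have h1 := h a (mem_insert_self _ _)
    have h2 : ∀ j ∈ t, Adm (F j) := fun j hj => h j (mem_insert_of_mem hj)
    simp only [Finset.sum_insert ha]
    rw [mean_add h1 (Adm.sum h2), ih h2]

lemma abs_mean_le (hF : Adm F) : |mean μ F| ≤ mean μ fun s i => |F s i| := by
  rw [abs_le]
  constructor
  · rw [← mean_neg hF.abs]
    exact mean_mono hF.abs.neg hF fun s i => neg_abs_le _
  · exact mean_mono hF hF.abs fun s i => le_abs_self _

lemma exists_of_mean_lt (hF : Adm F) (hG : Adm G) (h : mean μ F < mean μ G) :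
    ∃ s i, 0 ≤ i ∧ F s i < G s i := by
  by_contra! hc
  refine absurd (mean_le_of_avg hG hF (Eventually.of_forall fun I => ?_)) (not_le.mpr h)
  unfold avg
  exact div_le_div_of_nonneg_right (sum_le_sum fun i _ =>
    integral_mono (hG.integrable _) (hF.integrable _) fun s => hc s _ (Int.natCast_nonneg _))
    (by positivity)

lemma mean_mono' (hF : Adm F) (hG : Adm G) (h : ∀ s i, 0 ≤ i → F s i ≤ G s i) :
    mean μ F ≤ mean μ G := by
  by_contra! hc
  obtain ⟨s, i, hi, h'⟩ := exists_of_mean_lt hG hF hc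
  exact absurd (h s i hi) (not_le.mpr h')

/-- Time shifts do not change the mean. -/
lemma mean_shift (hF : Adm F) (k : ℕ) : mean μ (fun s i => F s (i - k)) = mean μ F := by
  have hF' : Adm fun s i => F s (i - k) := hF.comp measurable_id k
  obtain ⟨C, hC⟩ := hF.bdd
  have hb : ∀ i : ℤ, |∫ s, F s i ∂μ| ≤ C := fun i => by
    have := norm_integral_le_of_norm_le_const (μ := μ) (f := fun s => F s i) (C := C)
      (Eventually.of_forall fun s => hC s i)
    simpa using this
  have h0 : Tendsto (fun I => avg μ (fun s i => F s (i - k)) I - avg μ F I)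
      atTop (𝓝 0) := by
    have hz : Tendsto (fun I : ℕ => (2 * k * C) / (I : ℝ)) atTop (𝓝 0) :=
      tendsto_const_div_atTop_nhds_zero_nat _
    refine squeeze_zero_norm' ?_ hz
    filter_upwards [eventually_ge_atTop k] with I hI
    obtain ⟨J, rfl⟩ := Nat.exists_eq_add_of_le hI
    unfold avg
    rw [← sub_div, norm_div, Real.norm_natCast, Real.norm_eq_abs]
    refine div_le_div_of_nonneg_right ?_ (by positivity)
    have e1 : ∑ i ∈ range (k + J), ∫ s, F s ((i : ℤ) - k) ∂μ
        = ∑ i ∈ range k, ∫ s, F s ((i : ℤ) - k) ∂μ + ∑ i ∈ range J, ∫ s, F s i ∂μ := by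
      rw [sum_range_add]; simp
    have e2 : ∑ i ∈ range (k + J), ∫ s, F s (i : ℤ) ∂μ
        = ∑ i ∈ range J, ∫ s, F s i ∂μ + ∑ i ∈ range k, ∫ s, F s ((J + i : ℕ) : ℤ) ∂μ := by
      rw [add_comm k J, sum_range_add]
    rw [e1, e2]
    have b1 : |∑ i ∈ range k, ∫ s, F s ((i : ℤ) - k) ∂μ| ≤ k * C :=
      (abs_sum_le_sum_abs _ _).trans ((sum_le_sum fun i _ => hb _).trans (by simp))
    have b2 : |∑ i ∈ range k, ∫ s, F s ((J + i : ℕ) : ℤ) ∂μ| ≤ k * C :=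
      (abs_sum_le_sum_abs _ _).trans ((sum_le_sum fun i _ => hb _).trans (by simp))
    rw [abs_le] at b1 b2 ⊢
    constructor <;> linarith [b1.1, b1.2, b2.1, b2.2]
  have h1 := hF'.tendsto (μ := μ) |>.sub (hF.tendsto (μ := μ))
  have := tendsto_nhds_unique h1 (h0.mono_left hyper_le)
  linarith

/-- Invariance of the mean under `(s, i) ↦ (n ^ k * s, i - k)` on `1`-periodic functions. -/
lemma mean_comp {n : ℕ} (hT : MeasurePreserving (fun x : ℝ => Int.fract ((n : ℝ) * x)) μ μ)
    (hF : Adm F) (hper : ∀ s i, ∀ m : ℤ, F (s + m) i = F s i) (k : ℕ) :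
    mean μ (fun s i => F ((n : ℝ) ^ k * s) (i - k)) = mean μ F := by
  rw [← mean_shift hF k]
  unfold mean
  congr 1
  ext I
  unfold avg
  congr 1
  refine sum_congr rfl fun i _ => ?_
  change ∫ s, F ((n : ℝ) ^ k * s) ((i : ℤ) - k) ∂μ = ∫ s, F s ((i : ℤ) - k) ∂μ
  generalize ((i : ℤ) - k) = j
  induction k with
  | zero => simp
  | succ k ih =>
    rw [← ih]
    have hm : Measurable fun s => F ((n : ℝ) ^ k * s) j :=
      (hF.meas j).comp (measurable_const_mul _)
    have := hT.map_eq
    conv_rhs => rw [← this]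
    rw [integral_map hT.measurable.aemeasurable hm.aestronglyMeasurable]
    refine integral_congr_ae (Eventually.of_forall fun s => ?_)
    simp only
    rw [← hper ((n : ℝ) ^ k * Int.fract ((n : ℝ) * s)) j (n ^ k * ⌊(n : ℝ) * s⌋)]
    congr 1
    have := Int.floor_add_fract ((n : ℝ) * s)
    push_cast
    rw [← mul_add, add_comm (Int.fract _), this]
    ring

end
end CFP

namespace CFP
open Finset Topology

section Ind
variable {P Q R : ℝ → ℤ → Prop}

lemma ind_nonneg (P : ℝ → ℤ → Prop) (s : ℝ) (i : ℤ) : 0 ≤ ind P s i := by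
  unfold ind; split_ifs <;> simp

lemma ind_le_one (P : ℝ → ℤ → Prop) (s : ℝ) (i : ℤ) : ind P s i ≤ 1 := by
  unfold ind; split_ifs <;> simp

lemma ind_of {s : ℝ} {i : ℤ} (h : P s i) : ind P s i = 1 := by simp [ind, h]

lemma ind_of_not {s : ℝ} {i : ℤ} (h : ¬ P s i) : ind P s i = 0 := by simp [ind, h]

/-- Measurability in the first variable of a property. -/
def MSet (P : ℝ → ℤ → Prop) : Prop := ∀ i, MeasurableSet {s | P s i}

lemma MSet.adm (h : MSet P) : Adm (ind P) := by
  classical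
  refine ⟨⟨1, fun s i => ?_⟩, fun i => ?_⟩
  · rw [abs_of_nonneg (ind_nonneg _ _ _)]; exact ind_le_one _ _ _
  · exact Measurable.ite (h i) measurable_const measurable_const

lemma MSet.not (h : MSet P) : MSet fun s i => ¬ P s i := fun i => (h i).compl

lemma MSet.and (h : MSet P) (h' : MSet Q) : MSet fun s i => P s i ∧ Q s i :=
  fun i => (h i).inter (h' i)

lemma MSet.or (h : MSet P) (h' : MSet Q) : MSet fun s i => P s i ∨ Q s i :=
  fun i => (h i).union (h' i)

lemma MSet.ex {ι : Type*} [Countable ι] {P : ι → ℝ → ℤ → Prop} (h : ∀ j, MSet (P j)) :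
    MSet fun s i => ∃ j, P j s i := fun i => by
  have := MeasurableSet.iUnion fun j => h j i
  convert this using 1
  ext; simp

lemma MSet.all {ι : Type*} [Countable ι] {P : ι → ℝ → ℤ → Prop} (h : ∀ j, MSet (P j)) :
    MSet fun s i => ∀ j, P j s i := fun i => by
  have := MeasurableSet.iInter fun j => h j i
  convert this using 1
  ext; simp

lemma MSet.cst {p : ℤ → Prop} : MSet fun _ i => p i := fun i => MeasurableSet.const _

lemma MSet.comp (h : MSet P) {g : ℝ → ℝ} (hg : Measurable g) (k : ℤ) :
    MSet fun s i => P (g s) (i - k) := fun i => hg (h (i - k))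

lemma Adm.mset_lt {F G : ℝ → ℤ → ℝ} (hF : Adm F) (hG : Adm G) : MSet fun s i => F s i < G s i :=
  fun i => measurableSet_lt (hF.meas i) (hG.meas i)

lemma Adm.mset_le {F G : ℝ → ℤ → ℝ} (hF : Adm F) (hG : Adm G) : MSet fun s i => F s i ≤ G s i :=
  fun i => measurableSet_le (hF.meas i) (hG.meas i)

variable {μ : Measure ℝ} [IsProbabilityMeasure μ]

lemma integral_ind (h : MSet P) (i : ℤ) : ∫ s, ind P s i ∂μ = μ.real {s | P s i} := by
  classical
  rw [← integral_indicator_one (h i)]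
  congr 1

/-- Upper density of a property. -/
noncomputable def mS (μ : Measure ℝ) (P : ℝ → ℤ → Prop) : ℝ := mean μ (ind P)

lemma mS_mono (h : MSet P) (h' : MSet Q) (hPQ : ∀ s i, 0 ≤ i → P s i → Q s i) :
    mS μ P ≤ mS μ Q := by
  refine mean_mono' h.adm h'.adm fun s i hi => ?_
  by_cases hp : P s i
  · rw [ind_of hp, ind_of (hPQ s i hi hp)]
  · rw [ind_of_not hp]; exact ind_nonneg _ _ _

lemma mS_not (h : MSet P) : mS μ (fun s i => ¬ P s i) = 1 - mS μ P := by
  unfold mS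
  rw [← mean_const (μ := μ) 1, ← mean_sub (Adm.const 1) h.adm]
  congr 1
  ext s i
  by_cases hp : P s i <;> simp [ind, hp]

lemma mS_or_le (h : MSet P) (h' : MSet Q) :
    mS μ (fun s i => P s i ∨ Q s i) ≤ mS μ P + mS μ Q := by
  unfold mS
  rw [← mean_add h.adm h'.adm]
  refine mean_mono (h.or h').adm (h.adm.add h'.adm) fun s i => ?_
  by_cases hp : P s i <;> by_cases hq : Q s i <;> simp [ind, hp, hq]

lemma mS_ex_le {ι : Type*} [Countable ι] (t : Finset ι) {P : ι → ℝ → ℤ → Prop}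
    (h : ∀ j, MSet (P j)) :
    mS μ (fun s i => ∃ j ∈ t, P j s i) ≤ ∑ j ∈ t, mS μ (P j) := by
  have hm : MSet fun s i => ∃ j ∈ t, P j s i := by
    have := MSet.ex fun j : t => h j
    simpa using this
  unfold mS
  rw [← mean_sum fun j _ => (h j).adm]
  refine mean_mono hm.adm (Adm.sum fun j _ => (h j).adm) fun s i => ?_
  by_cases hp : ∃ j ∈ t, P j s i
  · rw [ind_of (P := fun s i => ∃ j ∈ t, P j s i) hp]
    obtain ⟨j, hj, hp⟩ := hp
    rw [← ind_of hp]
    exact single_le_sum (f := fun j => ind (P j) s i) (fun j _ => ind_nonneg _ _ _) hj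
  · rw [ind_of_not (P := fun s i => ∃ j ∈ t, P j s i) hp]
    exact sum_nonneg fun j _ => ind_nonneg _ _ _

/-- Markov's inequality for the mean. -/
lemma markov {F : ℝ → ℤ → ℝ} (hF : Adm F) (h0 : ∀ s i, 0 ≤ F s i) {c : ℝ} (hc : 0 < c)
    (h : MSet P) (hP : ∀ s i, P s i → c ≤ F s i) : mS μ P ≤ mean μ F / c := by
  rw [le_div_iff₀' hc]
  unfold mS
  rw [← mean_const_mul c h.adm]
  refine mean_mono (h.adm.const_mul c) hF fun s i => ?_
  by_cases hp : P s i
  · rw [ind_of hp, mul_one]; exact hP s i hp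
  · rw [ind_of_not hp, mul_zero]; exact h0 s i

lemma avg_le_of_sum {F G : ℝ → ℤ → ℝ} (hF : Adm F) (hG : Adm G) (I : ℕ)
    (h : ∀ s, ∑ i ∈ range I, F s i ≤ ∑ i ∈ range I, G s i) : avg μ F I ≤ avg μ G I := by
  unfold avg
  refine div_le_div_of_nonneg_right ?_ (by positivity)
  rw [← integral_finsetSum _ fun i _ => hF.integrable _,
    ← integral_finsetSum _ fun i _ => hG.integrable _]
  exact integral_mono (integrable_finsetSum _ fun i _ => hF.integrable _)
    (integrable_finsetSum _ fun i _ => hG.integrable _) h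

end Ind

section OneDim
open Classical

lemma card_window (P : ℕ → Prop) {i J : ℕ} (h : J ≤ i + 1) :
    ((range J).filter fun l => P (i - l)).card + Nat.count P (i + 1 - J) = Nat.count P (i + 1) := by
  induction J with
  | zero => simp
  | succ J ih =>
    rw [← ih (by omega), range_add_one, filter_insert,
      show i + 1 - J = (i + 1 - (J + 1)) + 1 by omega, Nat.count_succ,
      show i + 1 - (J + 1) = i - J by omega]
    split_ifs
    · rw [card_insert_of_notMem (by simp)]; omega
    · omega

lemma count_few (P Q : ℕ → Prop) {c : ℝ} (hc : 0 ≤ c)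
    (hQ : ∀ i, Q i → ∃ J, J ≤ i + 1 ∧ c * J < (((range J).filter fun l => P (i - l)).card : ℝ))
    (I : ℕ) : c * Nat.count Q I ≤ Nat.count P I := by
  induction I using Nat.strong_induction_on with
  | _ I ih =>
    rcases I with - | i
    · simp
    by_cases hi : Q i
    · obtain ⟨J, hJ, hlt⟩ := hQ i hi
      have hJ0 : J ≠ 0 := by rintro rfl; simp at hlt
      have h1 := ih (i + 1 - J) (by omega)
      have h2 := card_window P hJ
      have h3 : (Nat.count Q (i + 1) : ℝ) ≤ Nat.count Q (i + 1 - J) + J := by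
        have := card_window Q hJ
        have h4 : ((range J).filter fun l => Q (i - l)).card ≤ J := by
          simpa using card_filter_le (range J) fun l => Q (i - l)
        exact_mod_cast (by omega : Nat.count Q (i + 1) ≤ Nat.count Q (i + 1 - J) + J)
      have h5 : ((((range J).filter fun l => P (i - l)).card : ℕ) : ℝ) + Nat.count P (i + 1 - J) =
        Nat.count P (i + 1) := by exact_mod_cast h2
      have := mul_le_mul_of_nonneg_left h3 hc
      rw [mul_add] at this
      linarith
    · have h1 := ih i (by omega)
      have h2 : (Nat.count P i : ℝ) ≤ Nat.count P (i + 1) := by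
        exact_mod_cast Nat.count_monotone P (Nat.le_succ i)
      rw [Nat.count_succ, if_neg hi, add_zero]
      linarith

lemma count_most (P Q : ℕ → Prop) {c : ℝ} (hc : 0 ≤ c)
    (hQ : ∀ i, (∀ J, J ≤ i + 1 → c * J ≤ (((range J).filter fun l => P (i - l)).card : ℝ)) → Q i)
    (I : ℕ) : (Nat.count P I : ℝ) ≤ c * I + Nat.count Q I := by
  induction I using Nat.strong_induction_on with
  | _ I ih =>
    rcases I with - | i
    · simp
    by_cases hi : Q i
    · have h1 := ih i (by omega)
      have h2 : (Nat.count P (i + 1) : ℝ) ≤ Nat.count P i + 1 := by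
        rw [Nat.count_succ]; split_ifs <;> simp
      rw [Nat.count_succ Q, if_pos hi]
      push_cast
      linarith
    · have hi' := mt (hQ i) hi
      push Not at hi'
      obtain ⟨J, hJ, hlt⟩ := hi'
      have h1 := ih (i + 1 - J) (by
        have hJ0 : J ≠ 0 := by rintro rfl; simp at hlt
        omega)
      have h2 := card_window P hJ
      have h3 : (Nat.count Q (i + 1 - J) : ℝ) ≤ Nat.count Q (i + 1) := by
        exact_mod_cast Nat.count_monotone _ (by omega)
      have h5 : ((((range J).filter fun l => P (i - l)).card : ℕ) : ℝ) + Nat.count P (i + 1 - J) =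
        Nat.count P (i + 1) := by exact_mod_cast h2
      rw [Nat.cast_sub hJ, mul_sub] at h1
      push_cast at h1 ⊢
      linarith

end OneDim

section Windows
open Classical
variable {μ : Measure ℝ} [IsProbabilityMeasure μ]

/-- Number of the last `J` times at which `P` holds. -/
noncomputable def wcount (P : ℝ → ℤ → Prop) (s : ℝ) (i : ℤ) (J : ℕ) : ℕ :=
  ((range J).filter fun l : ℕ => P s (i - l)).card

/-- `P` holds at proportion at most `c` of every initial window into the past. -/
def Few (P : ℝ → ℤ → Prop) (c : ℝ) (s : ℝ) (i : ℤ) : Prop :=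
  ∀ J : ℕ, (J : ℤ) ≤ i + 1 → (wcount P s i J : ℝ) ≤ c * J

/-- `P` holds at proportion at least `c` of every initial window into the past. -/
def Most (P : ℝ → ℤ → Prop) (c : ℝ) (s : ℝ) (i : ℤ) : Prop :=
  ∀ J : ℕ, (J : ℤ) ≤ i + 1 → c * J ≤ (wcount P s i J : ℝ)

variable {P : ℝ → ℤ → Prop}

lemma adm_wcount_le (h : MSet P) (c : ℝ) (J : ℕ) :
    MSet (fun s i => (wcount P s i J : ℝ) ≤ c) ∧ MSet (fun s i => c ≤ (wcount P s i J : ℝ)) := by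
  have e : ∀ s i, (wcount P s i J : ℝ) = ∑ l ∈ range J, ind P s (i - l) := by
    intro s i
    unfold wcount ind
    rw [card_filter]
    push_cast
    rfl
  have ha : Adm fun s i => ∑ l ∈ range J, ind P s (i - l) :=
    Adm.sum fun l _ => h.adm.comp measurable_id l
  simp_rw [e]
  exact ⟨ha.mset_le (Adm.const c), (Adm.const c).mset_le ha⟩

lemma MSet.few (h : MSet P) (c : ℝ) : MSet (Few P c) := by
  refine MSet.all fun J => ?_
  intro i
  by_cases hJ : (J : ℤ) ≤ i + 1
  · simpa [hJ] using (adm_wcount_le h (c * J) J).1 i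
  · simp [hJ]

lemma MSet.most (h : MSet P) (c : ℝ) : MSet (Most P c) := by
  refine MSet.all fun J => ?_
  intro i
  by_cases hJ : (J : ℤ) ≤ i + 1
  · simpa [hJ] using (adm_wcount_le h (c * J) J).2 i
  · simp [hJ]

lemma wcount_nat (s : ℝ) {i J : ℕ} (hJ : J ≤ i + 1) :
    wcount P s i J = ((range J).filter fun l => P s ((i - l : ℕ) : ℤ)).card := by
  unfold wcount
  congr 1
  refine filter_congr fun l hl => ?_
  have : l < J := mem_range.mp hl
  rw [Nat.cast_sub (by omega)]

lemma sum_ind (Q : ℝ → ℤ → Prop) (s : ℝ) (I : ℕ) :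
    ∑ i ∈ range I, ind Q s i = Nat.count (fun i : ℕ => Q s i) I := by
  unfold ind
  rw [Nat.count_eq_card_filter_range, card_filter]
  push_cast
  rfl

lemma mS_not_few_le (h : MSet P) {c : ℝ} (hc : 0 < c) :
    mS μ (fun s i => ¬ Few P c s i) ≤ mS μ P / c := by
  rw [le_div_iff₀' hc]
  unfold mS
  rw [← mean_const_mul c (h.few c).not.adm]
  refine mean_le_of_avg ((h.few c).not.adm.const_mul c) h.adm (Eventually.of_forall fun I => ?_)
  refine avg_le_of_sum ((h.few c).not.adm.const_mul c) h.adm I fun s => ?_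
  rw [← mul_sum, sum_ind, sum_ind]
  refine count_few (fun i : ℕ => P s i) (fun i : ℕ => ¬ Few P c s i) hc.le (fun i hi => ?_) I
  simp only [Few, not_forall, not_le] at hi
  obtain ⟨J, h1, h2⟩ := hi
  have h1' : J ≤ i + 1 := by omega
  rw [wcount_nat s h1'] at h2
  exact ⟨J, h1', h2⟩

lemma mS_le_most (h : MSet P) {c : ℝ} (hc : 0 ≤ c) :
    mS μ P ≤ c + mS μ (Most P c) := by
  have e : c + mS μ (Most P c) = mean μ fun s i => c + ind (Most P c) s i := by
    rw [mean_add (Adm.const c) (h.most c).adm, mean_const]; rfl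
  rw [e]
  refine mean_le_of_avg h.adm ((Adm.const c).add (h.most c).adm)
    (Eventually.of_forall fun I => ?_)
  refine avg_le_of_sum h.adm ((Adm.const c).add (h.most c).adm) I fun s => ?_
  rw [sum_add_distrib, sum_ind, sum_ind]
  refine (count_most (fun i : ℕ => P s i) (fun i : ℕ => Most P c s i) hc (fun i hi J h1 => ?_)
    I).trans (le_of_eq ?_)
  · have h1' : J ≤ i + 1 := by omega
    rw [wcount_nat s h1']
    exact hi J h1'
  · simp [mul_comm]

end Windows
end CFP

namespace CFP
open Finset Topology

/-- The `n`-adic cell of generation `j` containing `s`. -/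
def cell (n j : ℕ) (s : ℝ) : Set ℝ := {x | ⌊(n : ℝ) ^ j * x⌋ = ⌊(n : ℝ) ^ j * s⌋}

section Cells
variable {n : ℕ}

lemma cell_eq {j : ℕ} {x s : ℝ} (h : x ∈ cell n j s) : cell n j x = cell n j s := by
  have h' : ⌊(n : ℝ) ^ j * x⌋ = ⌊(n : ℝ) ^ j * s⌋ := h
  simp [cell, h']

lemma mem_cell_comm {j : ℕ} {x s : ℝ} : x ∈ cell n j s ↔ s ∈ cell n j x := eq_comm

lemma floor_coarse (hn : 2 ≤ n) {i j : ℕ} (hij : i ≤ j) (x : ℝ) :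
    ⌊(n : ℝ) ^ i * x⌋ = ⌊(n : ℝ) ^ j * x⌋ / ((n ^ (j - i) : ℕ) : ℤ) := by
  have h0 : (n : ℝ) ≠ 0 := by positivity
  rw [← Int.floor_div_natCast]
  congr 1
  push_cast
  rw [eq_div_iff (by positivity), mul_right_comm, ← pow_add]
  congr 2
  omega

lemma cell_anti (hn : 2 ≤ n) {i j : ℕ} (hij : i ≤ j) (s : ℝ) : cell n j s ⊆ cell n i s := by
  intro x hx
  have h' : ⌊(n : ℝ) ^ j * x⌋ = ⌊(n : ℝ) ^ j * s⌋ := hx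
  simp only [cell, Set.mem_ofPred_eq, floor_coarse hn hij, h']

lemma measurableSet_cell (j : ℕ) (s : ℝ) : MeasurableSet (cell n j s) :=
  (Int.measurable_floor.comp (measurable_const_mul _)) (MeasurableSet.singleton _)

lemma cell_dist {j : ℕ} {x s : ℝ} (h : x ∈ cell n j s) : |(n : ℝ) ^ j * (x - s)| < 1 := by
  rw [mul_sub]
  exact Int.abs_sub_lt_one_of_floor_eq_floor h

lemma measurableSet_of_cell {j : ℕ} {E : Set ℝ} (hE : ∀ x ∈ E, cell n j x ⊆ E) :
    MeasurableSet E := by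
  have : E = (fun x : ℝ => ⌊(n : ℝ) ^ j * x⌋) ⁻¹' ((fun x : ℝ => ⌊(n : ℝ) ^ j * x⌋) '' E) := by
    ext x
    constructor
    · exact fun h => ⟨x, h, rfl⟩
    · rintro ⟨y, hy, h⟩
      exact hE y hy h.symm
  rw [this]
  exact (Int.measurable_floor.comp (measurable_const_mul _)) (MeasurableSet.of_discrete)

lemma measurable_cell_fun {β : Type*} [MeasurableSpace β] {j : ℕ} {F : ℝ → β}
    (hF : ∀ s x, x ∈ cell n j s → F x = F s) : Measurable F := by
  intro B _
  exact measurableSet_of_cell (n := n) (j := j) fun x hx y hy => by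
    simpa [hF x y hy] using hx

lemma cell_sat_le {j : ℕ} {E : Set ℝ} (hE : ∀ x ∈ E, cell n j x ⊆ E) (ν₁ ν₂ : Measure ℝ)
    (h : ∀ x ∈ E, ν₁ (cell n j x) ≤ ν₂ (cell n j x)) : ν₁ E ≤ ν₂ E := by
  set Z : Set ℤ := (fun x : ℝ => ⌊(n : ℝ) ^ j * x⌋) '' E
  have hEu : E = ⋃ z ∈ Z, {x : ℝ | ⌊(n : ℝ) ^ j * x⌋ = z} := by
    ext x
    simp only [Set.mem_iUnion, Set.mem_ofPred_eq, exists_prop]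
    constructor
    · exact fun h => ⟨_, ⟨x, h, rfl⟩, rfl⟩
    · rintro ⟨z, ⟨y, hy, h⟩, hx⟩
      exact hE y hy (hx.trans h.symm)
  have hd : Z.PairwiseDisjoint fun z => {x : ℝ | ⌊(n : ℝ) ^ j * x⌋ = z} := by
    intro a _ b _ hab
    refine Set.disjoint_left.mpr fun x hx hx' => hab ?_
    exact hx.symm.trans hx'
  have hm : ∀ z ∈ Z, MeasurableSet {x : ℝ | ⌊(n : ℝ) ^ j * x⌋ = z} := fun z _ =>
    (Int.measurable_floor.comp (measurable_const_mul _)) (MeasurableSet.singleton z)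
  rw [hEu, measure_biUnion (Set.to_countable Z) hd hm, measure_biUnion (Set.to_countable Z) hd hm]
  refine ENNReal.tsum_le_tsum fun ⟨z, x, hx, hz⟩ => ?_
  have := h x hx
  simp only at hz
  unfold cell at this
  rwa [hz] at this

/-- Maximal inequality for nested cells. -/
lemma cell_max (hn : 2 ≤ n) (ν₁ ν₂ : Measure ℝ) (J : ℕ) :
    ν₁ {s | ∃ j < J, ν₁ (cell n j s) ≤ ν₂ (cell n j s)} ≤
      ν₂ {s | ∃ j < J, ν₁ (cell n j s) ≤ ν₂ (cell n j s)} := by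
  induction J with
  | zero => simp
  | succ J ih =>
    set E : ℕ → Set ℝ := fun J => {s | ∃ j < J, ν₁ (cell n j s) ≤ ν₂ (cell n j s)} with hEdef
    change ν₁ (E (J + 1)) ≤ ν₂ (E (J + 1))
    have hsat : ∀ J, ∀ x ∈ E J, cell n J x ⊆ E J := by
      rintro J x ⟨j, hj, h⟩ y hy
      refine ⟨j, hj, ?_⟩
      rwa [cell_eq (cell_anti hn hj.le x hy)]
    have hmE : MeasurableSet (E J) := measurableSet_of_cell (hsat J)
    set F : Set ℝ := E (J + 1) \ E J with hF
    have hFc : ∀ x ∈ F, cell n J x ⊆ F := by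
      rintro x ⟨⟨j, hj, h⟩, hx'⟩ y hy
      have hjJ : j = J := by
        by_contra hne
        exact hx' ⟨j, by omega, h⟩
      subst hjJ
      refine ⟨⟨j, hj, ?_⟩, fun h' => hx' (hsat j y h' (mem_cell_comm.mp hy))⟩
      rwa [cell_eq hy]
    have hmF : MeasurableSet F := measurableSet_of_cell hFc
    have hU : E (J + 1) = E J ∪ F := by
      rw [hF, Set.union_sdiff_cancel]
      rintro x ⟨j, hj, h⟩
      exact ⟨j, by omega, h⟩
    rw [hU, measure_union Set.disjoint_sdiff_right hmF, measure_union Set.disjoint_sdiff_right hmF]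
    refine add_le_add ih (cell_sat_le hFc ν₁ ν₂ ?_)
    rintro x ⟨⟨j, hj, h⟩, hx'⟩
    have hjJ : j = J := by
      by_contra hne
      exact hx' ⟨j, by omega, h⟩
    rwa [← hjJ]

end Cells

section Hereditary
variable {n : ℕ} {μ : Measure ℝ} [IsProbabilityMeasure μ] {P : ℝ → ℤ → Prop}

/-- The property `P` (at time `i`) charges some earlier cell around `s` at proportion `≥ c`. -/
def Heavy (n : ℕ) (μ : Measure ℝ) (P : ℝ → ℤ → Prop) (c : ℝ) (s : ℝ) (i : ℤ) : Prop :=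
  ∃ j : ℕ, (j : ℤ) ≤ i ∧ ENNReal.ofReal c * μ (cell n j s) ≤ μ ({x | P x i} ∩ cell n j s)

/-- The property `P` charges all earlier cells around `s` at proportion `> c`. -/
def Dense (n : ℕ) (μ : Measure ℝ) (P : ℝ → ℤ → Prop) (c : ℝ) (s : ℝ) (i : ℤ) : Prop :=
  ∀ j : ℕ, (j : ℤ) ≤ i → ENNReal.ofReal c * μ (cell n j s) < μ ({x | P x i} ∩ cell n j s)

lemma MSet.heavy (c : ℝ) : MSet (Heavy n μ P c) := by
  refine MSet.ex fun j => MSet.and MSet.cst ?_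
  intro i
  refine measurableSet_of_cell (n := n) (j := j) fun x hx y hy => ?_
  simpa [cell_eq hy] using hx

lemma MSet.dense (c : ℝ) : MSet (Dense n μ P c) := by
  refine MSet.all fun j => ?_
  intro i
  refine measurableSet_of_cell (n := n) (j := j) fun x hx y hy => ?_
  simpa [cell_eq hy] using hx

lemma mS_le_of_measure {Q R : ℝ → ℤ → Prop} (hQ : MSet Q) (hR : MSet R) {a b : ℝ}
    (h : ∀ i : ℕ, μ.real {s | Q s i} ≤ a * μ.real {s | R s i} + b) :
    mS μ Q ≤ a * mS μ R + b := by
  have e : a * mS μ R + b = mean μ fun s i => a * ind R s i + b := by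
    rw [mean_add (hR.adm.const_mul a) (Adm.const b), mean_const_mul a hR.adm, mean_const]; rfl
  rw [e]
  refine mean_le_of_avg hQ.adm ((hR.adm.const_mul a).add (Adm.const b))
    (Eventually.of_forall fun I => ?_)
  refine div_le_div_of_nonneg_right (sum_le_sum fun i _ => ?_) (by positivity)
  rw [integral_add ((hR.adm.const_mul a).integrable _) (integrable_const b), integral_const_mul,
    integral_ind hQ, integral_ind hR]
  simpa using h i

lemma mS_heavy_le (hn : 2 ≤ n) (hP : MSet P) {c : ℝ} (hc : 0 < c) :
    mS μ (Heavy n μ P c) ≤ mS μ P / c := by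
  have := mS_le_of_measure (μ := μ) (Q := Heavy n μ P c) (R := P) (MSet.heavy c) hP (a := 1 / c)
    (b := 0) fun i => ?_
  · calc _ ≤ _ := this
      _ = _ := by ring
  have h := cell_max hn (ENNReal.ofReal c • μ) (μ.restrict {x | P x i}) (i + 1)
  have hset : {s | ∃ j < i + 1, (ENNReal.ofReal c • μ) (cell n j s) ≤
      (μ.restrict {x | P x i}) (cell n j s)} = {s | Heavy n μ P c s i} := by
    ext s
    simp only [Heavy, Set.mem_ofPred_eq, Measure.smul_apply, smul_eq_mul,
      Measure.restrict_apply (measurableSet_cell _ _), Set.inter_comm {x | P x i}]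
    exact exists_congr fun j => and_congr_left' (by omega)
  rw [hset, Measure.smul_apply, smul_eq_mul] at h
  have h2 : ENNReal.ofReal c * μ {s | Heavy n μ P c s i} ≤ μ {x | P x i} :=
    h.trans (by
      rw [Measure.restrict_apply (MSet.heavy c i)]
      exact measure_mono Set.inter_subset_right)
  have h3 := ENNReal.toReal_mono (measure_ne_top _ _) h2
  rw [ENNReal.toReal_mul, ENNReal.toReal_ofReal hc.le] at h3
  rw [add_zero, one_div, inv_mul_eq_div, le_div_iff₀' hc]
  exact h3

lemma mS_le_dense (hn : 2 ≤ n) (hP : MSet P) {c : ℝ} (hc : 0 < c) :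
    mS μ P ≤ mS μ (Dense n μ P c) + c := by
  have := mS_le_of_measure (μ := μ) (Q := P) (R := Dense n μ P c) hP (MSet.dense c) (a := 1)
    (b := c) fun i => ?_
  · simpa using this
  have h := cell_max hn (μ.restrict {x | P x i}) (ENNReal.ofReal c • μ) (i + 1)
  have hset : {s | ∃ j < i + 1, (μ.restrict {x | P x i}) (cell n j s) ≤
      (ENNReal.ofReal c • μ) (cell n j s)} = {s | ¬ Dense n μ P c s i} := by
    ext s
    simp only [Dense, Set.mem_ofPred_eq, Measure.smul_apply, smul_eq_mul,
      Measure.restrict_apply (measurableSet_cell _ _), Set.inter_comm {x | P x i}]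
    push Not
    exact exists_congr fun j => and_congr_left' (by omega)
  rw [hset, Measure.smul_apply, smul_eq_mul, Measure.restrict_apply ((MSet.dense c).not i)] at h
  have h2 : μ {s | P s i} ≤ μ {s | Dense n μ P c s i} + ENNReal.ofReal c := by
    calc μ {s | P s i} ≤ μ ({s | Dense n μ P c s i} ∪ ({s | ¬ Dense n μ P c s i} ∩ {s | P s i})) :=
          measure_mono fun s hs => by
            by_cases hd : Dense n μ P c s i
            · exact Or.inl hd
            · exact Or.inr ⟨hd, hs⟩
      _ ≤ _ := measure_union_le _ _
      _ ≤ _ := by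
        gcongr
        exact h.trans (mul_le_of_le_one_right (by positivity) prob_le_one)
  have h3 := ENNReal.toReal_mono (by finiteness) h2
  rw [ENNReal.toReal_add (by finiteness) (by finiteness), ENNReal.toReal_ofReal hc.le] at h3
  simpa [Measure.real] using h3

end Hereditary
end CFP

namespace CFP
open Finset Topology

/-- Real `2 × 2` matrices. -/
abbrev Mat := Matrix (Fin 2) (Fin 2) ℝ
/-- Integer `2 × 2` matrices. -/
abbrev ZMat := Matrix (Fin 2) (Fin 2) ℤ

/-- The real matrix of an integer matrix. -/
def toR (γ : ZMat) : Mat := γ.map (Int.cast : ℤ → ℝ)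

/-- The matrix `a_t u_s`. -/
noncomputable def X (s t : ℝ) : Mat := !![Real.exp t, -(Real.exp t * s); 0, Real.exp (-t)]

/-- The unipotent matrix `u_r`. -/
def uni (r : ℝ) : Mat := !![1, -r; 0, 1]

/-- Entrywise closeness to the identity. -/
def Near (η : ℝ) (g : Mat) : Prop := ∀ i j, |g i j - (1 : Mat) i j| ≤ η

/-- Every nonzero vector of the lattice `X s t * ℤ²` has sup norm at least `δ`. -/
def Thick (δ s t : ℝ) : Prop := ∀ m k : ℤ, ¬(m = 0 ∧ k = 0) →
  δ ≤ max |Real.exp t * ((m : ℝ) - (k : ℝ) * s)| |Real.exp (-t) * (k : ℝ)|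

@[simp] lemma toR_apply (γ : ZMat) (i j : Fin 2) : toR γ i j = (γ i j : ℝ) := rfl

lemma toR_mul (γ σ : ZMat) : toR (γ * σ) = toR γ * toR σ := Matrix.map_mul_intCast ..

lemma toR_one : toR 1 = 1 := by
  ext i j; fin_cases i <;> fin_cases j <;> simp [toR]

lemma toR_det (γ : ZMat) : (toR γ).det = γ.det := by
  simp [Matrix.det_fin_two]

lemma det_X (s t : ℝ) : (X s t).det = 1 := by
  simp [X, Matrix.det_fin_two, ← Real.exp_add]

lemma uni_mul_X (ρ s t : ℝ) : uni ρ * X s t = X (s + ρ * Real.exp (-(2 * t))) t := by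
  have h : Real.exp (-t) = Real.exp t * Real.exp (-(2 * t)) := by
    rw [← Real.exp_add]; ring_nf
  ext i j
  fin_cases i <;> fin_cases j <;> simp [uni, X, Matrix.mul_apply]
  rw [h]; ring

lemma X_add_int (s t : ℝ) (m : ℤ) : X (s + m) t = X s t * toR !![1, -m; 0, 1] := by
  ext i j
  fin_cases i <;> fin_cases j <;> simp [X, Matrix.mul_apply]
  ring

lemma uni_add (r r' : ℝ) : uni r * uni r' = uni (r + r') := by
  ext i j
  fin_cases i <;> fin_cases j <;> simp [uni, Matrix.mul_apply]

lemma uni_zero : uni 0 = 1 := by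
  ext i j
  fin_cases i <;> fin_cases j <;> simp [uni]

lemma X_scale {N τ : ℝ} (hN : Real.exp (2 * τ) = N) (s t : ℝ) :
    X (N * s) (t - τ) = Real.exp (-τ) • (X s t * !![1, 0; 0, N]) := by
  have h1 : Real.exp (t - τ) = Real.exp (-τ) * Real.exp t := by
    rw [← Real.exp_add]; ring_nf
  have h2 : Real.exp (τ - t) = Real.exp (-τ) * (Real.exp (-t) * N) := by
    rw [← hN, ← Real.exp_add, ← Real.exp_add]; ring_nf
  ext i j
  fin_cases i <;> fin_cases j <;> simp [X, Matrix.mul_apply, h1, h2]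
  ring

/-- Relations between lattices persist under `(s, t) ↦ (N s, t - τ)` with `e^{2τ} = N`. -/
lemma X_rel_scale {N : ℤ} {τ : ℝ} (hN : Real.exp (2 * τ) = N) {s₁ t₁ s₂ t₂ : ℝ} {g : Mat}
    {γ : ZMat} (hdet : γ.det = 1) {c : ℤ} (hc : γ 1 0 = N * c)
    (h : X s₂ t₂ = g * X s₁ t₁ * toR γ) :
    ∃ γ' : ZMat, γ'.det = 1 ∧ γ' 1 0 = c ∧
      X (N * s₂) (t₂ - τ) = g * X (N * s₁) (t₁ - τ) * toR γ' := by
  refine ⟨!![γ 0 0, N * γ 0 1; c, γ 1 1], ?_, rfl, ?_⟩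
  · rw [← hdet, Matrix.det_fin_two, Matrix.det_fin_two, hc]
    simp; ring
  · have e : toR γ * !![1, 0; 0, (N : ℝ)]
        = !![1, 0; 0, (N : ℝ)] * toR !![γ 0 0, N * γ 0 1; c, γ 1 1] := by
      ext i j
      fin_cases i <;> fin_cases j <;> simp [Matrix.mul_apply, hc, mul_comm]
    rw [X_scale hN, X_scale hN, h, Matrix.mul_smul, Matrix.smul_mul, Matrix.mul_assoc _ (toR γ), e]
    simp only [Matrix.mul_assoc]

/-- Conjugation of a relation between two lattices by a unipotent and a diagonal matrix. -/
lemma X_rel_shear {s₁ t₁ s₂ t₂ : ℝ} {g : Mat} {γ : ZMat} (h : X s₂ t₂ = g * X s₁ t₁ * toR γ)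
    (ρ τ : ℝ) :
    X (s₂ + ρ * Real.exp (-(2 * t₂))) (t₂ - τ) =
      !![g 0 0 - ρ * g 1 0,
          Real.exp (-(2 * τ)) * (g 0 1 + (ρ * (g 0 0 - g 1 1) - ρ ^ 2 * g 1 0));
        Real.exp (2 * τ) * g 1 0, g 1 1 + ρ * g 1 0] *
      X (s₁ + ρ * Real.exp (-(2 * t₁))) (t₁ - τ) * toR γ := by
  have hd : ∀ s t : ℝ, X s (t - τ) = !![Real.exp (-τ), 0; 0, Real.exp τ] * X s t := by
    intro s t
    ext i j
    fin_cases i <;> fin_cases j <;> simp [X, Matrix.mul_apply, sub_eq_add_neg, Real.exp_add,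
      mul_comm, mul_assoc, mul_left_comm]
  rw [hd, hd, ← uni_mul_X, ← uni_mul_X, h]
  have e : !![Real.exp (-τ), 0; 0, Real.exp τ] * (uni ρ * g) =
      !![g 0 0 - ρ * g 1 0,
          Real.exp (-(2 * τ)) * (g 0 1 + (ρ * (g 0 0 - g 1 1) - ρ ^ 2 * g 1 0));
        Real.exp (2 * τ) * g 1 0, g 1 1 + ρ * g 1 0] *
      (!![Real.exp (-τ), 0; 0, Real.exp τ] * uni ρ) := by
    have h1 : Real.exp (-(2 * τ)) * Real.exp τ = Real.exp (-τ) := by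
      rw [← Real.exp_add]; ring_nf
    have h2 : Real.exp (2 * τ) * Real.exp (-τ) = Real.exp τ := by
      rw [← Real.exp_add]; ring_nf
    clear h
    obtain ⟨a, b, c, d, rfl⟩ : ∃ a b c d, g = !![a, b; c, d] := ⟨_, _, _, _, Matrix.eta_fin_two g⟩
    ext i j
    fin_cases i <;> fin_cases j <;> simp [uni, Matrix.mul_apply]
    · ring
    · linear_combination (-(b + (ρ * (a - d) - ρ ^ 2 * c))) * h1
    · linear_combination (-c) * h2
    · linear_combination (ρ * c) * h2
  have := congrArg (· * (X s₁ t₁ * toR γ)) e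
  simpa only [Matrix.mul_assoc] using this

lemma X_rel_entries {s₁ t₁ s₂ t₂ : ℝ} {g : Mat} {γ : ZMat} (hdet : γ.det = 1)
    (h : X s₂ t₂ = g * X s₁ t₁ * toR γ) :
    g 1 0 = -(γ 1 0) * Real.exp (-(t₁ + t₂)) ∧
      (γ 1 0 = 0 → |g 0 0| = Real.exp (t₂ - t₁)) := by
  rw [Matrix.det_fin_two] at hdet
  have hR : (γ 0 0 : ℝ) * γ 1 1 - γ 0 1 * γ 1 0 = 1 := by exact_mod_cast hdet
  have e00 := congrFun (congrFun h 0) 0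
  have e10 := congrFun (congrFun h 1) 0
  have e11 := congrFun (congrFun h 1) 1
  simp [X, Matrix.mul_apply, Fin.sum_univ_two] at e00 e10 e11
  constructor
  · have h1 : g 1 0 * Real.exp t₁ = -(γ 1 0) * Real.exp (-t₂) := by
      linear_combination (-(g 1 0 * Real.exp t₁)) * hR - (γ 1 1 : ℝ) * e10 - (-(γ 1 0 : ℝ)) * e11
    have h2 : Real.exp t₁ * Real.exp (-t₁) = 1 := by rw [← Real.exp_add]; simp
    rw [neg_add, Real.exp_add]
    linear_combination (-(g 1 0)) * h2 + Real.exp (-t₁) * h1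
  · intro hc
    have hu : IsUnit (γ 0 0) := by
      refine IsUnit.of_mul_eq_one (γ 1 1) ?_
      rw [hc] at hdet; linarith
    have h1 : Real.exp t₂ = g 0 0 * Real.exp t₁ * γ 0 0 := by rw [e00, hc]; simp
    have h2 : |(γ 0 0 : ℝ)| = 1 := by
      rcases Int.isUnit_iff.mp hu with h | h <;> simp [h]
    have h3 := congrArg abs h1
    rw [abs_mul, abs_mul, h2, Real.abs_exp, Real.abs_exp, mul_one] at h3
    rw [Real.exp_sub, h3]
    field_simp

/-- A thick lattice has a bounded basis. -/
lemma exists_bounded_basis {δ s t : ℝ} (hδ : 0 < δ) (h : Thick δ s t) :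
    ∃ σ : ZMat, σ.det = 1 ∧ ∀ i j, |(X s t * toR σ) i j| ≤ 1 + 2 / δ := by
  obtain ⟨m, k, hmk, hm1, hk1⟩ : ∃ m k : ℤ, ¬(m = 0 ∧ k = 0) ∧
      |Real.exp t * ((m : ℝ) - k * s)| ≤ 1 ∧ |Real.exp (-t) * (k : ℝ)| ≤ 1 := by
    rcases le_or_gt 0 t with ht | ht
    · have hN : 0 < ⌊Real.exp t⌋₊ := Nat.floor_pos.mpr (Real.one_le_exp ht)
      obtain ⟨j, k, hk, hkN, hjk⟩ := Real.exists_int_int_abs_mul_sub_le s hN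
      have hNle : (⌊Real.exp t⌋₊ : ℝ) ≤ Real.exp t := Nat.floor_le (Real.exp_pos _).le
      have hNlt := Nat.lt_floor_add_one (Real.exp t)
      refine ⟨j, k, by omega, ?_, ?_⟩
      · rw [abs_mul, Real.abs_exp, abs_sub_comm]
        calc _ ≤ Real.exp t * (1 / (⌊Real.exp t⌋₊ + 1)) := by gcongr
          _ ≤ 1 := by rw [mul_one_div, div_le_one (by positivity)]; exact hNlt.le
      · rw [abs_mul, Real.abs_exp, Real.exp_neg, abs_of_pos (by exact_mod_cast hk), ← div_eq_inv_mul,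
          div_le_one (Real.exp_pos _)]
        have : (k : ℝ) ≤ (⌊Real.exp t⌋₊ : ℝ) := by exact_mod_cast hkN
        linarith
    · refine ⟨1, 0, by simp, ?_, by simp⟩
      simpa using ht.le
  have hg : 0 < Int.gcd m k := Int.gcd_pos_iff.mpr (by tauto)
  obtain ⟨p, q, hpq, hp, hq⟩ : ∃ p q : ℤ, IsCoprime p q ∧ m = p * Int.gcd m k ∧
      k = q * Int.gcd m k := by
    obtain ⟨p, q, hpq, hp, hq⟩ := Int.exists_gcd_one hg
    exact ⟨p, q, Int.isCoprime_iff_gcd_eq_one.mpr hpq, hp, hq⟩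
  have hg1 : (1 : ℝ) ≤ (Int.gcd m k : ℝ) := by exact_mod_cast hg
  have hdivide : ∀ a : ℝ, |a * (Int.gcd m k : ℝ)| ≤ 1 → |a| ≤ 1 := by
    intro a ha
    rw [abs_mul, Nat.abs_cast] at ha
    nlinarith [abs_nonneg a]
  set w1 : ℝ := Real.exp t * ((p : ℝ) - q * s) with hw1
  set w2 : ℝ := Real.exp (-t) * (q : ℝ) with hw2
  have hw1le : |w1| ≤ 1 := by
    apply hdivide
    have hp' : (m : ℝ) = p * Int.gcd m k := by exact_mod_cast hp
    have hq' : (k : ℝ) = q * Int.gcd m k := by exact_mod_cast hq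
    have : w1 * (Int.gcd m k : ℝ) = Real.exp t * ((m : ℝ) - k * s) := by
      linear_combination (-Real.exp t) * hp' + Real.exp t * s * hq'
    rwa [this]
  have hw2le : |w2| ≤ 1 := by
    apply hdivide
    have hq' : (k : ℝ) = q * Int.gcd m k := by exact_mod_cast hq
    have : w2 * (Int.gcd m k : ℝ) = Real.exp (-t) * (k : ℝ) := by
      linear_combination (-Real.exp (-t)) * hq'
    rwa [this]
  have hpq0 : ¬(p = 0 ∧ q = 0) := by
    rintro ⟨h1, h2⟩
    exact hmk ⟨by rw [hp, h1, zero_mul], by rw [hq, h2, zero_mul]⟩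
  have hthick : δ ≤ max |w1| |w2| := h p q hpq0
  obtain ⟨b, a, hab⟩ := hpq
  have key : ∀ z : ℤ, ((!![p, -a + z * p; q, b + z * q] : ZMat).det = 1) ∧
      ∀ i j, (X s t * toR !![p, -a + z * p; q, b + z * q]) i j =
        (!![w1, Real.exp t * ((-a : ℝ) - b * s) + z * w1; w2, Real.exp (-t) * b + z * w2] : Mat)
          i j := by
    intro z
    constructor
    · rw [Matrix.det_fin_two]; simp; linarith
    · intro i j
      fin_cases i <;> fin_cases j <;> simp [X, Matrix.mul_apply, Fin.sum_univ_two, hw1, hw2] <;>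
        ring
  have hround : ∀ x w : ℝ, w ≠ 0 → ∃ z : ℤ, |x + z * w| ≤ |w| := by
    intro x w hw
    refine ⟨-⌊x / w⌋, ?_⟩
    have h1 : x + ((-⌊x / w⌋ : ℤ) : ℝ) * w = w * Int.fract (x / w) := by
      rw [Int.fract]; push_cast; field_simp; ring
    rw [h1, abs_mul, abs_of_nonneg (Int.fract_nonneg (x / w))]
    exact mul_le_of_le_one_right (abs_nonneg _) (Int.fract_lt_one _).le
  have hdetw : ∀ z : ℤ, w1 * (Real.exp (-t) * b + z * w2) -
      (Real.exp t * ((-a : ℝ) - b * s) + z * w1) * w2 = 1 := by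
    intro z
    have h1 : Real.exp t * Real.exp (-t) = 1 := by rw [← Real.exp_add]; simp
    have h2 : (b : ℝ) * p + a * q = 1 := by exact_mod_cast hab
    rw [hw1, hw2]
    linear_combination (b * p + a * q : ℝ) * h1 + h2
  have hpos : 0 < 2 / δ := by positivity
  rcases le_max_iff.mp hthick with h1 | h1
  · have hw0 : w1 ≠ 0 := by rintro h0; rw [h0, abs_zero] at h1; linarith
    obtain ⟨z, hz⟩ := hround (Real.exp t * ((-a : ℝ) - b * s)) w1 hw0
    refine ⟨_, (key z).1, fun i j => ?_⟩
    rw [(key z).2 i j]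
    have hd := hdetw z
    set x := Real.exp t * ((-a : ℝ) - b * s) + z * w1
    set y := Real.exp (-t) * b + z * w2
    have hy : |y| ≤ 2 / δ := by
      have : |w1| * |y| ≤ 2 := by
        rw [← abs_mul, show w1 * y = 1 + x * w2 by linarith]
        refine (abs_add_le _ _).trans ?_
        rw [abs_mul, abs_one]
        nlinarith [abs_nonneg x, abs_nonneg w2]
      rw [le_div_iff₀ hδ]
      nlinarith [abs_nonneg y]
    fin_cases i <;> fin_cases j <;> simp <;> linarith
  · have hw0 : w2 ≠ 0 := by rintro h0; rw [h0, abs_zero] at h1; linarith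
    obtain ⟨z, hz⟩ := hround (Real.exp (-t) * b) w2 hw0
    refine ⟨_, (key z).1, fun i j => ?_⟩
    rw [(key z).2 i j]
    have hd := hdetw z
    set x := Real.exp t * ((-a : ℝ) - b * s) + z * w1
    set y := Real.exp (-t) * b + z * w2
    have hx : |x| ≤ 2 / δ := by
      have : |w2| * |x| ≤ 2 := by
        rw [← abs_mul, show w2 * x = w1 * y + -1 by linarith]
        refine (abs_add_le _ _).trans ?_
        rw [abs_mul, abs_neg, abs_one]
        nlinarith [abs_nonneg y, abs_nonneg w1]
      rw [le_div_iff₀ hδ]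
      nlinarith [abs_nonneg x]
    fin_cases i <;> fin_cases j <;> simp <;> linarith

/-- Among sufficiently many thick lattices, two are almost equal, with a change of basis in a
prescribed congruence subgroup. -/
lemma thick_pigeonhole (N : ℕ) [NeZero N] {δ η : ℝ} (hδ : 0 < δ) (hη : 0 < η) :
    ∃ B : ℕ, ∀ (S : Finset ℕ) (z t : ℕ → ℝ), B < S.card → (∀ k ∈ S, Thick δ (z k) (t k)) →
      ∃ k₁ ∈ S, ∃ k₂ ∈ S, k₁ < k₂ ∧ ∃ (g : Mat) (γ : ZMat), Near η g ∧ γ.det = 1 ∧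
        (N : ℤ) ∣ γ 1 0 ∧ X (z k₂) (t k₂) = g * X (z k₁) (t k₁) * toR γ := by
  classical
  set C : ℝ := 1 + 2 / δ
  have hC : 0 < C := by positivity
  set θ : ℝ := η / (2 * C)
  have hθ : 0 < θ := by positivity
  set L : ℤ := ⌈C / θ⌉ + 1
  let κ := (Fin 2 → Fin 2 → Finset.Icc (-L) L) × (Fin 2 → Fin 2 → ZMod N)
  refine ⟨Fintype.card κ, fun S z t hcard hth => ?_⟩
  choose! σ hσd hσb using fun k (hk : k ∈ S) => exists_bounded_basis hδ (hth k hk)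
  have hfl : ∀ k ∈ S, ∀ i j, ⌊(X (z k) (t k) * toR (σ k)) i j / θ⌋ ∈ Finset.Icc (-L) L := by
    intro k hk i j
    have h1 := abs_le.mp (hσb k hk i j)
    have h2 := Int.le_ceil (C / θ)
    rw [Finset.mem_Icc]
    constructor
    · rw [Int.le_floor]
      have : -(C / θ) ≤ (X (z k) (t k) * toR (σ k)) i j / θ := by
        rw [← neg_div]; gcongr; exact h1.1
      push_cast [L]; linarith
    · have h3 : (X (z k) (t k) * toR (σ k)) i j / θ ≤ C / θ := by gcongr; exact h1.2
      have := (Int.floor_le_floor h3).trans ((Int.floor_le_ceil (C / θ)))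
      omega
  have hL : (0 : ℤ) ∈ Finset.Icc (-L) L := by
    have : 0 ≤ ⌈C / θ⌉ := Int.ceil_nonneg (by positivity)
    rw [Finset.mem_Icc]; omega
  let cls : ℕ → κ := fun k =>
    (fun i j => if h : _ then ⟨⌊(X (z k) (t k) * toR (σ k)) i j / θ⌋, h⟩ else ⟨0, hL⟩,
      fun i j => (σ k i j : ZMod N))
  obtain ⟨x, hx, y, hy, hxy, hc⟩ := Finset.exists_ne_map_eq_of_card_lt_of_maps_to
    (s := S) (t := (Finset.univ : Finset κ)) (by simpa using hcard) (f := cls)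
    (fun _ _ => Finset.mem_coe.mpr (Finset.mem_univ _))
  have main : ∀ x ∈ S, ∀ y ∈ S, x < y → cls x = cls y → ∃ k₁ ∈ S, ∃ k₂ ∈ S, k₁ < k₂ ∧
      ∃ (g : Mat) (γ : ZMat), Near η g ∧ γ.det = 1 ∧
        (N : ℤ) ∣ γ 1 0 ∧ X (z k₂) (t k₂) = g * X (z k₁) (t k₁) * toR γ := by
    intro x hx y hy hlt hc
    have h1 : ∀ i j, ⌊(X (z x) (t x) * toR (σ x)) i j / θ⌋ = ⌊(X (z y) (t y) * toR (σ y)) i j / θ⌋ := by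
      intro i j
      have := congrFun (congrFun (congrArg Prod.fst hc) i) j
      simp only [cls, dif_pos (hfl x hx i j), dif_pos (hfl y hy i j)] at this
      exact congrArg Subtype.val this
    have h2 : ∀ i j, (σ x i j : ZMod N) = σ y i j := fun i j =>
      congrFun (congrFun (congrArg Prod.snd hc) i) j
    have hcl : ∀ i j, |(X (z y) (t y) * toR (σ y)) i j - (X (z x) (t x) * toR (σ x)) i j| ≤ θ := by
      intro i j
      have := Int.abs_sub_lt_one_of_floor_eq_floor (h1 i j).symm
      rw [← sub_div, abs_div, abs_of_pos hθ, div_lt_one hθ] at this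
      exact this.le
    set W₁ : Mat := X (z x) (t x) * toR (σ x) with hW₁
    set W₂ : Mat := X (z y) (t y) * toR (σ y) with hW₂
    have hd1 : W₁.det = 1 := by rw [hW₁, Matrix.det_mul, det_X, toR_det, hσd x hx]; simp
    have hi1 : W₁.adjugate * W₁ = 1 := by rw [Matrix.adjugate_mul, hd1, one_smul]
    have hi1' : W₁ * W₁.adjugate = 1 := by rw [Matrix.mul_adjugate, hd1, one_smul]
    have hs : toR (σ y) * toR (σ y).adjugate = 1 := by
      rw [← toR_mul, Matrix.mul_adjugate, hσd y hy, one_smul, toR_one]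
    have hdvd : ∀ i j, ((N : ℤ) ∣ σ x i j - σ y i j) := by
      intro i j
      rw [← ZMod.intCast_zmod_eq_zero_iff_dvd]
      push_cast
      rw [h2 i j, sub_self]
    refine ⟨x, hx, y, hy, hlt, W₂ * W₁.adjugate, σ x * (σ y).adjugate, ?_, ?_, ?_, ?_⟩
    · intro i j
      have e : (W₂ * W₁.adjugate) i j - (1 : Mat) i j = ((W₂ - W₁) * W₁.adjugate) i j := by
        rw [Matrix.sub_mul, hi1', Matrix.sub_apply]
      rw [e, Matrix.mul_apply, Fin.sum_univ_two]
      have hadj : ∀ i j, |W₁.adjugate i j| ≤ C := by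
        intro i j
        rw [Matrix.adjugate_fin_two]
        have := hσb x hx
        fin_cases i <;> fin_cases j <;> simp <;> apply this
      calc _ ≤ |(W₂ - W₁) i 0 * W₁.adjugate 0 j| + |(W₂ - W₁) i 1 * W₁.adjugate 1 j| :=
            abs_add_le _ _
        _ ≤ θ * C + θ * C := by
            rw [abs_mul, abs_mul]
            exact add_le_add (mul_le_mul (hcl i 0) (hadj 0 j) (abs_nonneg _) hθ.le)
              (mul_le_mul (hcl i 1) (hadj 1 j) (abs_nonneg _) hθ.le)
        _ = η := by simp only [θ]; field_simp; ring
    · rw [Matrix.det_mul, hσd x hx, Matrix.det_adjugate, hσd y hy]; simp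
    · have e : (σ x * (σ y).adjugate) 1 0 =
          (σ x 1 0 - σ y 1 0) * σ y 1 1 - (σ x 1 1 - σ y 1 1) * σ y 1 0 := by
        rw [Matrix.adjugate_fin_two, Matrix.mul_apply, Fin.sum_univ_two]
        simp; ring
      rw [e]
      exact dvd_sub ((hdvd 1 0).mul_right _) ((hdvd 1 1).mul_right _)
    · rw [toR_mul]
      calc X (z y) (t y) = X (z y) (t y) * (toR (σ y) * toR (σ y).adjugate) := by
            rw [hs, Matrix.mul_one]
        _ = W₂ * (W₁.adjugate * W₁) * toR (σ y).adjugate := by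
            rw [hi1, Matrix.mul_one, hW₂, Matrix.mul_assoc]
        _ = _ := by rw [hW₁]; simp only [Matrix.mul_assoc]
  rcases lt_or_gt_of_ne hxy with h | h
  · exact main x hx y hy h hc
  · exact main y hy x hx h hc.symm

end CFP

namespace CFP
open Finset Topology

section Dim
variable {n : ℕ} {μ : Measure ℝ} [IsProbabilityMeasure μ]

/-- The `n`-adic cell of generation `k` with index `z`. -/
def idx (n k : ℕ) (z : ℤ) : Set ℝ := {x | ⌊(n : ℝ) ^ k * x⌋ = z}

lemma measurableSet_idx (k : ℕ) (z : ℤ) : MeasurableSet (idx n k z) :=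
  (Int.measurable_floor.comp (measurable_const_mul _)) (MeasurableSet.singleton _)

lemma cell_eq_idx (k : ℕ) (s : ℝ) : cell n k s = idx n k ⌊(n : ℝ) ^ k * s⌋ := rfl

lemma tsum_idx_le (k : ℕ) : ∑' z, μ (idx n k z) ≤ 1 := by
  have hd : Pairwise fun a b => Disjoint (idx n k a) (idx n k b) := by
    intro a b hab
    refine Set.disjoint_left.mpr fun x hx hx' => hab ?_
    exact hx.symm.trans hx'
  rw [← measure_iUnion hd (measurableSet_idx k)]
  exact prob_le_one

lemma ae_cell_ne_zero (k : ℕ) : ∀ᵐ s ∂μ, μ (cell n k s) ≠ 0 := by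
  have : μ {s | μ (cell n k s) = 0} ≤ (0 : Measure ℝ) {s | μ (cell n k s) = 0} := by
    refine cell_sat_le (n := n) (j := k) (fun x hx y hy => ?_) μ 0 fun x hx => ?_
    · simpa [cell_eq hy] using hx
    · simpa using hx
  rw [ae_iff]
  simpa using this

/-- Information function of the `n`-adic partition of generation `k`. -/
noncomputable def info (n : ℕ) (μ : Measure ℝ) (k : ℕ) (s : ℝ) : ℝ :=
  -Real.log (μ.real (cell n k s))

lemma measurable_info (k : ℕ) : Measurable (info n μ k) :=
  measurable_cell_fun (n := n) (j := k) fun s x hx => by simp [info, cell_eq hx]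

lemma info_nonneg (k : ℕ) (s : ℝ) : 0 ≤ info n μ k s :=
  neg_nonneg.mpr (Real.log_nonpos measureReal_nonneg measureReal_le_one)

lemma lintegral_div_cell_le (k : ℕ) (w : ℤ → ENNReal) :
    ∫⁻ s, w ⌊(n : ℝ) ^ k * s⌋ / μ (cell n k s) ∂μ ≤ ∑' z, w z := by
  have hm : Measurable fun s : ℝ => ⌊(n : ℝ) ^ k * s⌋ :=
    Int.measurable_floor.comp (measurable_const_mul _)
  have h1 : ∫⁻ s, w ⌊(n : ℝ) ^ k * s⌋ / μ (cell n k s) ∂μ =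
      ∫⁻ z, w z / μ (idx n k z) ∂(μ.map fun s : ℝ => ⌊(n : ℝ) ^ k * s⌋) := by
    rw [lintegral_map (measurable_of_countable _) hm]; rfl
  rw [h1, lintegral_countable']
  refine ENNReal.tsum_le_tsum fun z => ?_
  rw [Measure.map_apply hm (MeasurableSet.singleton z)]
  change w z / μ (idx n k z) * μ (idx n k z) ≤ w z
  rw [ENNReal.div_eq_inv_mul, mul_comm, ← mul_assoc]
  exact (mul_le_mul_left (ENNReal.mul_inv_le_one _) _).trans_eq (one_mul _)

/-- If the likelihood ratio `exp G` has mass at most `c` then the positive part of `G` is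
integrable with integral at most `c`. -/
lemma integral_pos_part_le (k : ℕ) (w : ℤ → ENNReal) {c : ℝ} (hc : 0 ≤ c)
    (hw : ∑' z, w z ≤ ENNReal.ofReal c) {G : ℝ → ℝ} (hG : Measurable G)
    (h : ∀ᵐ s ∂μ, ENNReal.ofReal (Real.exp (G s)) * μ (cell n k s) ≤ w ⌊(n : ℝ) ^ k * s⌋) :
    Integrable (fun s => max (G s) 0) μ ∧ ∫ s, max (G s) 0 ∂μ ≤ c := by
  have hl : ∫⁻ s, ENNReal.ofReal (max (G s) 0) ∂μ ≤ ENNReal.ofReal c := by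
    refine le_trans (lintegral_mono_ae ?_) ((lintegral_div_cell_le (n := n) k w).trans hw)
    filter_upwards [h, ae_cell_ne_zero (n := n) k] with s hs h0
    rw [ENNReal.le_div_iff_mul_le (Or.inl h0) (Or.inl (measure_ne_top _ _))]
    refine le_trans ?_ hs
    gcongr
    exact max_le ((Real.add_one_le_exp (G s)).trans' (by linarith)) (Real.exp_pos _).le
  have hm : Measurable fun s => max (G s) 0 := hG.max measurable_const
  have hnn : 0 ≤ᵐ[μ] fun s => max (G s) 0 := Eventually.of_forall fun s => le_max_right _ _
  constructor
  · refine ⟨hm.aestronglyMeasurable, ?_⟩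
    rw [hasFiniteIntegral_iff_ofReal hnn]
    exact hl.trans_lt ENNReal.ofReal_lt_top
  · rw [integral_eq_lintegral_of_nonneg_ae hnn hm.aestronglyMeasurable]
    exact ENNReal.toReal_le_of_le_ofReal hc hl

lemma measure_Ico_of (hsupp : μ (Set.Ico (0 : ℝ) 1) = 1) : ∀ᵐ s ∂μ, s ∈ Set.Ico (0 : ℝ) 1 :=
  (mem_ae_iff_prob_eq_one measurableSet_Ico).mpr hsupp

/-- `E (L_M - M log n)^+ ≤ 1`. -/
lemma info_tail (hn : 2 ≤ n) (hsupp : ∀ᵐ s ∂μ, s ∈ Set.Ico (0 : ℝ) 1) (M : ℕ) :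
    Integrable (fun s => max (info n μ M s - M * Real.log n) 0) μ ∧
      ∫ s, max (info n μ M s - M * Real.log n) 0 ∂μ ≤ 1 := by
  classical
  have hn0 : (0 : ℝ) < n := by positivity
  refine integral_pos_part_le (n := n) M
    (fun z => if z ∈ Finset.Ico (0 : ℤ) (n ^ M : ℕ) then ENNReal.ofReal (((n : ℝ) ^ M)⁻¹) else 0)
    zero_le_one ?_ ((measurable_info M).sub_const _) ?_
  · rw [tsum_eq_sum (s := Finset.Ico (0 : ℤ) (n ^ M : ℕ)) (fun z hz => if_neg hz),
      Finset.sum_congr rfl (fun z hz => if_pos hz), Finset.sum_const, Int.card_Ico,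
      sub_zero, Int.toNat_natCast, nsmul_eq_mul, ← ENNReal.ofReal_natCast,
      ← ENNReal.ofReal_mul (by positivity)]
    refine ENNReal.ofReal_le_ofReal ?_
    push_cast
    rw [mul_inv_cancel₀ (by positivity)]
  · filter_upwards [hsupp, ae_cell_ne_zero (n := n) M] with s hs h0
    have hmem : ⌊(n : ℝ) ^ M * s⌋ ∈ Finset.Ico (0 : ℤ) (n ^ M : ℕ) := by
      rw [Finset.mem_Ico]
      have hp : (0 : ℝ) < (n : ℝ) ^ M := by positivity
      refine ⟨Int.floor_nonneg.mpr (mul_nonneg hp.le hs.1), Int.floor_lt.mpr ?_⟩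
      push_cast
      nlinarith [hs.2]
    rw [if_pos hmem]
    have hpos : 0 < μ.real (cell n M s) := ENNReal.toReal_pos h0 (measure_ne_top _ _)
    rw [← ENNReal.ofReal_toReal (measure_ne_top μ (cell n M s)),
      ← ENNReal.ofReal_mul (Real.exp_pos _).le]
    refine ENNReal.ofReal_le_ofReal (le_of_eq ?_)
    change _ * μ.real (cell n M s) = _
    rw [info, Real.exp_sub, Real.exp_neg, Real.exp_log hpos, Real.exp_nat_mul, Real.exp_log hn0]
    field_simp

lemma info_integrable (hn : 2 ≤ n) (hsupp : ∀ᵐ s ∂μ, s ∈ Set.Ico (0 : ℝ) 1) (M : ℕ) :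
    Integrable (info n μ M) μ := by
  refine Integrable.mono' ((info_tail hn hsupp M).1.add (integrable_const (M * Real.log n)))
    (measurable_info M).aestronglyMeasurable (Eventually.of_forall fun s => ?_)
  rw [Real.norm_of_nonneg (info_nonneg _ _)]
  simp only [Pi.add_apply]
  linarith [le_max_left (info n μ M s - M * Real.log n) 0]

/-- Mass of the three cells around a point. -/
noncomputable def mass3 (n : ℕ) (μ : Measure ℝ) (k : ℕ) (z : ℤ) : ENNReal :=
  μ (idx n k (z - 1)) + μ (idx n k z) + μ (idx n k (z + 1))

/-- Minus the logarithm of the mass of the three cells around a point. -/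
noncomputable def info3 (n : ℕ) (μ : Measure ℝ) (k : ℕ) (s : ℝ) : ℝ :=
  -Real.log (mass3 n μ k ⌊(n : ℝ) ^ k * s⌋).toReal

lemma measurable_info3 (k : ℕ) : Measurable (info3 n μ k) :=
  measurable_cell_fun (n := n) (j := k) fun s x hx => by
    have h' : ⌊(n : ℝ) ^ k * x⌋ = ⌊(n : ℝ) ^ k * s⌋ := hx
    simp [info3, h']

lemma mass3_ne_top (k : ℕ) (z : ℤ) : mass3 n μ k z ≠ ⊤ := by
  unfold mass3; finiteness

lemma cell_le_mass3 (k : ℕ) (s : ℝ) : μ (cell n k s) ≤ mass3 n μ k ⌊(n : ℝ) ^ k * s⌋ := by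
  rw [cell_eq_idx]
  unfold mass3
  exact le_add_right (le_add_self)

lemma info_sub_info3 (k : ℕ) :
    Integrable (fun s => max (info n μ k s - info3 n μ k s) 0) μ ∧
      ∫ s, max (info n μ k s - info3 n μ k s) 0 ∂μ ≤ 3 := by
  refine integral_pos_part_le (n := n) k (mass3 n μ k) (by norm_num) ?_
    ((measurable_info k).sub (measurable_info3 k)) ?_
  · unfold mass3
    rw [ENNReal.tsum_add, ENNReal.tsum_add]
    have h1 : ∑' z, μ (idx n k (z - 1)) = ∑' z, μ (idx n k z) :=
      (Equiv.subRight (1 : ℤ)).tsum_eq fun z => μ (idx n k z)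
    have h2 : ∑' z, μ (idx n k (z + 1)) = ∑' z, μ (idx n k z) :=
      (Equiv.addRight (1 : ℤ)).tsum_eq fun z => μ (idx n k z)
    rw [h1, h2]
    calc _ ≤ (1 + 1 + 1 : ENNReal) := by gcongr <;> exact tsum_idx_le k
      _ = ENNReal.ofReal 3 := by norm_num
  · filter_upwards [ae_cell_ne_zero (n := n) k] with s h0
    have hpos : 0 < μ.real (cell n k s) := ENNReal.toReal_pos h0 (measure_ne_top _ _)
    have h3 : mass3 n μ k ⌊(n : ℝ) ^ k * s⌋ ≠ 0 := fun h => by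
      have := cell_le_mass3 (n := n) (μ := μ) k s
      rw [h] at this
      exact h0 (le_antisymm this zero_le)
    have hpos3 := ENNReal.toReal_pos h3 (mass3_ne_top _ _)
    rw [← ENNReal.ofReal_toReal (measure_ne_top μ (cell n k s)),
      ← ENNReal.ofReal_mul (Real.exp_pos _).le]
    refine ENNReal.ofReal_le_of_le_toReal (le_of_eq ?_)
    change _ * μ.real (cell n k s) = _
    rw [info, info3, sub_neg_eq_add, add_comm, Real.exp_add, Real.exp_neg, Real.exp_log hpos,
      Real.exp_log hpos3]
    field_simp

lemma measurePreserving_fract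
    (hT : MeasurePreserving (fun x : ℝ => Int.fract ((n : ℝ) * x)) μ μ)
    (hsupp : ∀ᵐ s ∂μ, s ∈ Set.Ico (0 : ℝ) 1) (j : ℕ) :
    MeasurePreserving (fun x : ℝ => Int.fract ((n : ℝ) ^ j * x)) μ μ := by
  induction j with
  | zero =>
    have h0 : (fun x : ℝ => Int.fract ((n : ℝ) ^ 0 * x)) =ᵐ[μ] id := by
      filter_upwards [hsupp] with s hs
      simpa using Int.fract_eq_self.mpr hs
    refine ⟨by fun_prop, ?_⟩
    rw [Measure.map_congr h0, Measure.map_id]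
  | succ j ih =>
    have := hT.comp ih
    convert this using 1
    ext x
    simp only [Function.comp]
    have e : (n : ℝ) ^ (j + 1) * x =
        (n : ℝ) * Int.fract ((n : ℝ) ^ j * x) + ((n * ⌊(n : ℝ) ^ j * x⌋ : ℤ) : ℝ) := by
      have := Int.floor_add_fract ((n : ℝ) ^ j * x)
      push_cast
      rw [← mul_add, add_comm (Int.fract _), this]
      ring
    rw [e, Int.fract_add_intCast]

lemma floor_fract (hn : 2 ≤ n) (j M : ℕ) (s : ℝ) :
    ⌊(n : ℝ) ^ M * Int.fract ((n : ℝ) ^ j * s)⌋ =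
      ⌊(n : ℝ) ^ (j + M) * s⌋ % ((n ^ M : ℕ) : ℤ) := by
  have h1 := floor_coarse hn (Nat.le_add_right j M) s
  rw [Nat.add_sub_cancel_left] at h1
  have h2 : (n : ℝ) ^ M * Int.fract ((n : ℝ) ^ j * s) =
      (n : ℝ) ^ (j + M) * s - (((n ^ M : ℕ) : ℤ) * ⌊(n : ℝ) ^ j * s⌋ : ℤ) := by
    rw [Int.fract]; push_cast; ring
  rw [h2, Int.floor_sub_intCast, h1, Int.emod_def]

lemma info_increment (hn : 2 ≤ n)
    (hT : MeasurePreserving (fun x : ℝ => Int.fract ((n : ℝ) * x)) μ μ)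
    (hsupp : ∀ᵐ s ∂μ, s ∈ Set.Ico (0 : ℝ) 1) (j M : ℕ) :
    Integrable (fun s => max (info n μ (j + M) s - info n μ j s -
      info n μ M (Int.fract ((n : ℝ) ^ j * s))) 0) μ ∧
      ∫ s, max (info n μ (j + M) s - info n μ j s -
        info n μ M (Int.fract ((n : ℝ) ^ j * s))) 0 ∂μ ≤ 1 := by
  have hP := measurePreserving_fract hT hsupp j
  have hnM : n ^ M ≠ 0 := by positivity
  haveI : NeZero (n ^ M) := ⟨hnM⟩
  refine integral_pos_part_le (n := n) (j + M)
    (fun z => μ (idx n j (z / ((n ^ M : ℕ) : ℤ))) * μ (idx n M (z % ((n ^ M : ℕ) : ℤ))))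
    zero_le_one ?_ (((measurable_info _).sub (measurable_info _)).sub
      ((measurable_info M).comp hP.measurable)) ?_
  · rw [← (Int.divModEquiv (n ^ M)).symm.tsum_eq]
    have h1 : ∀ p : ℤ × Fin (n ^ M), μ (idx n j ((Int.divModEquiv (n ^ M)).symm p / ((n ^ M : ℕ) : ℤ)))
        * μ (idx n M ((Int.divModEquiv (n ^ M)).symm p % ((n ^ M : ℕ) : ℤ))) =
        μ (idx n j p.1) * μ (idx n M (p.2 : ℕ)) := by
      rintro ⟨a, b⟩
      have hb : ((b : ℕ) : ℤ) < ((n ^ M : ℕ) : ℤ) := by exact_mod_cast b.2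
      have hpos : (0 : ℤ) < ((n ^ M : ℕ) : ℤ) := by positivity
      have e : (Int.divModEquiv (n ^ M)).symm (a, b) = a * ((n ^ M : ℕ) : ℤ) + (b : ℕ) := by
        simp [Int.divModEquiv]
      rw [e, add_comm, Int.add_mul_ediv_right _ _ hpos.ne', Int.add_mul_emod_self_right,
        Int.ediv_eq_zero_of_lt (by positivity) hb, Int.emod_eq_of_lt (by positivity) hb, zero_add]
    rw [tsum_congr h1, ENNReal.tsum_prod (f := fun (a : ℤ) (b : Fin (n ^ M)) =>
      μ (idx n j a) * μ (idx n M ((b : ℕ) : ℤ)))]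
    simp_rw [ENNReal.tsum_mul_left]
    rw [ENNReal.tsum_mul_right]
    have h2 : ∑' b : Fin (n ^ M), μ (idx n M ((b : ℕ) : ℤ)) ≤ 1 := by
      refine le_trans ?_ (tsum_idx_le (n := n) (μ := μ) M)
      refine ENNReal.tsum_comp_le_tsum_of_injective (f := fun b : Fin (n ^ M) => ((b : ℕ) : ℤ))
        ?_ fun z => μ (idx n M z)
      intro a b hab
      exact Fin.ext (Int.ofNat_inj.mp hab)
    rw [ENNReal.ofReal_one]
    exact mul_le_one' (tsum_idx_le j) h2
  · filter_upwards [ae_cell_ne_zero (n := n) j, ae_cell_ne_zero (n := n) (j + M),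
      hP.quasiMeasurePreserving.ae (ae_cell_ne_zero (n := n) M)] with s h1 h2 h3
    have e1 : μ (idx n j (⌊(n : ℝ) ^ (j + M) * s⌋ / ((n ^ M : ℕ) : ℤ))) = μ (cell n j s) := by
      rw [cell_eq_idx]
      have := floor_coarse hn (Nat.le_add_right j M) s
      rw [Nat.add_sub_cancel_left] at this
      rw [this]
    have e2 : μ (idx n M (⌊(n : ℝ) ^ (j + M) * s⌋ % ((n ^ M : ℕ) : ℤ))) =
        μ (cell n M (Int.fract ((n : ℝ) ^ j * s))) := by
      rw [cell_eq_idx, floor_fract hn]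
    rw [e1, e2]
    have p1 : 0 < μ.real (cell n j s) := ENNReal.toReal_pos h1 (measure_ne_top _ _)
    have p2 : 0 < μ.real (cell n (j + M) s) := ENNReal.toReal_pos h2 (measure_ne_top _ _)
    have p3 : 0 < μ.real (cell n M (Int.fract ((n : ℝ) ^ j * s))) :=
      ENNReal.toReal_pos h3 (measure_ne_top _ _)
    rw [← ENNReal.ofReal_toReal (measure_ne_top μ (cell n (j + M) s)),
      ← ENNReal.ofReal_mul (Real.exp_pos _).le]
    refine ENNReal.ofReal_le_of_le_toReal (le_of_eq ?_)
    rw [ENNReal.toReal_mul]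
    change _ * μ.real (cell n (j + M) s) = μ.real _ * μ.real _
    rw [Real.exp_sub, Real.exp_sub, info, info, info, Real.exp_neg, Real.exp_neg, Real.exp_neg,
      Real.exp_log p1, Real.exp_log p2, Real.exp_log p3]
    field_simp

end Dim
end CFP

namespace CFP
open Finset Topology

section Dim2
variable {n : ℕ} {μ : Measure ℝ} [IsProbabilityMeasure μ]

/-- Normalised logarithm of the mass of the ball of radius `n⁻ᵏ`. -/
noncomputable def ballDim (n : ℕ) (μ : Measure ℝ) (k : ℕ) (s : ℝ) : ℝ :=
  -Real.log (μ.real (Metric.ball s (((n : ℝ) ^ k)⁻¹))) / (k * Real.log n)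

lemma tendsto_ballDim (hn : 2 ≤ n) {κ s : ℝ}
    (h : Tendsto (fun r : ℝ => Real.log (μ (Metric.ball s r)).toReal / Real.log r)
      (𝓝[>] 0) (𝓝 κ)) :
    Tendsto (fun k : ℕ => ballDim n μ k s) atTop (𝓝 κ) := by
  have hn1 : (1 : ℝ) < n := by exact_mod_cast hn
  have h1 : Tendsto (fun k : ℕ => (((n : ℝ) ^ k)⁻¹)) atTop (𝓝[>] 0) := by
    refine tendsto_nhdsWithin_iff.mpr ⟨?_, Eventually.of_forall fun k => ?_⟩
    · exact tendsto_inv_atTop_zero.comp (tendsto_pow_atTop_atTop_of_one_lt hn1)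
    · exact Set.mem_Ioi.mpr (by positivity)
  refine (h.comp h1).congr fun k => ?_
  simp only [Function.comp, ballDim, Real.log_inv, Real.log_pow]
  rw [div_neg, neg_div]
  rfl

lemma cell_subset_ball (hn : 2 ≤ n) (k : ℕ) (s : ℝ) :
    cell n k s ⊆ Metric.ball s (((n : ℝ) ^ k)⁻¹) := by
  intro x hx
  have hp : (0 : ℝ) < (n : ℝ) ^ k := by positivity
  have := cell_dist hx
  rw [abs_mul, abs_of_pos hp] at this
  rw [Metric.mem_ball, Real.dist_eq, ← one_div, lt_div_iff₀ hp]
  linarith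

lemma ball_le_mass3 (hn : 2 ≤ n) (k : ℕ) (s : ℝ) :
    μ (Metric.ball s (((n : ℝ) ^ k)⁻¹)) ≤ mass3 n μ k ⌊(n : ℝ) ^ k * s⌋ := by
  have hp : (0 : ℝ) < (n : ℝ) ^ k := by positivity
  unfold mass3
  refine le_trans (measure_mono (t := (idx n k (⌊(n : ℝ) ^ k * s⌋ - 1) ∪ idx n k ⌊(n : ℝ) ^ k * s⌋) ∪
    idx n k (⌊(n : ℝ) ^ k * s⌋ + 1)) ?_) ((measure_union_le _ _).trans
      (by gcongr; exact measure_union_le _ _))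
  intro x hx
  rw [Metric.mem_ball, Real.dist_eq, ← one_div, lt_div_iff₀ hp] at hx
  have hx' : -1 < (x - s) * (n : ℝ) ^ k ∧ (x - s) * (n : ℝ) ^ k < 1 := by
    rw [← abs_lt, abs_mul, abs_of_pos hp]
    exact hx
  have a1 := Int.floor_le ((n : ℝ) ^ k * s)
  have a2 := Int.lt_floor_add_one ((n : ℝ) ^ k * s)
  set z := ⌊(n : ℝ) ^ k * s⌋
  have b1 : z - 1 ≤ ⌊(n : ℝ) ^ k * x⌋ := by
    rw [Int.le_floor]; push_cast; nlinarith
  have b2 : ⌊(n : ℝ) ^ k * x⌋ < z + 2 := by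
    rw [Int.floor_lt]; push_cast; nlinarith
  simp only [idx, Set.mem_union, Set.mem_ofPred_eq]
  omega

lemma info_bounds (hn : 2 ≤ n) {k : ℕ} (hk : 0 < k) {s : ℝ} (h : μ (cell n k s) ≠ 0) :
    ballDim n μ k s ≤ info n μ k s / (k * Real.log n) ∧
      info3 n μ k s / (k * Real.log n) ≤ ballDim n μ k s := by
  have hn1 : (1 : ℝ) < n := by exact_mod_cast hn
  have hl : 0 < (k : ℝ) * Real.log n := mul_pos (by exact_mod_cast hk) (Real.log_pos hn1)
  have p1 : 0 < μ.real (cell n k s) := ENNReal.toReal_pos h (measure_ne_top _ _)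
  have p2 : μ.real (cell n k s) ≤ μ.real (Metric.ball s (((n : ℝ) ^ k)⁻¹)) :=
    measureReal_mono (cell_subset_ball hn k s)
  have p3 : μ.real (Metric.ball s (((n : ℝ) ^ k)⁻¹)) ≤ (mass3 n μ k ⌊(n : ℝ) ^ k * s⌋).toReal :=
    ENNReal.toReal_mono (mass3_ne_top _ _) (ball_le_mass3 hn k s)
  constructor
  · unfold ballDim info
    gcongr
  · unfold ballDim info3
    have := p1.trans_le p2
    gcongr

lemma ae_ballDim (hn : 2 ≤ n) {κ : ℝ} (hdim : ExactDimensional μ κ) :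
    ∀ᵐ s ∂μ, Tendsto (fun k : ℕ => ballDim n μ k s) atTop (𝓝 κ) ∧ ∀ k, μ (cell n k s) ≠ 0 := by
  filter_upwards [hdim, ae_all_iff.mpr fun k => ae_cell_ne_zero (n := n) (μ := μ) k] with s h1 h2
  exact ⟨tendsto_ballDim hn h1, h2⟩

lemma integral_info_ge (hn : 2 ≤ n) (hsupp : ∀ᵐ s ∂μ, s ∈ Set.Ico (0 : ℝ) 1) {κ : ℝ} (hκ : 0 < κ)
    (hdim : ExactDimensional μ κ) {ε : ℝ} (hε : 0 < ε) :
    ∀ᶠ i : ℕ in atTop, (κ - ε) * (i * Real.log n) ≤ ∫ s, info n μ i s ∂μ := by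
  have hn1 : (1 : ℝ) < n := by exact_mod_cast hn
  have hlog := Real.log_pos hn1
  have hnn : ∀ (i : ℕ) (s : ℝ), 0 ≤ info n μ i s / (i * Real.log n) := fun i s =>
    div_nonneg (info_nonneg _ _) (by positivity)
  have hlim : Tendsto (fun i : ℕ => ∫ s, min (info n μ i s / (i * Real.log n)) κ ∂μ) atTop
      (𝓝 (∫ _, κ ∂μ)) := by
    refine tendsto_integral_of_dominated_convergence (fun _ => κ)
      (fun i => (((measurable_info i).div_const _).min measurable_const).aestronglyMeasurable)
      (integrable_const _) (fun i => Eventually.of_forall fun s => ?_) ?_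
    · rw [Real.norm_of_nonneg (le_min (hnn i s) hκ.le)]
      exact min_le_right _ _
    · filter_upwards [ae_ballDim hn hdim] with s hs
      have h1 : Tendsto (fun i : ℕ => min (ballDim n μ i s) κ) atTop (𝓝 κ) := by
        simpa using Tendsto.min hs.1 (tendsto_const_nhds (x := κ))
      refine tendsto_of_tendsto_of_tendsto_of_le_of_le' h1 tendsto_const_nhds ?_
        (Eventually.of_forall fun i => min_le_right _ _)
      filter_upwards [eventually_gt_atTop 0] with i hi
      exact min_le_min_right _ (info_bounds hn hi (hs.2 i)).1
  rw [integral_const, probReal_univ, one_smul] at hlim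
  filter_upwards [hlim.eventually_const_le (sub_lt_self κ hε), eventually_gt_atTop 0] with i hi h0
  have hp : 0 < (i : ℝ) * Real.log n := mul_pos (by exact_mod_cast h0) hlog
  have hle : ∫ s, min (info n μ i s / (i * Real.log n)) κ ∂μ ≤
      ∫ s, info n μ i s / (i * Real.log n) ∂μ := by
    refine integral_mono_of_nonneg (Eventually.of_forall fun s => le_min (hnn i s) hκ.le)
      ((info_integrable hn hsupp i).div_const _) (Eventually.of_forall fun s => min_le_left _ _)
  rw [integral_div] at hle
  have := hi.trans hle
  rwa [le_div_iff₀ hp] at this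

lemma integral_info_tail (hn : 2 ≤ n) (hsupp : ∀ᵐ s ∂μ, s ∈ Set.Ico (0 : ℝ) 1) {κ : ℝ}
    (hκ : 0 < κ) (hdim : ExactDimensional μ κ) {ε : ℝ} (hε : 0 < ε) :
    ∀ᶠ M : ℕ in atTop, ∫ s, max (info n μ M s - (κ + ε) * (M * Real.log n)) 0 ∂μ ≤
      ε * (M * Real.log n) := by
  have hn1 : (1 : ℝ) < n := by exact_mod_cast hn
  have hlog := Real.log_pos hn1
  have hm : ∀ i : ℕ, Measurable
      (fun s => min (max (info3 n μ i s / (i * Real.log n) - (κ + ε)) 0) 1) := fun i =>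
    ((((measurable_info3 i).div_const _).sub_const _).max measurable_const).min measurable_const
  have hb : ∀ (i : ℕ) (s : ℝ),
      ‖min (max (info3 n μ i s / (i * Real.log n) - (κ + ε)) 0) 1‖ ≤ 1 := fun i s => by
    rw [Real.norm_of_nonneg (le_min (le_max_right _ _) zero_le_one)]
    exact min_le_right _ _
  have hlim : Tendsto (fun i : ℕ => ∫ s,
      min (max (info3 n μ i s / (i * Real.log n) - (κ + ε)) 0) 1 ∂μ) atTop
      (𝓝 (∫ _, (0 : ℝ) ∂μ)) := by
    refine tendsto_integral_of_dominated_convergence (fun _ => 1)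
      (fun i => (hm i).aestronglyMeasurable)
      (integrable_const _) (fun i => Eventually.of_forall fun s => hb i s) ?_
    · filter_upwards [ae_ballDim hn hdim] with s hs
      refine tendsto_const_nhds.congr' ?_
      filter_upwards [eventually_gt_atTop 0,
        hs.1.eventually_le_const (lt_add_of_pos_right κ hε)] with i hi h2
      have := (info_bounds hn hi (hs.2 i)).2
      rw [max_eq_right (by linarith), min_eq_left zero_le_one]
  rw [integral_zero] at hlim
  have hbig : ∀ᶠ M : ℕ in atTop, 8 / ε ≤ M * Real.log n :=
    (tendsto_natCast_atTop_atTop.atTop_mul_const hlog).eventually_ge_atTop _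
  filter_upwards [hlim.eventually_le_const (half_pos hε), eventually_gt_atTop 0, hbig]
    with M hM h0 hM8
  have hp : 0 < (M : ℝ) * Real.log n := mul_pos (by exact_mod_cast h0) hlog
  set c := (M : ℝ) * Real.log n
  have i1 := info_tail hn hsupp (μ := μ) M
  have i2 := info_sub_info3 (n := n) (μ := μ) M
  have i3 : Integrable (fun s => min (max (info3 n μ M s / c - (κ + ε)) 0) 1) μ :=
    Integrable.of_bound (hm M).aestronglyMeasurable 1 (Eventually.of_forall fun s => hb M s)
  have hpt : ∀ s, max (info n μ M s - (κ + ε) * c) 0 ≤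
      max (info n μ M s - c) 0 + max (info n μ M s - info3 n μ M s) 0 +
        c * min (max (info3 n μ M s / c - (κ + ε)) 0) 1 := by
    intro s
    have e : c * min (max (info3 n μ M s / c - (κ + ε)) 0) 1 =
        min (max (info3 n μ M s - (κ + ε) * c) 0) c := by
      rw [← mul_min_of_nonneg _ _ hp.le |>.symm, ← mul_max_of_nonneg _ _ hp.le |>.symm, mul_zero,
        mul_one, mul_sub, mul_div_cancel₀ _ hp.ne', mul_comm c (κ + ε)]
    rw [e]
    have hk : 0 ≤ (κ + ε) * c := by positivity
    have := info_nonneg (n := n) (μ := μ) M s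
    rcases max_cases (info n μ M s - (κ + ε) * c) 0 with ⟨e1, _⟩ | ⟨e1, _⟩ <;>
    rcases max_cases (info n μ M s - c) 0 with ⟨e2, _⟩ | ⟨e2, _⟩ <;>
    rcases max_cases (info n μ M s - info3 n μ M s) 0 with ⟨e3, _⟩ | ⟨e3, _⟩ <;>
    rcases max_cases (info3 n μ M s - (κ + ε) * c) 0 with ⟨e4, _⟩ | ⟨e4, _⟩ <;>
    rw [e1, e2, e3, e4] <;>
    first
    | (rcases min_cases (info3 n μ M s - (κ + ε) * c) c with ⟨e5, _⟩ | ⟨e5, _⟩ <;> rw [e5] <;>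
        linarith)
    | (rcases min_cases 0 c with ⟨e5, _⟩ | ⟨e5, _⟩ <;> rw [e5] <;> linarith)
  have h8 : 8 ≤ ε * c := by
    rw [div_le_iff₀ hε] at hM8; linarith
  calc _ ≤ ∫ s, (max (info n μ M s - c) 0 + max (info n μ M s - info3 n μ M s) 0 +
        c * min (max (info3 n μ M s / c - (κ + ε)) 0) 1) ∂μ :=
        integral_mono_of_nonneg (Eventually.of_forall fun s => le_max_right _ _)
          ((i1.1.add i2.1).add (i3.const_mul c)) (Eventually.of_forall hpt)
    _ = ∫ s, max (info n μ M s - c) 0 ∂μ + ∫ s, max (info n μ M s - info3 n μ M s) 0 ∂μ +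
        c * ∫ s, min (max (info3 n μ M s / c - (κ + ε)) 0) 1 ∂μ := by
        rw [← integral_const_mul, ← integral_add i1.1 i2.1]
        exact integral_add (i1.1.add i2.1) (i3.const_mul c)
    _ ≤ 1 + 3 + c * (ε / 2) := by
        gcongr
        · exact i1.2
        · exact i2.2
    _ ≤ ε * c := by linarith

end Dim2
end CFP

namespace CFP
open Finset Topology

section Dim3
variable {n : ℕ} {μ : Measure ℝ} [IsProbabilityMeasure μ]

lemma sum_increment (f : ℕ → ℝ) (I M : ℕ) :
    ∑ j ∈ range I, (f (j + M) - f j) = ∑ i ∈ range M, f (I + i) - ∑ i ∈ range M, f i := by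
  have h1 := Finset.sum_range_add f M I
  have h2 := Finset.sum_range_add f I M
  rw [add_comm M I] at h1
  rw [sum_sub_distrib]
  have h3 : ∑ j ∈ range I, f (j + M) = ∑ j ∈ range I, f (M + j) :=
    sum_congr rfl fun j _ => by rw [add_comm]
  linarith

/-- Points whose cell of generation `j` has a subcell of generation `j + M` of small relative
codimension. -/
def Conc (n : ℕ) (μ : Measure ℝ) (M : ℕ) (ε : ℝ) (j : ℕ) : Set ℝ :=
  {s | ENNReal.ofReal ε * μ (cell n j s) < μ (cell n (j + M) s)}

lemma measurable_measure_cell (j : ℕ) : Measurable fun s => μ (cell n j s) :=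
  measurable_cell_fun (n := n) (j := j) fun s x hx => by simp [cell_eq hx]

lemma measurableSet_Conc (M : ℕ) (ε : ℝ) (j : ℕ) : MeasurableSet (Conc n μ M ε j) :=
  measurableSet_lt ((measurable_measure_cell j).const_mul _) (measurable_measure_cell _)

lemma sum_conc_le (hn : 2 ≤ n)
    (hT : MeasurePreserving (fun x : ℝ => Int.fract ((n : ℝ) * x)) μ μ)
    (hsupp : ∀ᵐ s ∂μ, s ∈ Set.Ico (0 : ℝ) 1) {κ : ℝ}
    (hκ : 0 < κ) (hdim : ExactDimensional μ κ) {ε ε5 : ℝ} (hε : 0 < ε) (h5 : 0 < ε5) :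
    ∃ M : ℕ, ∀ᶠ I : ℕ in atTop, ∑ j ∈ range I, μ.real (Conc n μ M ε5 j) ≤ ε * I := by
  have hn1 : (1 : ℝ) < n := by exact_mod_cast hn
  have hlog := Real.log_pos hn1
  set η := κ * ε / 10 with hη
  have hη0 : 0 < η := by positivity
  have hbig : Tendsto (fun M : ℕ => (M : ℝ) * Real.log n) atTop atTop :=
    tendsto_natCast_atTop_atTop.atTop_mul_const hlog
  obtain ⟨M, hM, hM1, hM2, hM0⟩ := ((integral_info_tail hn hsupp hκ hdim hη0).and
    ((hbig.eventually_ge_atTop (1 / η)).and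
    ((hbig.eventually_ge_atTop (2 * Real.log ε5⁻¹ / κ)).and (eventually_gt_atTop 0)))).exists
  refine ⟨M, ?_⟩
  have hp : 0 < (M : ℝ) * Real.log n := mul_pos (by exact_mod_cast hM0) hlog
  set c := (M : ℝ) * Real.log n with hc
  rw [div_le_iff₀ hη0] at hM1
  rw [div_le_iff₀ hκ] at hM2
  set E : ℕ → ℝ := fun j => ∫ s, info n μ j s ∂μ with hE
  have hintg := fun j => info_integrable hn hsupp (μ := μ) j
  set A := (κ + η) * c with hA
  have hdef : ∀ j, Integrable (fun s => max (A - (info n μ (j + M) s - info n μ j s)) 0) μ ∧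
      ∫ s, max (A - (info n μ (j + M) s - info n μ j s)) 0 ∂μ ≤
        A + 2 * η * c - (E (j + M) - E j) := by
    intro j
    obtain ⟨k1, k2⟩ := info_increment hn hT hsupp (μ := μ) j M
    have hP := measurePreserving_fract hT hsupp j
    have hZ : Integrable (fun s => A - (info n μ (j + M) s - info n μ j s)) μ :=
      (integrable_const A).sub ((hintg _).sub (hintg _))
    have k3 : Integrable (fun s => max (info n μ M s - A) 0) μ :=
      ((hintg M).sub (integrable_const A)).pos_part
    have k4 : Integrable (fun s => max (info n μ M (Int.fract ((n : ℝ) ^ j * s)) - A) 0) μ :=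
      hP.integrable_comp_of_integrable k3
    have k5 : ∫ s, max (info n μ M (Int.fract ((n : ℝ) ^ j * s)) - A) 0 ∂μ =
        ∫ s, max (info n μ M s - A) 0 ∂μ := by
      have h := integral_map (μ := μ) hP.measurable.aemeasurable
        (f := fun s => max (info n μ M s - A) 0) (by rw [hP.map_eq]; exact k3.aestronglyMeasurable)
      rw [hP.map_eq] at h
      exact h.symm
    refine ⟨hZ.pos_part, ?_⟩
    calc _ ≤ ∫ s, ((A - (info n μ (j + M) s - info n μ j s)) +
          (max (info n μ (j + M) s - info n μ j s -
            info n μ M (Int.fract ((n : ℝ) ^ j * s))) 0 +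
          max (info n μ M (Int.fract ((n : ℝ) ^ j * s)) - A) 0)) ∂μ := by
          refine integral_mono hZ.pos_part (hZ.add (k1.add k4)) fun s => ?_
          simp only
          set z := info n μ (j + M) s - info n μ j s
          set w := info n μ M (Int.fract ((n : ℝ) ^ j * s))
          have a1 := le_max_left (z - w) 0
          have a2 := le_max_left (w - A) 0
          have a3 := le_max_right (z - w) 0
          have a4 := le_max_right (w - A) 0
          refine max_le (by linarith) (by linarith)
      _ = (A - (E (j + M) - E j)) + (∫ s, max (info n μ (j + M) s - info n μ j s -
            info n μ M (Int.fract ((n : ℝ) ^ j * s))) 0 ∂μ + ∫ s, max (info n μ M s - A) 0 ∂μ) := by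
          rw [← k5, ← integral_add k1 k4]
          have e1 : A - (E (j + M) - E j) =
              ∫ s, (A - (info n μ (j + M) s - info n μ j s)) ∂μ := by
            have e2 : ∫ s, (info n μ (j + M) s - info n μ j s) ∂μ = E (j + M) - E j :=
              integral_sub (hintg _) (hintg _)
            have e3 := integral_sub (integrable_const (μ := μ) A) ((hintg (j + M)).sub (hintg j))
            rw [integral_const, probReal_univ, one_smul] at e3
            rw [← e2]
            exact e3.symm
          rw [e1]
          exact integral_add hZ (k1.add k4)
      _ ≤ (A - (E (j + M) - E j)) + (1 + η * c) := by gcongr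
      _ ≤ _ := by linarith
  have hV : ∀ j, μ.real (Conc n μ M ε5 j) * (κ * c / 2) ≤
      ∫ s, max (A - (info n μ (j + M) s - info n μ j s)) 0 ∂μ := by
    intro j
    have h1 := integral_indicator_const (μ := μ) (κ * c / 2) (measurableSet_Conc (n := n) (μ := μ) M ε5 j)
    rw [smul_eq_mul] at h1
    rw [← h1]
    refine integral_mono_of_nonneg (Eventually.of_forall fun s => Set.indicator_nonneg
      (fun _ _ => by positivity) s) (hdef j).1 (Eventually.of_forall fun s => ?_)
    by_cases hs : s ∈ Conc n μ M ε5 j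
    · rw [Set.indicator_of_mem hs]
      refine le_max_of_le_left ?_
      have hs' : ENNReal.ofReal ε5 * μ (cell n j s) < μ (cell n (j + M) s) := hs
      have q2 : μ (cell n (j + M) s) ≠ 0 := hs'.ne_bot
      have q1 : μ (cell n j s) ≠ 0 := fun h => q2 (by
        have := measure_mono (μ := μ) (cell_anti hn (Nat.le_add_right j M) s)
        rw [h] at this
        exact le_antisymm this zero_le)
      have p1 : 0 < μ.real (cell n j s) := ENNReal.toReal_pos q1 (measure_ne_top _ _)
      have p2 : 0 < μ.real (cell n (j + M) s) := ENNReal.toReal_pos q2 (measure_ne_top _ _)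
      have h2 : ε5 * μ.real (cell n j s) < μ.real (cell n (j + M) s) := by
        have := (ENNReal.toReal_lt_toReal (by finiteness) (measure_ne_top _ _)).mpr hs'
        rwa [ENNReal.toReal_mul, ENNReal.toReal_ofReal h5.le] at this
      have h3 := Real.log_lt_log (by positivity) h2
      rw [Real.log_mul h5.ne' p1.ne'] at h3
      rw [Real.log_inv] at hM2
      have : info n μ (j + M) s - info n μ j s < κ * c / 2 := by
        unfold info; linarith
      have : 0 < η * c := by positivity
      rw [hA]; linarith
    · rw [Set.indicator_of_notMem hs]
      exact le_max_right _ _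
  set C := ∑ i ∈ range M, E i with hC
  have hlow : ∀ᶠ I : ℕ in atTop, (κ - η) * (I * c) ≤ ∑ i ∈ range M, E (I + i) := by
    have h1 := integral_info_ge hn hsupp hκ hdim hη0
    obtain ⟨I0, hI0⟩ := eventually_atTop.mp h1
    filter_upwards [eventually_ge_atTop I0] with I hI
    calc (κ - η) * (I * c) = ∑ i ∈ range M, (κ - η) * (I * Real.log n) := by
          rw [sum_const, card_range, nsmul_eq_mul, hc]; ring
      _ ≤ ∑ i ∈ range M, E (I + i) := sum_le_sum fun i _ => by
          by_cases hneg : κ - η ≤ 0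
          · refine (mul_nonpos_of_nonpos_of_nonneg hneg (by positivity)).trans ?_
            exact integral_nonneg fun s => info_nonneg _ _
          · refine le_trans ?_ (hI0 (I + i) (by omega))
            push Not at hneg
            gcongr
            omega
  have hIbig : ∀ᶠ I : ℕ in atTop, C / (η * c) ≤ I :=
    tendsto_natCast_atTop_atTop.eventually_ge_atTop _
  filter_upwards [hlow, hIbig] with I h1 h2
  rw [div_le_iff₀ (by positivity)] at h2
  have h3 := sum_le_sum fun j (_ : j ∈ range I) => (hV j).trans (hdef j).2
  rw [← sum_mul, sum_sub_distrib, sum_increment, sum_const, card_range, nsmul_eq_mul] at h3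
  have h4 : (∑ j ∈ range I, μ.real (Conc n μ M ε5 j)) * (κ * c / 2) ≤ (ε * I) * (κ * c / 2) := by
    refine h3.trans ?_
    have e : (ε * I) * (κ * c / 2) = 5 * η * c * I := by rw [hη]; ring
    rw [e, hA]
    linarith
  exact le_of_mul_le_mul_right h4 (by positivity)

/-- Points in a cell of generation `j` which contains a heavy subcell of generation `j + M`. -/
def Bad2 (n : ℕ) (μ : Measure ℝ) (M : ℕ) (ε : ℝ) (s : ℝ) (i : ℤ) : Prop :=
  ∃ x ∈ cell n i.toNat s, x ∈ Conc n μ M ε i.toNat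

lemma MSet_Bad2 (M : ℕ) (ε : ℝ) : MSet (Bad2 n μ M ε) := fun i =>
  measurableSet_of_cell (n := n) (j := i.toNat) fun s hs x hx => by
    obtain ⟨y, hy, hy'⟩ := hs
    exact ⟨y, by rwa [cell_eq hx], hy'⟩

lemma measure_Bad2_le (hn : 2 ≤ n) (M : ℕ) {ε : ℝ} (hε : 0 < ε) (i : ℕ) :
    μ.real {s | Bad2 n μ M ε s i} ≤ ε⁻¹ * μ.real (Conc n μ M ε i) := by
  have h : (ENNReal.ofReal ε • μ) {s | Bad2 n μ M ε s i} ≤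
      (μ.restrict (Conc n μ M ε i)) {s | Bad2 n μ M ε s i} := by
    refine cell_sat_le (n := n) (j := i) (fun x hx y hy => ?_) _ _ fun x hx => ?_
    · obtain ⟨z, hz, hz'⟩ := hx
      exact ⟨z, by rw [Int.toNat_natCast] at *; rwa [cell_eq hy], hz'⟩
    · obtain ⟨z, hz, hz'⟩ := hx
      rw [Int.toNat_natCast] at hz hz'
      rw [Measure.smul_apply, smul_eq_mul, Measure.restrict_apply (measurableSet_cell _ _),
        ← cell_eq hz]
      have hz2 : ENNReal.ofReal ε * μ (cell n i z) < μ (cell n (i + M) z) := hz'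
      refine hz2.le.trans (measure_mono fun y hy => ?_)
      have hy1 := cell_anti hn (Nat.le_add_right i M) z hy
      refine ⟨hy1, ?_⟩
      change ENNReal.ofReal ε * μ (cell n i y) < μ (cell n (i + M) y)
      rwa [cell_eq hy, cell_eq hy1]
  have h3 : ENNReal.ofReal ε * μ {s | Bad2 n μ M ε s i} ≤ μ (Conc n μ M ε i) :=
    h.trans (by
      rw [Measure.restrict_apply' (measurableSet_Conc M ε i)]
      exact measure_mono Set.inter_subset_right)
  have h4 := ENNReal.toReal_mono (measure_ne_top _ _) h3
  rw [ENNReal.toReal_mul, ENNReal.toReal_ofReal hε.le] at h4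
  rw [inv_mul_eq_div, le_div_iff₀ hε, mul_comm]
  exact h4

lemma exists_mS_Bad2_le (hn : 2 ≤ n)
    (hT : MeasurePreserving (fun x : ℝ => Int.fract ((n : ℝ) * x)) μ μ)
    (hsupp : ∀ᵐ s ∂μ, s ∈ Set.Ico (0 : ℝ) 1) {κ : ℝ}
    (hκ : 0 < κ) (hdim : ExactDimensional μ κ) {ε ε5 : ℝ} (hε : 0 < ε) (h5 : 0 < ε5) :
    ∃ M : ℕ, mS μ (Bad2 n μ M ε5) ≤ ε := by
  obtain ⟨M, hM⟩ := sum_conc_le hn hT hsupp hκ hdim (mul_pos hε h5) h5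
  refine ⟨M, ?_⟩
  have h := mean_le_of_avg (μ := μ) (MSet_Bad2 (n := n) (μ := μ) M ε5).adm (Adm.const ε) (by
    filter_upwards [hM, eventually_gt_atTop 0] with I hI h0
    have h0' : (0 : ℝ) < I := by exact_mod_cast h0
    unfold avg
    refine div_le_div_of_nonneg_right ?_ h0'.le
    calc _ = ∑ i ∈ range I, μ.real {s | Bad2 n μ M ε5 s i} :=
          sum_congr rfl fun i _ => integral_ind (MSet_Bad2 (n := n) (μ := μ) M ε5) (i : ℤ)
      _ ≤ ∑ i ∈ range I, ε5⁻¹ * μ.real (Conc n μ M ε5 i) :=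
          sum_le_sum fun i _ => measure_Bad2_le hn M h5 i
      _ = ε5⁻¹ * ∑ i ∈ range I, μ.real (Conc n μ M ε5 i) := by rw [mul_sum]
      _ ≤ ε5⁻¹ * (ε * ε5 * I) := by gcongr
      _ = _ := by simp; field_simp)
  rwa [mean_const] at h

end Dim3
end CFP

namespace CFP
open Finset Topology

/-- Bounded functions on the space of lattices which are uniformly continuous with respect to
the left action. -/
structure IsTest (φ : Mat → ℝ) : Prop where
  bdd : ∃ C, ∀ A, |φ A| ≤ C
  inv : ∀ (A : Mat) (γ : ZMat), γ.det = 1 → φ (A * toR γ) = φ A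
  cont : ∀ ε > 0, ∃ η > 0, ∀ g : Mat, Near η g → ∀ A, |φ (g * A) - φ A| ≤ ε

/-- `η` is a modulus of continuity of `φ` at scale `ε`. -/
def Modulus (φ : Mat → ℝ) (η ε : ℝ) : Prop := ∀ g : Mat, Near η g → ∀ A, |φ (g * A) - φ A| ≤ ε

/-- Discretised time. -/
noncomputable def tm (n : ℕ) (i : ℤ) : ℝ := i * (Real.log n / 2)

lemma exp_tm {n : ℕ} (hn : 2 ≤ n) (i : ℤ) : Real.exp (2 * tm n i) = (n : ℝ) ^ i := by
  have h0 : (0 : ℝ) < n := by positivity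
  rw [tm, ← Real.rpow_intCast, Real.rpow_def_of_pos h0]
  ring_nf

lemma tm_sub (n : ℕ) (i k : ℤ) : tm n (i - k) = tm n i - tm n k := by
  simp only [tm]; push_cast; ring

/-- The value of `φ` along the orbit, sheared by `r`. -/
noncomputable def ev (n : ℕ) (φ : Mat → ℝ) (r s : ℝ) (i : ℤ) : ℝ := φ (uni r * X s (tm n i))

/-- The family generated from the evaluation of `φ` by rescaling and taking midpoints. -/
inductive Conv (n : ℕ) (φ : Mat → ℝ) : (ℝ → ℝ → ℤ → ℝ) → Prop
  | base : Conv n φ (ev n φ)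
  | comp {f} (k : ℕ) : Conv n φ f → Conv n φ fun r s i => f r ((n : ℝ) ^ k * s) (i - k)
  | mid {f g} : Conv n φ f → Conv n φ g → Conv n φ fun r s i => (f r s i + g r s i) / 2

lemma near_uni {η x : ℝ} (h : |x| ≤ η) : Near η (uni x) := by
  have h0 := (abs_nonneg x).trans h
  intro i j
  fin_cases i <;> fin_cases j <;> simp [uni, h, h0]

lemma IsTest.continuous {φ : Mat → ℝ} (hφ : IsTest φ) (r t : ℝ) :
    Continuous fun s => φ (uni r * X s t) := by
  rw [Metric.continuous_iff]
  intro s ε hε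
  obtain ⟨η, hη, h⟩ := hφ.cont (ε / 2) (half_pos hε)
  refine ⟨η * Real.exp (-(2 * t)), by positivity, fun s' hs' => ?_⟩
  rw [Real.dist_eq] at hs' ⊢
  have e : uni r * X s' t = uni ((s' - s) * Real.exp (2 * t)) * (uni r * X s t) := by
    rw [← Matrix.mul_assoc, uni_add, add_comm, ← uni_add, Matrix.mul_assoc, uni_mul_X _ s, mul_assoc,
      ← Real.exp_add]
    simp
  rw [e]
  refine lt_of_le_of_lt (h _ (near_uni ?_) _) (half_lt_self hε)
  rw [abs_mul, abs_of_pos (Real.exp_pos _)]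
  have : η = η * Real.exp (-(2 * t)) * Real.exp (2 * t) := by
    rw [mul_assoc, ← Real.exp_add]; simp
  rw [this]
  gcongr

section
variable {n : ℕ} {φ : Mat → ℝ} {f : ℝ → ℝ → ℤ → ℝ}

lemma adm_ev (hφ : IsTest φ) (r : ℝ) : Adm (ev n φ r) :=
  ⟨⟨_, fun _ _ => hφ.bdd.choose_spec _⟩, fun _ => (hφ.continuous r _).measurable⟩

lemma ev_periodic (hφ : IsTest φ) (r s : ℝ) (i m : ℤ) : ev n φ r (s + m) i = ev n φ r s i := by
  unfold ev
  rw [X_add_int, ← Matrix.mul_assoc, hφ.inv _ _ (by simp [Matrix.det_fin_two])]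

lemma half_abs_le {a b c a' b' : ℝ} (h : |a - a'| ≤ c) (h' : |b - b'| ≤ c) :
    |(a + b) / 2 - (a' + b') / 2| ≤ c := by
  rw [abs_le] at *
  constructor <;> linarith [h.1, h.2, h'.1, h'.2]

lemma Conv.bdd (hf : Conv n φ f) {C : ℝ} (hC : ∀ A, |φ A| ≤ C) (r s : ℝ) (i : ℤ) :
    |f r s i| ≤ C := by
  induction hf generalizing s i with
  | base => exact hC _
  | comp k _ ih => exact ih _ _
  | mid _ _ ih ih' =>
    have h1 := ih s i
    have h2 := ih' s i
    rw [abs_le] at h1 h2 ⊢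
    constructor <;> linarith [h1.1, h1.2, h2.1, h2.2]

lemma Conv.adm (hφ : IsTest φ) (hf : Conv n φ f) (r : ℝ) : Adm (f r) := by
  induction hf with
  | base => exact adm_ev hφ r
  | comp k _ ih => exact ih.comp (measurable_const_mul _) k
  | mid _ _ ih ih' => simpa only [div_eq_inv_mul] using (ih.add ih').const_mul 2⁻¹

lemma Conv.periodic (hφ : IsTest φ) (hf : Conv n φ f) (r s : ℝ) (i m : ℤ) :
    f r (s + m) i = f r s i := by
  induction hf generalizing s i m with
  | base => exact ev_periodic hφ r s i m
  | comp k _ ih =>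
    have := ih ((n : ℝ) ^ k * s) (i - k) ((n : ℤ) ^ k * m)
    push_cast at this
    simp only [mul_add, this]
  | mid _ _ ih ih' => simp only [ih, ih']

lemma Conv.modulus (hf : Conv n φ f) {η ε : ℝ} (h : Modulus φ η ε) {x : ℝ} (hx : |x| ≤ η)
    (r s : ℝ) (i : ℤ) : |f (x + r) s i - f r s i| ≤ ε := by
  induction hf generalizing s i with
  | base =>
    unfold ev
    rw [← uni_add, Matrix.mul_assoc]
    exact h _ (near_uni hx) _
  | comp k _ ih => exact ih _ _
  | mid _ _ ih ih' => exact half_abs_le (ih _ _) (ih' _ _)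

lemma Conv.rel (hn : 2 ≤ n) (hφ : IsTest φ) (hf : Conv n φ f) :
    ∃ K : ℕ, ∀ (s₁ s₂ : ℝ) (i₁ i₂ : ℤ) (H : Mat) (γ : ZMat), γ.det = 1 →
      ((n ^ K : ℕ) : ℤ) ∣ γ 1 0 → X s₂ (tm n i₂) = H * X s₁ (tm n i₁) * toR γ →
      ∀ η ε r r' : ℝ, Modulus φ η ε → Near η (uni r * H * uni (-r')) →
      |f r s₂ i₂ - f r' s₁ i₁| ≤ ε := by
  induction hf with
  | base =>
    refine ⟨0, fun s₁ s₂ i₁ i₂ H γ hdet _ h η ε r r' hm hnear => ?_⟩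
    unfold ev
    rw [h, ← Matrix.mul_assoc, hφ.inv _ _ hdet]
    have e : uni r * (H * X s₁ (tm n i₁)) =
        (uni r * H * uni (-r')) * (uni r' * X s₁ (tm n i₁)) := by
      rw [Matrix.mul_assoc (uni r * H), ← Matrix.mul_assoc (uni (-r')), uni_add, neg_add_cancel,
        uni_zero, Matrix.one_mul, Matrix.mul_assoc]
    rw [e]
    exact hm _ hnear _
  | comp k _ ih =>
    obtain ⟨K, hK⟩ := ih
    refine ⟨k + K, fun s₁ s₂ i₁ i₂ H γ hdet hdvd h η ε r r' hm hnear => ?_⟩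
    obtain ⟨c, hc⟩ := hdvd
    have hτ : Real.exp (2 * tm n k) = (((n : ℤ) ^ k : ℤ) : ℝ) := by
      rw [exp_tm hn]; push_cast; rw [zpow_natCast]
    obtain ⟨γ', h1, h2, h3⟩ := X_rel_scale hτ hdet
      (c := (n : ℤ) ^ K * c) (by rw [hc]; push_cast; ring) h
    push_cast at h3
    rw [← tm_sub, ← tm_sub] at h3
    exact hK _ _ _ _ H γ' h1 (by rw [h2]; exact ⟨c, by push_cast; ring⟩) h3 η ε r r' hm hnear
  | mid _ _ ih ih' =>
    obtain ⟨K, hK⟩ := ih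
    obtain ⟨K', hK'⟩ := ih'
    refine ⟨K + K', fun s₁ s₂ i₁ i₂ H γ hdet hdvd h η ε r r' hm hnear => half_abs_le
      (hK _ _ _ _ H γ hdet (dvd_trans ?_ hdvd) h η ε r r' hm hnear)
      (hK' _ _ _ _ H γ hdet (dvd_trans ?_ hdvd) h η ε r r' hm hnear)⟩
    · exact_mod_cast pow_dvd_pow n (Nat.le_add_right K K')
    · exact_mod_cast pow_dvd_pow n (Nat.le_add_left K' K)

variable {μ : Measure ℝ} [IsProbabilityMeasure μ]

lemma Conv.mean_eq (hT : MeasurePreserving (fun x : ℝ => Int.fract ((n : ℝ) * x)) μ μ)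
    (hφ : IsTest φ) (hf : Conv n φ f) (r : ℝ) : mean μ (f r) = mean μ (ev n φ r) := by
  induction hf with
  | base => rfl
  | comp k hf ih =>
    rw [← ih]
    exact mean_comp hT (hf.adm hφ r) (fun s i m => hf.periodic hφ r s i m) k
  | mid hf hg ih ih' =>
    have := mean_const_mul (μ := μ) 2⁻¹ ((hf.adm hφ r).add (hg.adm hφ r))
    rw [mean_add (hf.adm hφ r) (hg.adm hφ r), ih, ih'] at this
    simp only [div_eq_inv_mul]
    rw [this]; ring

/-- Near-minimisers of the `L²` norm in the convex family are almost invariant under rescaling. -/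
lemma exists_almost_invariant
    (hT : MeasurePreserving (fun x : ℝ => Int.fract ((n : ℝ) * x)) μ μ)
    (hφ : IsTest φ) (G : Finset ℝ) {ε : ℝ} (hε : 0 < ε) :
    ∃ f, Conv n φ f ∧ ∀ k : ℕ, ∀ r ∈ G,
      mean μ (fun s i => (f r ((n : ℝ) ^ k * s) (i - k) - f r s i) ^ 2) ≤ ε := by
  set E : (ℝ → ℝ → ℤ → ℝ) → ℝ := fun f => ∑ r ∈ G, mean μ fun s i => f r s i ^ 2 with hE
  have hE0 : ∀ f, Conv n φ f → 0 ≤ E f := fun f hf => sum_nonneg fun r _ =>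
    mean_nonneg (hf.adm hφ r).sq fun s i => sq_nonneg _
  set V : Set ℝ := E '' {f | Conv n φ f}
  have hV : BddBelow V := ⟨0, by rintro _ ⟨f, hf, rfl⟩; exact hE0 f hf⟩
  have hVne : V.Nonempty := ⟨_, _, Conv.base, rfl⟩
  obtain ⟨_, ⟨f, hf, rfl⟩, hlt⟩ := exists_lt_of_csInf_lt hVne
    (lt_add_of_pos_right (sInf V) (by positivity : 0 < ε / 4))
  have hf' : Conv n φ f := hf
  refine ⟨f, hf, fun k => ?_⟩
  have hmid := csInf_le hV ⟨_, Conv.mid hf' (Conv.comp k hf'), rfl⟩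
  have hterm : ∀ r, mean μ (fun s i => (f r ((n : ℝ) ^ k * s) (i - k) - f r s i) ^ 2) =
      4 * mean μ (fun s i => f r s i ^ 2) -
        4 * mean μ (fun s i => ((f r s i + f r ((n : ℝ) ^ k * s) (i - k)) / 2) ^ 2) := by
    intro r
    have a0 := hf'.adm hφ r
    have a1 := a0.comp (measurable_const_mul ((n : ℝ) ^ k)) k
    have a2 := (Conv.mid hf' (Conv.comp k hf')).adm hφ r
    have e1 : mean μ (fun s i => f r ((n : ℝ) ^ k * s) (i - k) ^ 2) =
        mean μ (fun s i => f r s i ^ 2) :=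
      mean_comp hT a0.sq (fun s i m => by rw [hf'.periodic hφ]) k
    have e2 : (fun s i => (f r ((n : ℝ) ^ k * s) (i - k) - f r s i) ^ 2) = fun s i =>
        (2 * f r s i ^ 2 + 2 * f r ((n : ℝ) ^ k * s) (i - k) ^ 2) -
          4 * ((f r s i + f r ((n : ℝ) ^ k * s) (i - k)) / 2) ^ 2 := by
      ext s i; ring
    rw [e2, mean_sub ((a0.sq.const_mul 2).add (a1.sq.const_mul 2)) (a2.sq.const_mul 4),
      mean_add (a0.sq.const_mul 2) (a1.sq.const_mul 2), mean_const_mul _ a0.sq,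
      mean_const_mul _ a1.sq, mean_const_mul _ a2.sq, e1]
    ring
  have hsum : ∑ r ∈ G, mean μ (fun s i => (f r ((n : ℝ) ^ k * s) (i - k) - f r s i) ^ 2) ≤ ε := by
    rw [sum_congr rfl fun r _ => hterm r, sum_sub_distrib, ← mul_sum, ← mul_sum]
    change 4 * E f - 4 * E (fun r s i => (f r s i + f r ((n : ℝ) ^ k * s) (i - k)) / 2) ≤ ε
    linarith
  intro r hr
  have a0 := hf'.adm hφ
  refine le_trans (single_le_sum (f := fun r => mean μ (fun s i =>
    (f r ((n : ℝ) ^ k * s) (i - k) - f r s i) ^ 2)) (fun r _ => ?_) hr) hsum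
  exact mean_nonneg (((a0 r).comp (measurable_const_mul ((n : ℝ) ^ k)) k).sub (a0 r)).sq
    fun s i => sq_nonneg _

end
end CFP

namespace CFP
open Finset Topology

section Choice
variable {n : ℕ} {μ : Measure ℝ} [IsProbabilityMeasure μ]

lemma measure_near_inter_le {k : ℕ} {C : Set ℝ} {a : ENNReal}
    (h : ∀ x ∈ C, μ (cell n k x) ≤ a) (c : ℝ) :
    μ ({x | |(n : ℝ) ^ k * (x - c)| < 1} ∩ C) ≤ 3 * a := by
  have hz : ∀ z, μ (idx n k z ∩ C) ≤ a := by
    intro z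
    rcases (idx n k z ∩ C).eq_empty_or_nonempty with h0 | ⟨x, hx, hxC⟩
    · rw [h0]; simp
    · refine (measure_mono Set.inter_subset_left).trans ((le_of_eq ?_).trans (h x hxC))
      have hx' : ⌊(n : ℝ) ^ k * x⌋ = z := hx
      rw [cell_eq_idx, hx']
  set z := ⌊(n : ℝ) ^ k * c⌋ with hzdef
  have hsub : {x | |(n : ℝ) ^ k * (x - c)| < 1} ∩ C ⊆
      (idx n k (z - 1) ∩ C ∪ idx n k z ∩ C) ∪ idx n k (z + 1) ∩ C := by
    rintro x ⟨hx, hxC⟩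
    have hx1 : |(n : ℝ) ^ k * (x - c)| < 1 := hx
    have hx' := abs_lt.mp hx1
    have a1 := Int.floor_le ((n : ℝ) ^ k * c)
    have a2 := Int.lt_floor_add_one ((n : ℝ) ^ k * c)
    rw [← hzdef] at a1 a2
    have b1 : z - 1 ≤ ⌊(n : ℝ) ^ k * x⌋ := by
      rw [Int.le_floor]; push_cast; linarith
    have b2 : ⌊(n : ℝ) ^ k * x⌋ < z + 2 := by
      rw [Int.floor_lt]; push_cast; linarith
    simp only [idx, Set.mem_union, Set.mem_inter_iff, Set.mem_ofPred_eq, hxC, and_true]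
    omega
  calc _ ≤ _ := measure_mono hsub
    _ ≤ a + a + a := (measure_union_le _ _).trans
      (add_le_add ((measure_union_le _ _).trans (add_le_add (hz _) (hz _))) (hz _))
    _ = 3 * a := by ring

lemma exists_in_cell {M j : ℕ} {s β : ℝ} {D b₁ b₂ : Set ℝ} (hβ : 0 < β)
    (hD : ENNReal.ofReal (β / 2) * μ (cell n j s) < μ (D ∩ cell n j s))
    (h₁ : μ (b₁ ∩ cell n j s) < ENNReal.ofReal (β / 16) * μ (cell n j s))
    (h₂ : μ (b₂ ∩ cell n j s) < ENNReal.ofReal (β / 16) * μ (cell n j s))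
    (hbad : ∀ x ∈ cell n j s,
      μ (cell n (j + M) x) ≤ ENNReal.ofReal (β / 100) * μ (cell n j s)) (c₁ c₂ : ℝ) :
    ∃ x ∈ cell n j s, x ∈ D ∧ x ∉ b₁ ∧ x ∉ b₂ ∧ 1 ≤ |(n : ℝ) ^ (j + M) * (x - c₁)| ∧
      1 ≤ |(n : ℝ) ^ (j + M) * (x - c₂)| := by
  by_contra! hcon
  set C := cell n j s
  set E₁ := {x | |(n : ℝ) ^ (j + M) * (x - c₁)| < 1}
  set E₂ := {x | |(n : ℝ) ^ (j + M) * (x - c₂)| < 1}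
  have hsub : D ∩ C ⊆ ((b₁ ∩ C ∪ b₂ ∩ C) ∪ E₁ ∩ C) ∪ E₂ ∩ C := by
    rintro x ⟨hx, hxC⟩
    by_cases q1 : x ∈ b₁
    · exact Or.inl (Or.inl (Or.inl ⟨q1, hxC⟩))
    by_cases q2 : x ∈ b₂
    · exact Or.inl (Or.inl (Or.inr ⟨q2, hxC⟩))
    by_cases q3 : 1 ≤ |(n : ℝ) ^ (j + M) * (x - c₁)|
    · exact Or.inr ⟨hcon x hxC hx q1 q2 q3, hxC⟩
    · exact Or.inl (Or.inr ⟨not_le.mp q3, hxC⟩)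
  have hle : μ (D ∩ C) ≤ ((ENNReal.ofReal (β / 16) * μ C + ENNReal.ofReal (β / 16) * μ C) +
      3 * (ENNReal.ofReal (β / 100) * μ C)) + 3 * (ENNReal.ofReal (β / 100) * μ C) := by
    refine (measure_mono hsub).trans ((measure_union_le _ _).trans (add_le_add
      ((measure_union_le _ _).trans (add_le_add ((measure_union_le _ _).trans
        (add_le_add h₁.le h₂.le)) ?_)) ?_))
    · exact measure_near_inter_le hbad c₁
    · exact measure_near_inter_le hbad c₂
  have hlt := hD.trans_le hle
  have e : ((ENNReal.ofReal (β / 16) * μ C + ENNReal.ofReal (β / 16) * μ C) +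
      3 * (ENNReal.ofReal (β / 100) * μ C)) + 3 * (ENNReal.ofReal (β / 100) * μ C) =
      ENNReal.ofReal (β / 16 + β / 16 + 3 * (β / 100) + 3 * (β / 100)) * μ C := by
    rw [ENNReal.ofReal_add (by positivity) (by positivity),
      ENNReal.ofReal_add (by positivity) (by positivity),
      ENNReal.ofReal_add (by positivity) (by positivity), ENNReal.ofReal_mul (by positivity)]
    norm_num
    ring
  rw [e] at hlt
  refine absurd hlt (not_lt.mpr ?_)
  gcongr
  linarith

end Choice

/-- A scale function: `ν e` is the last scale at which `S` does not exceed `n ^ e`. -/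
lemma exists_scales {n : ℕ} (hn : 2 ≤ n) {S : ℕ → ℝ} (h0 : S 0 ≤ 1) (hpos : ∀ N, 0 < S N)
    (h1 : ∀ N, n * S N ≤ S (N + 1)) (h2 : ∀ N, S (N + 1) ≤ (n : ℝ) ^ 2 * S N) :
    ∃ ν : ℕ → ℕ, (∀ e, S (ν e) ≤ (n : ℝ) ^ e) ∧ (∀ e, (n : ℝ) ^ e < (n : ℝ) ^ 2 * S (ν e)) ∧
      (∀ e, ν 0 ≤ ν e) ∧ (∀ e, ν e ≤ ν 0 + e) ∧ (∀ e e', ν e = ν e' → e ≤ e' + 1) ∧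
      ∀ N, S N ≤ 1 → N ≤ ν 0 := by
  have hn1 : (1 : ℝ) < n := by exact_mod_cast hn
  have hn2 : (2 : ℝ) ≤ n := by exact_mod_cast hn
  have hmono : StrictMono S := strictMono_nat_of_lt_succ fun N => by
    have := h1 N; have := hpos N; nlinarith
  have hgrow : ∀ N, (n : ℝ) ^ N * S 0 ≤ S N := by
    intro N
    induction N with
    | zero => simp
    | succ N ih =>
      refine le_trans ?_ (h1 N)
      rw [pow_succ]
      nlinarith [ih, hpos N]
  have hex : ∀ e : ℕ, ∃ N, S N ≤ (n : ℝ) ^ e ∧ (n : ℝ) ^ e < S (N + 1) := by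
    intro e
    have hunb : ∃ N, (n : ℝ) ^ e < S N := by
      obtain ⟨N, hN⟩ := pow_unbounded_of_one_lt ((n : ℝ) ^ e / S 0) hn1
      refine ⟨N, lt_of_lt_of_le ?_ (hgrow N)⟩
      rwa [div_lt_iff₀ (hpos 0)] at hN
    classical
    have hf := Nat.find_spec hunb
    have hne : Nat.find hunb ≠ 0 := fun h => by
      rw [h] at hf
      exact absurd (h0.trans (one_le_pow₀ hn1.le)) (not_le.mpr hf)
    refine ⟨Nat.find hunb - 1, not_lt.mp (Nat.find_min hunb (by omega)), ?_⟩
    rwa [Nat.sub_add_cancel (by omega)]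
  choose ν hν1 hν2 using hex
  refine ⟨ν, hν1, fun e => (hν2 e).trans_le (h2 _), fun e => ?_, fun e => ?_, fun e e' h => ?_,
    fun N hN => ?_⟩
  · have := (hν1 0).trans_lt ((by rw [pow_zero]; exact one_le_pow₀ hn1.le :
      (n : ℝ) ^ 0 ≤ (n : ℝ) ^ e).trans_lt (hν2 e))
    have := hmono.lt_iff_lt.mp this
    omega
  · have hstep : ∀ k, S (ν 0 + 1) * (n : ℝ) ^ k ≤ S (ν 0 + 1 + k) := by
      intro k
      induction k with
      | zero => simp
      | succ k ih =>
        refine le_trans ?_ (h1 (ν 0 + 1 + k))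
        rw [pow_succ]
        nlinarith
    have h3 : S (ν e) < S (ν 0 + 1 + e) := by
      refine (hν1 e).trans_lt (lt_of_lt_of_le ?_ (hstep e))
      have := hν2 0
      rw [pow_zero] at this
      have hp : (0 : ℝ) < (n : ℝ) ^ e := by positivity
      nlinarith
    have := hmono.lt_iff_lt.mp h3
    omega
  · have h3 : (n : ℝ) ^ e < (n : ℝ) ^ (e' + 2) := by
      refine (hν2 e).trans_le ((h2 _).trans ?_)
      rw [h, pow_add, mul_comm]
      gcongr
      exact hν1 e'
    have := (pow_lt_pow_iff_right₀ hn1).mp h3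
    omega
  · have := hN.trans_lt ((pow_zero (n : ℝ)).symm.trans_lt (hν2 0))
    have := hmono.lt_iff_lt.mp this
    omega

open Classical in
/-- Choice of a good scale by counting. -/
lemma exists_scale {D B₁ B₂ V : ℕ → Prop} {ν : ℕ → ℕ} {q N J : ℕ} {β : ℝ} (hβ : 0 < β)
    (hν1 : ∀ e, ν e ≤ N + e) (hν2 : ∀ e e', ν e = ν e' → e ≤ e' + 1) (hNJ : N ≤ 8 * J + 8)
    (hJ : 5 * (q + 1) ≤ β * J)
    (hD : β / 4 * (q + J + 1 : ℕ) ≤ #{l ∈ range (q + J + 1) | D l})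
    (hB₁ : (#{l ∈ range (q + J + 1) | B₁ l} : ℝ) ≤ β / 1000 * (q + J + 1 : ℕ))
    (hB₂ : (#{l ∈ range (q + J + 1) | B₂ l} : ℝ) ≤ β / 1000 * (q + J + 1 : ℕ))
    (hV : (#{l ∈ range (N + J + 1) | V l} : ℝ) ≤ β / 1000 * (N + J + 1 : ℕ)) :
    ∃ e, e ≤ J ∧ D (q + e) ∧ ¬ B₁ (q + e) ∧ ¬ B₂ (q + e) ∧ ¬ V (ν e) := by
  by_contra! hcon
  set W := q + J + 1
  set T : Finset ℕ := {e ∈ range (J + 1) | V (ν e)}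
  have hT : #T ≤ 2 * #{l ∈ range (N + J + 1) | V l} := by
    refine (card_le_mul_card_image (f := ν) T 2 fun a ha => ?_).trans
      (Nat.mul_le_mul_left 2 (card_le_card ?_))
    · rcases ({x ∈ T | ν x = a} : Finset ℕ).eq_empty_or_nonempty with h | h
      · simp [h]
      · set m := ({x ∈ T | ν x = a} : Finset ℕ).min' h
        have hm := min'_mem _ h
        have : ({x ∈ T | ν x = a} : Finset ℕ) ⊆ {m, m + 1} := by
          intro x hx
          have h1 : m ≤ x := min'_le _ _ hx
          have h2 := hν2 x m ((mem_filter.mp hx).2.trans (mem_filter.mp hm).2.symm)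
          simp only [mem_insert, mem_singleton]
          omega
        exact (card_le_card this).trans card_le_two
    · intro a ha
      obtain ⟨e, he, rfl⟩ := mem_image.mp ha
      obtain ⟨he1, he2⟩ := mem_filter.mp he
      refine mem_filter.mpr ⟨mem_range.mpr ?_, he2⟩
      have := hν1 e
      have := mem_range.mp he1
      omega
  have hsub : ({l ∈ range W | D l} : Finset ℕ) ⊆ ((range q ∪ {l ∈ range W | B₁ l}) ∪
      {l ∈ range W | B₂ l}) ∪ T.image (q + ·) := by
    intro l hl
    obtain ⟨hl1, hl2⟩ := mem_filter.mp hl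
    have hl1' := mem_range.mp hl1
    simp only [mem_union, mem_filter, mem_range, mem_image]
    by_cases hq : l < q
    · exact Or.inl (Or.inl (Or.inl hq))
    by_cases q1 : B₁ l
    · exact Or.inl (Or.inl (Or.inr ⟨hl1', q1⟩))
    by_cases q2 : B₂ l
    · exact Or.inl (Or.inr ⟨hl1', q2⟩)
    obtain ⟨e, rfl⟩ := Nat.exists_eq_add_of_le (not_lt.mp hq)
    exact Or.inr ⟨e, mem_filter.mpr ⟨mem_range.mpr (by omega), hcon e (by omega) hl2 q1 q2⟩, rfl⟩
  have hcard : #{l ∈ range W | D l} ≤ q + #{l ∈ range W | B₁ l} + #{l ∈ range W | B₂ l} +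
      2 * #{l ∈ range (N + J + 1) | V l} := by
    refine (card_le_card hsub).trans ((card_union_le _ _).trans (add_le_add
      ((card_union_le _ _).trans (add_le_add ((card_union_le _ _).trans (by simp)) le_rfl))
      (card_image_le.trans hT)))
  have hcard' : (#{l ∈ range W | D l} : ℝ) ≤ q + #{l ∈ range W | B₁ l} + #{l ∈ range W | B₂ l} +
      2 * #{l ∈ range (N + J + 1) | V l} := by exact_mod_cast hcard
  have hW : ((W : ℕ) : ℝ) = q + J + 1 := by simp [W]
  have hN : (N : ℝ) ≤ 8 * J + 8 := by exact_mod_cast hNJ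
  rw [hW] at hD hB₁ hB₂
  push_cast at hV
  have hq' : (0 : ℝ) ≤ (q : ℝ) := by positivity
  have hq : (0 : ℝ) ≤ β * q := by positivity
  have hN' := mul_le_mul_of_nonneg_left hN hβ.le
  have a1 : β / 4 * ((q : ℝ) + J + 1) = β * q / 4 + β * J / 4 + β / 4 := by ring
  have a2 : β / 1000 * ((q : ℝ) + J + 1) = β * q / 1000 + β * J / 1000 + β / 1000 := by ring
  have a3 : β / 1000 * ((N : ℝ) + J + 1) = β * N / 1000 + β * J / 1000 + β / 1000 := by ring
  have a4 : β * (8 * (J : ℝ) + 8) = 8 * (β * J) + 8 * β := by ring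
  rw [a1] at hD
  rw [a2] at hB₁ hB₂
  rw [a3] at hV
  rw [a4] at hN'
  linarith

end CFP

namespace CFP
open Finset Topology

lemma quadratic_bounds {a q ρ A m : ℝ} (hA : 0 < A) (hm : 1 ≤ m) (hq : q ≠ 0) (h1 : |ρ| ≤ A)
    (h2 : A ≤ m * |ρ|) (h3 : A ≤ m * |ρ - a / q|) :
    max (|a| * A) (|q| * A ^ 2) ≤ 2 * m ^ 2 * |ρ * a - ρ ^ 2 * q| ∧
      |ρ * a - ρ ^ 2 * q| ≤ 2 * max (|a| * A) (|q| * A ^ 2) := by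
  have hq' : 0 < |q| := abs_pos.mpr hq
  have e : |ρ * a - ρ ^ 2 * q| = |ρ| * (|q| * |ρ - a / q|) := by
    rw [← abs_mul, ← abs_mul, ← abs_neg]
    congr 1
    field_simp
    ring
  have hρ : 0 < |ρ| := by
    by_contra h
    have : |ρ| = 0 := le_antisymm (not_lt.mp h) (abs_nonneg _)
    rw [this] at h2; linarith
  have hy : 0 < |ρ - a / q| := by
    by_contra h
    have : |ρ - a / q| = 0 := le_antisymm (not_lt.mp h) (abs_nonneg _)
    rw [this] at h3; linarith
  have ha : |q| * |a / q| = |a| := by rw [← abs_mul]; congr 1; field_simp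
  have t1 : |a / q| ≤ |ρ| + |ρ - a / q| := by
    have := abs_sub ρ (ρ - a / q)
    simpa using this
  constructor
  · rw [e]
    refine max_le ?_ ?_
    · have t2 : |a| ≤ |q| * |ρ| + |q| * |ρ - a / q| := by rw [← ha]; nlinarith
      have t3 : |q| * |ρ| * A ≤ |q| * |ρ| * (m * |ρ - a / q|) :=
        mul_le_mul_of_nonneg_left h3 (by positivity)
      have t4 : |q| * |ρ - a / q| * A ≤ |q| * |ρ - a / q| * (m * |ρ|) :=
        mul_le_mul_of_nonneg_left h2 (by positivity)
      have t5 : |a| * A ≤ (|q| * |ρ| + |q| * |ρ - a / q|) * A := by gcongr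
      have t6 : 0 ≤ |ρ| * (|q| * |ρ - a / q|) := by positivity
      have t7 : m ≤ m ^ 2 := by nlinarith
      have t8 := mul_le_mul_of_nonneg_right t7 t6
      nlinarith
    · have t3 : A * A ≤ (m * |ρ|) * (m * |ρ - a / q|) := by gcongr
      have t4 := mul_le_mul_of_nonneg_left t3 hq'.le
      have t6 : 0 ≤ m ^ 2 * (|ρ| * (|q| * |ρ - a / q|)) := by positivity
      nlinarith
  · have b1 : |ρ * a - ρ ^ 2 * q| ≤ |ρ * a| + |ρ ^ 2 * q| := abs_sub _ _
    rw [abs_mul, abs_mul, abs_pow] at b1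
    have b2 : |ρ| * |a| ≤ |a| * A := by rw [mul_comm]; gcongr
    have b3 : |ρ| ^ 2 * |q| ≤ |q| * A ^ 2 := by rw [mul_comm]; gcongr
    have b4 := le_max_left (|a| * A) (|q| * A ^ 2)
    have b5 := le_max_right (|a| * A) (|q| * A ^ 2)
    linarith

lemma near_conj {H : Mat} {η R r r' : ℝ} (h00 : |H 0 0 - 1| ≤ η) (h10 : |H 1 0| ≤ η)
    (h11 : |H 1 1 - 1| ≤ η) (hr : |r| ≤ R) (hr' : |r'| ≤ R) (hrr : r' = r - H 0 1) :
    Near ((1 + R) ^ 2 * η) (uni r * H * uni (-r')) := by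
  obtain ⟨a, b, c, d, rfl⟩ : ∃ a b c d, H = !![a, b; c, d] := ⟨_, _, _, _, Matrix.eta_fin_two H⟩
  simp at h00 h10 h11 hrr
  have hη : 0 ≤ η := (abs_nonneg _).trans h10
  have hR : 0 ≤ R := (abs_nonneg _).trans hr
  have p1 : |r * c| ≤ R * η := by rw [abs_mul]; gcongr
  have p2 : |r' * c| ≤ R * η := by rw [abs_mul]; gcongr
  have p3 : |r' * (a - 1)| ≤ R * η := by rw [abs_mul]; gcongr
  have p4 : |r * (d - 1)| ≤ R * η := by rw [abs_mul]; gcongr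
  have p5 : |r * (r' * c)| ≤ R * (R * η) := by rw [abs_mul]; gcongr
  have e : (1 + R) ^ 2 * η = η + R * η + R * η + R * (R * η) := by ring
  have n1 : 0 ≤ R * η := by positivity
  have n2 : 0 ≤ R * (R * η) := by positivity
  rw [e]
  intro i j
  rw [abs_le] at *
  fin_cases i <;> fin_cases j <;> simp [uni, Matrix.mul_apply]
  · constructor <;> linarith
  · have : (a + -(r * c)) * r' + (b + -(r * d)) = r' * (a - 1) - r * (r' * c) - r * (d - 1) := by
      rw [hrr]; ring
    rw [this]
    constructor <;> linarith
  · constructor <;> linarith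
  · constructor <;> linarith

set_option maxHeartbeats 800000 in
/-- The relation between two nearby lattices after shearing and flowing back. -/
lemma shear_estimate {n : ℕ} (hn : 2 ≤ n) {s x : ℝ} {j N' N₀ e q₀ M k₁ k₂ : ℕ} {g : Mat} {γ : ZMat}
    {η η₂ : ℝ} (hg : Near η g)
    (hrel : X ((n : ℝ) ^ k₂ * s) (tm n ((j + N' : ℕ) - k₂)) =
      g * X ((n : ℝ) ^ k₁ * s) (tm n ((j + N' : ℕ) - k₁)) * toR γ)
    (hq : g 1 0 ≠ 0) (hN : N' ≤ N₀ + e)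
    (hq1 : |g 1 0| * (n : ℝ) ^ (2 * N₀) ≤ 1)
    (hS1 : max (|g 0 0 - g 1 1| * (n : ℝ) ^ N') (|g 1 0| * ((n : ℝ) ^ N') ^ 2) ≤ (n : ℝ) ^ e)
    (hS2 : (n : ℝ) ^ e < (n : ℝ) ^ 2 *
      max (|g 0 0 - g 1 1| * (n : ℝ) ^ N') (|g 1 0| * ((n : ℝ) ^ N') ^ 2))
    (hη : η * (4 * (n : ℝ) ^ (2 + 2 * M)) ≤ 1) (hη₂ : 2 * η ≤ η₂)
    (hsm : 2 ≤ η₂ * (n : ℝ) ^ (N₀ - e)) (hsm' : 2 ≤ η₂ * (n : ℝ) ^ (2 * N₀ - (q₀ + e)))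
    (he : q₀ + e ≤ N₀)
    (hx : x ∈ cell n j s) (hx1 : 1 ≤ |(n : ℝ) ^ (j + M) * (x - s)|)
    (hx2 : 1 ≤ |(n : ℝ) ^ (j + M) * (x - (s + (g 0 0 - g 1 1) / g 1 0 / (n : ℝ) ^ (j + N')))|) :
    ∃ H : Mat, X ((n : ℝ) ^ k₂ * x) (tm n (((j + N' : ℕ) - (q₀ + e : ℕ) : ℤ) - k₂)) =
        H * X ((n : ℝ) ^ k₁ * x) (tm n (((j + N' : ℕ) - (q₀ + e : ℕ) : ℤ) - k₁)) * toR γ ∧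
      |H 0 0 - 1| ≤ η₂ ∧ |H 1 0| ≤ η₂ ∧ |H 1 1 - 1| ≤ η₂ ∧
      1 ≤ 4 * (n : ℝ) ^ (q₀ + 2 + 2 * M) * |H 0 1| ∧ (n : ℝ) ^ q₀ * |H 0 1| ≤ 3 := by
  have hn1 : (1 : ℝ) ≤ n := by exact_mod_cast (by omega : 1 ≤ n)
  have hn0 : (0 : ℝ) < n := by linarith
  set ρ := (x - s) * (n : ℝ) ^ (j + N') with hρ
  have hz : ∀ k : ℕ, (n : ℝ) ^ k * s + ρ * Real.exp (-(2 * tm n ((j + N' : ℕ) - k))) =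
      (n : ℝ) ^ k * x := by
    intro k
    rw [Real.exp_neg, exp_tm hn, zpow_sub₀ hn0.ne', zpow_natCast, zpow_natCast, hρ]
    field_simp
    ring
  have hl : Real.exp (2 * tm n ((q₀ + e : ℕ) : ℤ)) = (n : ℝ) ^ (q₀ + e) := by
    rw [exp_tm hn, zpow_natCast]
  have hshear := X_rel_shear hrel ρ (tm n ((q₀ + e : ℕ) : ℤ))
  rw [hz, hz, Real.exp_neg, hl, ← tm_sub, ← tm_sub, sub_right_comm, sub_right_comm _ (k₁ : ℤ)] at hshear
  have hA : (0 : ℝ) < (n : ℝ) ^ N' := by positivity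
  have hm : (1 : ℝ) ≤ (n : ℝ) ^ M := one_le_pow₀ hn1
  have hM : (0 : ℝ) < (n : ℝ) ^ M := by positivity
  have hρA : |ρ| ≤ (n : ℝ) ^ N' := by
    have h := (cell_dist hx).le
    have e1 : ρ = (n : ℝ) ^ j * (x - s) * (n : ℝ) ^ N' := by rw [hρ, pow_add]; ring
    rw [e1, abs_mul, abs_of_pos hA]
    nlinarith
  have hρ1 : (n : ℝ) ^ N' ≤ (n : ℝ) ^ M * |ρ| := by
    have e1 : (n : ℝ) ^ M * |ρ| = |(n : ℝ) ^ (j + M) * (x - s)| * (n : ℝ) ^ N' := by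
      calc (n : ℝ) ^ M * |ρ| = |(n : ℝ) ^ M * ρ| := by rw [abs_mul ((n : ℝ) ^ M), abs_of_pos hM]
        _ = |(n : ℝ) ^ (j + M) * (x - s) * (n : ℝ) ^ N'| := by
            congr 1
            rw [hρ, pow_add, pow_add]
            ring
        _ = _ := by rw [abs_mul _ ((n : ℝ) ^ N'), abs_of_pos hA]
    rw [e1]; nlinarith
  have hρ2 : (n : ℝ) ^ N' ≤ (n : ℝ) ^ M * |ρ - (g 0 0 - g 1 1) / g 1 0| := by
    have e1 : (n : ℝ) ^ M * |ρ - (g 0 0 - g 1 1) / g 1 0| =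
        |(n : ℝ) ^ (j + M) * (x - (s + (g 0 0 - g 1 1) / g 1 0 / (n : ℝ) ^ (j + N')))| *
          (n : ℝ) ^ N' := by
      calc (n : ℝ) ^ M * |ρ - (g 0 0 - g 1 1) / (g 1 0)| =
          |(n : ℝ) ^ M * (ρ - (g 0 0 - g 1 1) / g 1 0)| := by rw [abs_mul ((n : ℝ) ^ M), abs_of_pos hM]
        _ = |(n : ℝ) ^ (j + M) * (x - (s + (g 0 0 - g 1 1) / g 1 0 / (n : ℝ) ^ (j + N'))) *
            (n : ℝ) ^ N'| := by
            congr 1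
            rw [hρ, pow_add, pow_add]
            field_simp
            ring
        _ = _ := by rw [abs_mul _ ((n : ℝ) ^ N'), abs_of_pos hA]
    rw [e1]; nlinarith
  obtain ⟨b1, b2⟩ := quadratic_bounds hA hm hq hρA hρ1 hρ2
  have g00 := hg 0 0
  have g01 := hg 0 1
  have g11 := hg 1 1
  simp at g00 g01 g11
  have hη0 : 0 ≤ η := (abs_nonneg _).trans g01
  have hE : (0 : ℝ) < (n : ℝ) ^ e := by positivity
  have hQ : (0 : ℝ) < (n : ℝ) ^ q₀ := by positivity
  have hη₂0 : 0 ≤ η₂ := by linarith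
  have hρq : |ρ * g 1 0| ≤ η₂ / 2 := by
    have c1 : |ρ * g 1 0| * (n : ℝ) ^ (N₀ - e) ≤ 1 := by
      rw [abs_mul]
      calc |ρ| * |g 1 0| * (n : ℝ) ^ (N₀ - e)
          ≤ (n : ℝ) ^ N' * |g 1 0| * (n : ℝ) ^ (N₀ - e) := by gcongr
        _ = |g 1 0| * (n : ℝ) ^ (N' + (N₀ - e)) := by rw [pow_add]; ring
        _ ≤ |g 1 0| * (n : ℝ) ^ (2 * N₀) := by
            have := pow_le_pow_right₀ hn1 (by omega : N' + (N₀ - e) ≤ 2 * N₀)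
            gcongr
        _ ≤ 1 := hq1
    have c2 : (0 : ℝ) < (n : ℝ) ^ (N₀ - e) := by positivity
    refine le_of_mul_le_mul_right (c1.trans ?_) c2
    linarith
  have hlq : |(n : ℝ) ^ (q₀ + e) * g 1 0| ≤ η₂ := by
    have c1 : |(n : ℝ) ^ (q₀ + e) * g 1 0| * (n : ℝ) ^ (2 * N₀ - (q₀ + e)) ≤ 1 := by
      rw [abs_mul, abs_of_pos (by positivity : (0 : ℝ) < (n : ℝ) ^ (q₀ + e))]
      refine (le_of_eq ?_).trans hq1
      have : (n : ℝ) ^ (2 * N₀) = (n : ℝ) ^ (q₀ + e) * (n : ℝ) ^ (2 * N₀ - (q₀ + e)) := by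
        rw [← pow_add]; congr 1; omega
      rw [this]; ring
    have c2 : (0 : ℝ) < (n : ℝ) ^ (2 * N₀ - (q₀ + e)) := by positivity
    refine le_of_mul_le_mul_right (c1.trans ?_) c2
    linarith
  have hH01 : (n : ℝ) ^ (q₀ + e) * |((n : ℝ) ^ (q₀ + e))⁻¹ *
      (g 0 1 + (ρ * (g 0 0 - g 1 1) - ρ ^ 2 * g 1 0))| =
      |g 0 1 + (ρ * (g 0 0 - g 1 1) - ρ ^ 2 * g 1 0)| := by
    rw [abs_mul, abs_of_pos (by positivity : (0 : ℝ) < ((n : ℝ) ^ (q₀ + e))⁻¹)]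
    field_simp
  set w := ρ * (g 0 0 - g 1 1) - ρ ^ 2 * g 1 0 with hw
  have u1 : |g 0 1 + w| ≤ η + |w| := (abs_add_le _ _).trans (by linarith)
  have u2 : |w| - η ≤ |g 0 1 + w| := by
    have := abs_sub_abs_le_abs_sub w (-(g 0 1))
    rw [abs_neg, sub_neg_eq_add, add_comm w] at this
    linarith
  have hP : (1 : ℝ) ≤ (n : ℝ) ^ (2 + 2 * M) := one_le_pow₀ hn1
  have hη4 : η ≤ 1 := by nlinarith
  refine ⟨_, hshear, ?_, ?_, ?_, ?_, ?_⟩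
  · simp only [Matrix.of_apply, Matrix.cons_val', Matrix.cons_val_zero, Matrix.cons_val_fin_one]
    rw [abs_le] at *
    constructor <;> linarith
  · simpa using hlq
  · simp only [Matrix.of_apply, Matrix.cons_val', Matrix.cons_val_one, Matrix.cons_val_fin_one]
    rw [abs_le] at *
    constructor <;> linarith
  · simp only [Matrix.of_apply, Matrix.cons_val', Matrix.cons_val_one, Matrix.cons_val_zero,
      Matrix.cons_val_fin_one]
    have v1 : (n : ℝ) ^ e ≤ 2 * (n : ℝ) ^ (2 + 2 * M) * |w| := by
      refine hS2.le.trans ?_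
      calc _ ≤ (n : ℝ) ^ 2 * (2 * ((n : ℝ) ^ M) ^ 2 * |w|) := by gcongr
        _ = _ := by ring
    have v2 : (n : ℝ) ^ e ≤ 4 * (n : ℝ) ^ (2 + 2 * M) * |g 0 1 + w| := by
      have e1 : (1 : ℝ) ≤ (n : ℝ) ^ e := one_le_pow₀ hn1
      have e2 := mul_le_mul_of_nonneg_left u2 (by positivity : (0 : ℝ) ≤ (n : ℝ) ^ (2 + 2 * M))
      rw [mul_sub] at e2
      linarith
    rw [← hH01] at v2
    have v3 : (n : ℝ) ^ e * 1 ≤ (n : ℝ) ^ e * (4 * (n : ℝ) ^ (q₀ + 2 + 2 * M) *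
        |((n : ℝ) ^ (q₀ + e))⁻¹ * (g 0 1 + w)|) := by
      rw [mul_one]
      refine v2.trans (le_of_eq ?_)
      rw [pow_add _ q₀ e, pow_add _ (q₀ + 2), pow_add _ q₀ 2, pow_add _ 2]
      ring
    exact le_of_mul_le_mul_left v3 hE
  · simp only [Matrix.of_apply, Matrix.cons_val', Matrix.cons_val_one, Matrix.cons_val_zero,
      Matrix.cons_val_fin_one]
    have v2 : |g 0 1 + w| ≤ 3 * (n : ℝ) ^ e := by
      have e1 : (1 : ℝ) ≤ (n : ℝ) ^ e := one_le_pow₀ hn1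
      linarith
    rw [← hH01] at v2
    have v3 : (n : ℝ) ^ e * ((n : ℝ) ^ q₀ * |((n : ℝ) ^ (q₀ + e))⁻¹ * (g 0 1 + w)|) ≤
        (n : ℝ) ^ e * 3 := by
      refine (le_of_eq ?_).trans (v2.trans (le_of_eq (mul_comm _ _)))
      rw [pow_add _ q₀ e]; ring
    exact le_of_mul_le_mul_left v3 hE

/-- A function almost invariant under a small step is almost constant. -/
lemma chain_bound {F : ℝ → ℝ} {r₀ δ δmin η ε₁ ε : ℝ} (hr₀ : 0 < r₀) (hmin : 0 < δmin)
    (h1 : δmin ≤ |δ|) (h2 : |δ| ≤ η) (hε₁ : 0 ≤ ε₁)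
    (hF : ∀ r ∈ Set.Icc 0 r₀, r + δ ∈ Set.Icc 0 r₀ → |F (r + δ) - F r| ≤ ε₁)
    (hη : ∀ r x, |x| ≤ η → |F (x + r) - F r| ≤ ε) :
    |F r₀ - F 0| ≤ r₀ / δmin * ε₁ + ε := by
  set d := |δ| with hd
  have hd0 : 0 < d := hmin.trans_le h1
  have hF' : ∀ r ∈ Set.Icc 0 r₀, r + d ∈ Set.Icc 0 r₀ → |F (r + d) - F r| ≤ ε₁ := by
    intro r hr hrd
    rcases abs_cases δ with ⟨h, _⟩ | ⟨h, _⟩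
    · rw [hd, h] at hrd ⊢; exact hF r hr hrd
    · have := hF (r + d) hrd (by rw [hd, h]; simpa using hr)
      rw [abs_sub_comm]
      rwa [show r + d + δ = r by rw [hd, h]; ring] at this
  have hk : ∀ k : ℕ, k * d ≤ r₀ → |F (k * d) - F 0| ≤ k * ε₁ := by
    intro k
    induction k with
    | zero => simp
    | succ k ih =>
      intro h
      push_cast at h ⊢
      have h3 : (k : ℝ) * d ≤ r₀ := by nlinarith
      have h4 := hF' (k * d) ⟨by positivity, h3⟩ ⟨by positivity, by linarith⟩
      have h5 := abs_sub_le (F (k * d + d)) (F (k * d)) (F 0)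
      rw [show ((k : ℝ) + 1) * d = k * d + d by ring]
      linarith [ih h3]
  have f1 := Nat.floor_le (by positivity : 0 ≤ r₀ / d)
  have f2 := Nat.lt_floor_add_one (r₀ / d)
  set N := ⌊r₀ / d⌋₊
  rw [le_div_iff₀ hd0] at f1
  rw [div_lt_iff₀ hd0] at f2
  have h6 := hk N f1
  have h7 := hη (N * d) (r₀ - N * d) (by rw [abs_of_nonneg (by linarith)]; linarith)
  rw [sub_add_cancel] at h7
  have h8 : (N : ℝ) ≤ r₀ / δmin := by
    rw [le_div_iff₀ hmin]
    nlinarith [Nat.cast_nonneg (α := ℝ) N]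
  have h9 := mul_le_mul_of_nonneg_right h8 hε₁
  have := abs_sub_le (F r₀) (F (N * d)) (F 0)
  linarith

end CFP

namespace CFP
open Finset Topology

lemma entry_ne_zero {n : ℕ} (hn : 2 ≤ n) {s : ℝ} {i k₁ k₂ : ℕ} (hk : k₁ < k₂) {g : Mat} {γ : ZMat}
    {η : ℝ} (hg : Near η g) (hη : η ≤ 1 / 10) (hdet : γ.det = 1)
    (hrel : X ((n : ℝ) ^ k₂ * s) (tm n (i - k₂)) =
      g * X ((n : ℝ) ^ k₁ * s) (tm n (i - k₁)) * toR γ) :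
    1 ≤ |g 1 0| * (n : ℝ) ^ i := by
  have hn1 : (1 : ℝ) ≤ n := by exact_mod_cast (by omega : 1 ≤ n)
  have hn2 : (2 : ℝ) ≤ n := by exact_mod_cast hn
  have hn0 : (0 : ℝ) < n := by linarith
  obtain ⟨h1, h2⟩ := X_rel_entries hdet hrel
  have hγ : γ 1 0 ≠ 0 := by
    intro h
    have h3 := h2 h
    have h4 : |g 0 0| ^ 2 * (n : ℝ) ^ (k₂ - k₁) = 1 := by
      rw [h3, ← Real.exp_nat_mul]
      have e : ((2 : ℕ) : ℝ) * (tm n (i - k₂) - tm n (i - k₁)) = 2 * tm n (k₁ - k₂) := by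
        simp only [tm]; push_cast; ring
      rw [e, exp_tm hn, ← zpow_natCast, ← zpow_add₀ hn0.ne', Nat.cast_sub hk.le]
      simp
    have h5 : (2 : ℝ) ≤ (n : ℝ) ^ (k₂ - k₁) :=
      hn2.trans (le_self_pow₀ hn1 (by omega))
    have h6 := hg 0 0
    simp at h6
    have h7 : 9 / 10 ≤ |g 0 0| := by
      rw [abs_le] at h6
      exact le_trans (by linarith) (le_abs_self _)
    nlinarith
  have h3 : (1 : ℝ) ≤ |(γ 1 0 : ℝ)| := by exact_mod_cast Int.one_le_abs hγ
  rw [h1, abs_mul, abs_neg, Real.abs_exp]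
  have h4 : 1 ≤ Real.exp (-(tm n (i - k₁) + tm n (i - k₂))) * (n : ℝ) ^ i := by
    rw [← zpow_natCast, ← exp_tm hn, ← Real.exp_add]
    rw [Real.one_le_exp_iff]
    simp only [tm]; push_cast
    have : 0 ≤ Real.log n := Real.log_nonneg hn1
    have e : -((i - k₁ : ℝ) * (Real.log n / 2) + (i - k₂) * (Real.log n / 2)) +
      2 * (i * (Real.log n / 2)) = (k₁ + k₂) * (Real.log n / 2) := by ring
    rw [e]
    positivity
  rw [mul_assoc]
  nlinarith

section
variable {n : ℕ} {μ : Measure ℝ} [IsProbabilityMeasure μ]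

set_option maxHeartbeats 400000 in
/-- From two nearby lattices along an orbit, find a nearby point with a definite shear between
the corresponding lattices. -/
lemma exists_sheared_point (hn : 2 ≤ n) {D b₁ b₂ : ℝ → ℤ → Prop} {s β η η₂ : ℝ}
    {i k₁ k₂ q₀ M J₀ : ℕ} {g : Mat} {γ : ZMat} (hβ : 0 < β) (hg : Near η g) (hk : k₁ < k₂)
    (hdet : γ.det = 1)
    (hrel : X ((n : ℝ) ^ k₂ * s) (tm n (i - k₂)) =
      g * X ((n : ℝ) ^ k₁ * s) (tm n (i - k₁)) * toR γ)
    (hη : η ≤ 1 / 10) (hηM : η * (4 * (n : ℝ) ^ (2 + 2 * M)) ≤ 1) (hη₂ : 2 * η ≤ η₂)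
    (hηJ : 2 * η * (n : ℝ) ^ (2 * (8 * J₀)) ≤ 1) (hβJ : 5 * (q₀ + 1) ≤ β * J₀)
    (hJ : 2 ≤ η₂ * (n : ℝ) ^ J₀) (hqJ : q₀ + 1 ≤ J₀)
    (hD : Most (Dense n μ D (β / 2)) (β / 4) s i)
    (hb₁ : Few (Heavy n μ b₁ (β / 16)) (β / 1000) s i)
    (hb₂ : Few (Heavy n μ b₂ (β / 16)) (β / 1000) s i)
    (hV : Few (Bad2 n μ M (β / 100)) (β / 1000) s i) :
    ∃ (x : ℝ) (l : ℕ) (H : Mat), D x (i - l) ∧ ¬ b₁ x (i - l) ∧ ¬ b₂ x (i - l) ∧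
      X ((n : ℝ) ^ k₂ * x) (tm n ((i : ℤ) - l - k₂)) =
        H * X ((n : ℝ) ^ k₁ * x) (tm n ((i : ℤ) - l - k₁)) * toR γ ∧
      |H 0 0 - 1| ≤ η₂ ∧ |H 1 0| ≤ η₂ ∧ |H 1 1 - 1| ≤ η₂ ∧
      1 ≤ 4 * (n : ℝ) ^ (q₀ + 2 + 2 * M) * |H 0 1| ∧ (n : ℝ) ^ q₀ * |H 0 1| ≤ 3 := by
  have hn1 : (1 : ℝ) < n := by exact_mod_cast (by omega : 1 < n)
  have hn0 : (0 : ℝ) < n := by linarith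
  have hq := entry_ne_zero hn hk hg hη hdet hrel
  have hq0 : 0 < |g 1 0| := by
    by_contra h
    have : |g 1 0| = 0 := le_antisymm (not_lt.mp h) (abs_nonneg _)
    rw [this] at hq; linarith
  set S : ℕ → ℝ := fun N => max (|g 0 0 - g 1 1| * (n : ℝ) ^ N) (|g 1 0| * ((n : ℝ) ^ N) ^ 2) with hS
  have ga : |g 0 0 - g 1 1| ≤ 2 * η := by
    have h0 := hg 0 0
    have h1 := hg 1 1
    simp at h0 h1
    rw [abs_le] at *
    constructor <;> linarith
  have gq : |g 1 0| ≤ 2 * η := by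
    have h0 := hg 1 0
    simp at h0
    linarith [abs_nonneg (g 1 0)]
  have hS0 : S 0 ≤ 1 := by
    simp only [hS, pow_zero, mul_one, one_pow]
    exact max_le (by linarith) (by linarith)
  have hSpos : ∀ N, 0 < S N := fun N => lt_max_of_lt_right (by positivity)
  have hS1 : ∀ N, n * S N ≤ S (N + 1) := by
    intro N
    simp only [hS]
    rw [mul_max_of_nonneg _ _ hn0.le]
    refine max_le_max (le_of_eq (by ring)) ?_
    have : (n : ℝ) * (|g 1 0| * ((n : ℝ) ^ N) ^ 2) ≤ n * (n * (|g 1 0| * ((n : ℝ) ^ N) ^ 2)) := by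
      refine mul_le_mul_of_nonneg_left ?_ hn0.le
      exact le_mul_of_one_le_left (by positivity) hn1.le
    exact this.trans (le_of_eq (by ring))
  have hS2 : ∀ N, S (N + 1) ≤ (n : ℝ) ^ 2 * S N := by
    intro N
    simp only [hS]
    rw [mul_max_of_nonneg _ _ (by positivity)]
    refine max_le_max ?_ (le_of_eq (by ring))
    have : (n : ℝ) * (|g 0 0 - g 1 1| * (n : ℝ) ^ N) ≤
        n * (n * (|g 0 0 - g 1 1| * (n : ℝ) ^ N)) := by
      refine mul_le_mul_of_nonneg_left ?_ hn0.le
      exact le_mul_of_one_le_left (by positivity) hn1.le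
    exact (le_of_eq (by ring)).trans (this.trans (le_of_eq (by ring)))
  obtain ⟨ν, hν1, hν2, hν3, hν4, hν5, hν6⟩ := exists_scales hn hS0 hSpos hS1 hS2
  have hN₀ : 8 * J₀ ≤ ν 0 := by
    refine hν6 _ (max_le ?_ ?_)
    · refine le_trans ?_ hηJ
      exact mul_le_mul ga (pow_le_pow_right₀ hn1.le (by omega)) (by positivity)
        ((abs_nonneg _).trans ga)
    · rw [← pow_mul, mul_comm (8 * J₀)]
      refine le_trans ?_ hηJ
      gcongr
  set N₀ := ν 0
  set J := N₀ / 8 with hJdef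
  have hJJ : J₀ ≤ J := by omega
  have hq1 : |g 1 0| * (n : ℝ) ^ (2 * N₀) ≤ 1 := by
    have h := (le_max_right _ _).trans (hν1 0)
    rw [pow_zero, ← pow_mul, mul_comm _ 2] at h
    exact h
  have hi : 2 * N₀ ≤ i := by
    have h := le_of_mul_le_mul_left (hq1.trans hq) hq0
    exact (pow_le_pow_iff_right₀ hn1).mp h
  have hβJ' : 5 * ((q₀ : ℝ) + 1) ≤ β * J := by
    refine hβJ.trans ?_
    gcongr
  obtain ⟨e, heJ, h1, h2, h3, h4⟩ := exists_scale (q := q₀) (J := J) (N := N₀) hβ hν4 hν5 (by omega)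
    hβJ' (hD (q₀ + J + 1) (by omega)) (hb₁ (q₀ + J + 1) (by omega)) (hb₂ (q₀ + J + 1) (by omega))
    (hV (N₀ + J + 1) (by omega))
  have hNe := hν4 e
  have hNe' := hν3 e
  set N' := ν e
  obtain ⟨j, hj⟩ := Nat.exists_eq_add_of_le' (by omega : N' ≤ i)
  have hjl : (j : ℤ) ≤ (i : ℤ) - (q₀ + e : ℕ) := by omega
  have hj' : ((i : ℤ) - (N' : ℤ)).toNat = j := by omega
  have hD' := h1 j hjl
  have hb₁' : μ ({x | b₁ x ((i : ℤ) - (q₀ + e : ℕ))} ∩ cell n j s) <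
      ENNReal.ofReal (β / 16) * μ (cell n j s) := by
    by_contra hc
    exact h2 ⟨j, hjl, not_lt.mp hc⟩
  have hb₂' : μ ({x | b₂ x ((i : ℤ) - (q₀ + e : ℕ))} ∩ cell n j s) <
      ENNReal.ofReal (β / 16) * μ (cell n j s) := by
    by_contra hc
    exact h3 ⟨j, hjl, not_lt.mp hc⟩
  have hbad : ∀ x ∈ cell n j s,
      μ (cell n (j + M) x) ≤ ENNReal.ofReal (β / 100) * μ (cell n j s) := by
    intro x hx
    by_contra hc
    refine h4 ⟨x, by rwa [hj'], ?_⟩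
    rw [hj']
    show ENNReal.ofReal (β / 100) * μ (cell n j x) < μ (cell n (j + M) x)
    rw [cell_eq hx]
    exact not_le.mp hc
  obtain ⟨x, hxc, hxD, hx1, hx2, hx3, hx4⟩ := exists_in_cell hβ hD' hb₁' hb₂' hbad s
    (s + (g 0 0 - g 1 1) / g 1 0 / (n : ℝ) ^ (j + N'))
  subst hj
  have hJ₀ : (n : ℝ) ^ J₀ ≤ (n : ℝ) ^ (N₀ - e) := pow_le_pow_right₀ hn1.le (by omega)
  have hJ₁ : (n : ℝ) ^ J₀ ≤ (n : ℝ) ^ (2 * N₀ - (q₀ + e)) := pow_le_pow_right₀ hn1.le (by omega)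
  have hη0 : 0 ≤ η := by linarith
  have hη₂0 : 0 ≤ η₂ := by linarith
  obtain ⟨H, hH⟩ := shear_estimate hn hg hrel (abs_pos.mp hq0) hNe hq1 (hν1 e) (hν2 e) hηM hη₂
    (hJ.trans (by gcongr)) (hJ.trans (by gcongr)) (by omega : q₀ + e ≤ N₀) hxc hx3 hx4
  exact ⟨x, q₀ + e, H, hxD, hx1, hx2, hH⟩

end
end CFP

namespace CFP
open Finset Topology

lemma Thick.add_int {δ s t : ℝ} (h : Thick δ s t) (m : ℤ) : Thick δ (s + m) t := by
  intro a k hak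
  have := h (a - k * m) k (by rintro ⟨h1, rfl⟩; exact hak ⟨by simpa using h1, rfl⟩)
  convert this using 4
  push_cast; ring

lemma thick_add_int_iff {δ s t : ℝ} (m : ℤ) : Thick δ (s + m) t ↔ Thick δ s t :=
  ⟨fun h => by simpa using h.add_int (-m), fun h => h.add_int m⟩

lemma measurableSet_thick (δ t : ℝ) : MeasurableSet {s | Thick δ s t} := by
  have : {s | Thick δ s t} = ⋂ m : ℤ, ⋂ k : ℤ, {s | ¬(m = 0 ∧ k = 0) →
      δ ≤ max |Real.exp t * ((m : ℝ) - (k : ℝ) * s)| |Real.exp (-t) * (k : ℝ)|} := by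
    ext s; simp [Thick]
  rw [this]
  refine MeasurableSet.iInter fun m => MeasurableSet.iInter fun k => ?_
  by_cases h : m = 0 ∧ k = 0
  · simp [h]
  · simp only [h, not_false_eq_true, true_implies]
    exact measurableSet_le measurable_const (by fun_prop)

lemma MSet_thick (n : ℕ) (δ : ℝ) : MSet fun s i => Thick δ s (tm n i) :=
  fun i => measurableSet_thick δ _

/-- If the values along two orbits agree with `F` and differ by a definite shear, then `F` is
almost constant. -/
lemma almost_const_of_shear {φ : Mat → ℝ} {F F₁ F₂ : ℝ → ℝ} {H : Mat} {r₀ η₂ ε₁ ε δmin ηm : ℝ}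
    (hr₀ : 0 < r₀) (hmin : 0 < δmin) (hε₁ : 0 ≤ ε₁)
    (hrel : ∀ η ε r r' : ℝ, Modulus φ η ε → Near η (uni r * H * uni (-r')) → |F₂ r - F₁ r'| ≤ ε)
    (h₁ : ∀ r ∈ Set.Icc 0 r₀, |F₁ r - F r| ≤ 3 * ε₁)
    (h₂ : ∀ r ∈ Set.Icc 0 r₀, |F₂ r - F r| ≤ 3 * ε₁)
    (hH00 : |H 0 0 - 1| ≤ η₂) (hH10 : |H 1 0| ≤ η₂) (hH11 : |H 1 1 - 1| ≤ η₂)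
    (hm : Modulus φ ((1 + r₀) ^ 2 * η₂) ε₁) (hl : δmin ≤ |H 0 1|) (hu : |H 0 1| ≤ ηm)
    (hF : ∀ r x, |x| ≤ ηm → |F (x + r) - F r| ≤ ε) :
    |F r₀ - F 0| ≤ r₀ / δmin * (7 * ε₁) + ε := by
  refine chain_bound (δ := -(H 0 1)) hr₀ hmin (by rwa [abs_neg]) (by rwa [abs_neg]) (by positivity)
    (fun r hr hr' => ?_) hF
  have a1 := hrel _ _ r (r + -(H 0 1)) hm (near_conj (R := r₀) hH00 hH10 hH11
    (abs_le.mpr ⟨by linarith [hr.1], hr.2⟩) (abs_le.mpr ⟨by linarith [hr'.1], hr'.2⟩) rfl)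
  have a2 := h₁ _ hr'
  have a3 := h₂ _ hr
  rw [abs_le] at *
  constructor <;> linarith

/-- A finite grid of step `η` in `[0, r₀]`. -/
lemma exists_grid {r₀ η : ℝ} (hη : 0 < η) :
    ∃ G : Finset ℝ, ∀ r ∈ Set.Icc 0 r₀, ∃ g ∈ G, |r - g| ≤ η := by
  refine ⟨(range (⌈r₀ / η⌉₊ + 1)).image fun j : ℕ => j * η, fun r hr => ?_⟩
  have h0 : 0 ≤ r / η := div_nonneg hr.1 hη.le
  have h1 := Nat.floor_le h0
  have h2 := Nat.lt_floor_add_one (r / η)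
  refine ⟨⌊r / η⌋₊ * η, mem_image.mpr ⟨_, mem_range.mpr ?_, rfl⟩, ?_⟩
  · have h3 : ⌊r / η⌋₊ ≤ ⌈r₀ / η⌉₊ := (Nat.floor_le_ceil _).trans (Nat.ceil_le_ceil (by
      have := hr.2
      gcongr))
    omega
  · rw [le_div_iff₀ hη] at h1
    rw [div_lt_iff₀ hη] at h2
    rw [abs_le]
    constructor <;> linarith

section
variable {n : ℕ} {μ : Measure ℝ} [IsProbabilityMeasure μ]

lemma mS_not_thick_comp (hT : MeasurePreserving (fun x : ℝ => Int.fract ((n : ℝ) * x)) μ μ)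
    (δ : ℝ) (k : ℕ) :
    mS μ (fun s i => ¬ Thick δ ((n : ℝ) ^ k * s) (tm n (i - k))) =
      mS μ fun s i => ¬ Thick δ s (tm n i) := by
  unfold mS
  exact mean_comp hT (MSet_thick n δ).not.adm (fun s i m => by
    by_cases h : Thick δ s (tm n i) <;> simp [ind, thick_add_int_iff, h]) k

/-- The event that some grid value of `f` is not almost invariant under rescaling. -/
def Var (n : ℕ) (f : ℝ → ℝ → ℤ → ℝ) (G : Finset ℝ) (ε : ℝ) (k : ℕ) (s : ℝ) (i : ℤ) : Prop :=
  ∃ r ∈ G, ε < |f r ((n : ℝ) ^ k * s) (i - k) - f r s i|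

lemma MSet_Var {φ : Mat → ℝ} (hφ : IsTest φ) {f : ℝ → ℝ → ℤ → ℝ} (hf : Conv n φ f) (G : Finset ℝ)
    (ε : ℝ) (k : ℕ) : MSet (Var n f G ε k) := by
  have := MSet.ex fun r : G => (Adm.const ε).mset_lt
    (((hf.adm hφ r).comp (measurable_const_mul ((n : ℝ) ^ k)) k).sub (hf.adm hφ r)).abs
  have e : Var n f G ε k = fun s i => ∃ r : G,
      ε < |f r ((n : ℝ) ^ k * s) (i - k) - f r s i| := by
    ext s i
    simp [Var]
  rwa [e]

lemma mS_Var_le {φ : Mat → ℝ} (hφ : IsTest φ) {f : ℝ → ℝ → ℤ → ℝ} (hf : Conv n φ f) (G : Finset ℝ)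
    {ε c : ℝ} (hε : 0 < ε) {k : ℕ}
    (h : ∀ r ∈ G, mean μ (fun s i => (f r ((n : ℝ) ^ k * s) (i - k) - f r s i) ^ 2) ≤ c) :
    mS μ (Var n f G ε k) ≤ G.card * (c / ε ^ 2) := by
  have hm : ∀ r : ℝ, Adm fun s i => f r ((n : ℝ) ^ k * s) (i - k) - f r s i := fun r =>
    ((hf.adm hφ r).comp (measurable_const_mul ((n : ℝ) ^ k)) k).sub (hf.adm hφ r)
  have hP : ∀ r : G, MSet fun s i => ε < |f r ((n : ℝ) ^ k * s) (i - k) - f r s i| :=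
    fun r => (Adm.const ε).mset_lt (hm r).abs
  have h1 := mS_ex_le (μ := μ) (univ : Finset G) hP
  have e : Var n f G ε k = fun s i => ∃ r ∈ (univ : Finset G),
      ε < |f r ((n : ℝ) ^ k * s) (i - k) - f r s i| := by
    ext s i
    simp [Var]
  rw [e]
  refine h1.trans ((sum_le_card_nsmul _ _ (c / ε ^ 2) fun r _ => ?_).trans (by simp))
  refine (markov (hm r).sq (fun s i => sq_nonneg _) (by positivity : 0 < ε ^ 2) (hP r)
    fun s i hlt => ?_).trans (div_le_div_of_nonneg_right (h r r.2) (by positivity))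
  rw [← sq_abs (f _ _ _ - _)]
  gcongr

end
end CFP

namespace CFP
open Finset Topology

section
variable {n : ℕ} {μ : Measure ℝ} [IsProbabilityMeasure μ]

lemma not_many_good (hn : 2 ≤ n) {φ : Mat → ℝ} (hφ : IsTest φ) {f : ℝ → ℝ → ℤ → ℝ}
    (hf : Conv n φ f) {r₀ ε' ε₁ β δth δmin ηm η₁ η₂ η s : ℝ} {G : Finset ℝ} {q₀ M J₀ N i : ℕ}
    [NeZero N] {S : Finset ℕ} {B : ℕ}
    (hr₀ : 0 < r₀) (hε' : 0 < ε') (hβ : 0 < β)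
    (hN : ∀ (s₁ s₂ : ℝ) (i₁ i₂ : ℤ) (H : Mat) (γ : ZMat), γ.det = 1 →
      (N : ℤ) ∣ γ 1 0 → X s₂ (tm n i₂) = H * X s₁ (tm n i₁) * toR γ →
      ∀ η ε r r' : ℝ, Modulus φ η ε → Near η (uni r * H * uni (-r')) →
      |f r s₂ i₂ - f r' s₁ i₁| ≤ ε)
    (hm : Modulus φ ηm (ε' / 4)) (hq : 3 ≤ ηm * (n : ℝ) ^ q₀)
    (hδmin : δmin = 1 / (4 * (n : ℝ) ^ (q₀ + 2 + 2 * M)))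
    (hε₁ : ε₁ = ε' * δmin / (28 * r₀)) (hm₁ : Modulus φ η₁ ε₁)
    (hG : ∀ r ∈ Set.Icc 0 r₀, ∃ g ∈ G, |r - g| ≤ η₁)
    (hη₂₁ : (1 + r₀) ^ 2 * η₂ = η₁)
    (hη : η ≤ 1 / 10) (hηM : η * (4 * (n : ℝ) ^ (2 + 2 * M)) ≤ 1) (hη₂ : 2 * η ≤ η₂)
    (hηJ : 2 * η * (n : ℝ) ^ (2 * (8 * J₀)) ≤ 1) (hβJ : 5 * (q₀ + 1) ≤ β * J₀)
    (hJ : 2 ≤ η₂ * (n : ℝ) ^ J₀) (hqJ : q₀ + 1 ≤ J₀)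
    (hB : ∀ (S : Finset ℕ) (z t : ℕ → ℝ), B < S.card → (∀ k ∈ S, Thick δth (z k) (t k)) →
      ∃ k₁ ∈ S, ∃ k₂ ∈ S, k₁ < k₂ ∧ ∃ (g : Mat) (γ : ZMat), Near η g ∧ γ.det = 1 ∧
        (N : ℤ) ∣ γ 1 0 ∧ X (z k₂) (t k₂) = g * X (z k₁) (t k₁) * toR γ)
    (hD : Most (Dense n μ (fun s i => ε' < |f r₀ s i - f 0 s i|) (β / 2)) (β / 4) s i)
    (hV : Few (Bad2 n μ M (β / 100)) (β / 1000) s i)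
    (hS : B < S.card) (hS₁ : ∀ k ∈ S, Thick δth ((n : ℝ) ^ k * s) (tm n (i - k)))
    (hS₂ : ∀ k ∈ S, Few (Heavy n μ (Var n f G ε₁ k) (β / 16)) (β / 1000) s i) : False := by
  obtain ⟨k₁, hk₁, k₂, hk₂, hk, g, γ, hg, hdet, hdvd, hrel⟩ :=
    hB S (fun k => (n : ℝ) ^ k * s) (fun k => tm n (i - k)) hS hS₁
  obtain ⟨x, l, H, hx, hb₁, hb₂, hrel', h00, h10, h11, hl, hu⟩ :=
    exists_sheared_point hn hβ hg hk hdet hrel hη hηM hη₂ hηJ hβJ hJ hqJ hD (hS₂ k₁ hk₁)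
      (hS₂ k₂ hk₂) hV
  have hn0 : (0 : ℝ) < n := by positivity
  have hδ0 : 0 < δmin := by rw [hδmin]; positivity
  have hε₁0 : 0 < ε₁ := by rw [hε₁]; positivity
  have hgrid : ∀ k : ℕ, ¬ Var n f G ε₁ k x (i - l) → ∀ r ∈ Set.Icc 0 r₀,
      |f r ((n : ℝ) ^ k * x) ((i : ℤ) - l - k) - f r x ((i : ℤ) - l)| ≤ 3 * ε₁ := by
    intro k hk r hr
    obtain ⟨g, hgG, hgr⟩ := hG r hr
    have h1 : |f g ((n : ℝ) ^ k * x) ((i : ℤ) - l - k) - f g x ((i : ℤ) - l)| ≤ ε₁ := by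
      by_contra! h
      exact hk ⟨g, hgG, h⟩
    have h2 := hf.modulus hm₁ hgr g ((n : ℝ) ^ k * x) ((i : ℤ) - l - k)
    have h3 := hf.modulus hm₁ hgr g x ((i : ℤ) - l)
    rw [sub_add_cancel, abs_le] at h2 h3
    rw [abs_le] at h1 ⊢
    constructor <;> linarith [h1.1, h1.2, h2.1, h2.2, h3.1, h3.2]
  have key := almost_const_of_shear (φ := φ) (F := fun r => f r x ((i : ℤ) - l))
    (F₁ := fun r => f r ((n : ℝ) ^ k₁ * x) ((i : ℤ) - l - k₁))
    (F₂ := fun r => f r ((n : ℝ) ^ k₂ * x) ((i : ℤ) - l - k₂)) (H := H) (r₀ := r₀) (η₂ := η₂)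
    (ε₁ := ε₁) (ε := ε' / 4) (δmin := δmin) (ηm := ηm) hr₀ hδ0 hε₁0.le
    (hN _ _ _ _ H γ hdet hdvd hrel') (hgrid k₁ hb₁) (hgrid k₂ hb₂) h00 h10 h11 (by rwa [hη₂₁])
    (by rw [hδmin, div_le_iff₀ (by positivity)]; linarith)
    (by
      have hp : (0 : ℝ) < (n : ℝ) ^ q₀ := by positivity
      have : (n : ℝ) ^ q₀ * |H 0 1| ≤ (n : ℝ) ^ q₀ * ηm := by linarith
      exact le_of_mul_le_mul_left this hp)
    (fun r y hy => hf.modulus hm hy _ _ _)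
  have e : r₀ / δmin * (7 * ε₁) = ε' / 4 := by
    rw [hε₁]; field_simp; norm_num
  rw [e] at key
  have : ε' < |f r₀ x ((i : ℤ) - l) - f 0 x ((i : ℤ) - l)| := hx
  linarith

lemma exists_conv_close (hn : 2 ≤ n)
    (hT : MeasurePreserving (fun x : ℝ => Int.fract ((n : ℝ) * x)) μ μ)
    (hsupp : ∀ᵐ s ∂μ, s ∈ Set.Ico (0 : ℝ) 1) {κ : ℝ} (hκ : 0 < κ) (hdim : ExactDimensional μ κ)
    (hthick : ∀ ε > 0, ∃ δ > 0, mS μ (fun s i => ¬ Thick δ s (tm n i)) ≤ ε)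
    {φ : Mat → ℝ} (hφ : IsTest φ) {r₀ ε' β : ℝ} (hr₀ : 0 < r₀) (hε' : 0 < ε') (hβ : 0 < β) :
    ∃ f, Conv n φ f ∧ mS μ (fun s i => ε' < |f r₀ s i - f 0 s i|) ≤ β := by
  have hn0 : (0 : ℝ) < n := by positivity
  have hn1 : (1 : ℝ) < n := by exact_mod_cast hn
  obtain ⟨ηm, hηm, hm⟩ := hφ.cont (ε' / 4) (by positivity)
  obtain ⟨q₀, hq₀⟩ := pow_unbounded_of_one_lt (3 / ηm) hn1
  obtain ⟨M, hM⟩ := exists_mS_Bad2_le hn hT hsupp hκ hdim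
    (show 0 < β / 16 * (β / 1000) by positivity) (show 0 < β / 100 by positivity)
  obtain ⟨δmin, hδmin⟩ : ∃ x, x = 1 / (4 * (n : ℝ) ^ (q₀ + 2 + 2 * M)) := ⟨_, rfl⟩
  have hδ0 : 0 < δmin := by rw [hδmin]; positivity
  obtain ⟨ε₁, hε₁⟩ : ∃ x, x = ε' * δmin / (28 * r₀) := ⟨_, rfl⟩
  have hε₁0 : 0 < ε₁ := by rw [hε₁]; positivity
  obtain ⟨η₁, hη₁, hm₁⟩ := hφ.cont ε₁ hε₁0
  obtain ⟨G, hG⟩ := exists_grid (r₀ := r₀) hη₁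
  obtain ⟨c, hc⟩ : ∃ x, x = ε₁ ^ 2 * (β / 16 * (β / 1000) * (β / 64)) / (G.card + 1) := ⟨_, rfl⟩
  obtain ⟨f, hf, hfk⟩ := exists_almost_invariant (n := n) hT hφ G
    (show 0 < c by rw [hc]; positivity)
  refine ⟨f, hf, ?_⟩
  obtain ⟨K, hK⟩ := hf.rel hn hφ
  obtain ⟨δth, hδth, hth⟩ := hthick (β / 64) (by positivity)
  obtain ⟨η₂, hη₂⟩ : ∃ x, x = η₁ / (1 + r₀) ^ 2 := ⟨_, rfl⟩
  have hη₂0 : 0 < η₂ := by rw [hη₂]; positivity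
  obtain ⟨J₁, hJ₁⟩ := pow_unbounded_of_one_lt (2 / η₂) hn1
  obtain ⟨J₂, hJ₂⟩ := exists_nat_gt (5 * (q₀ + 1) / β)
  obtain ⟨J₀, hJ₀⟩ : ∃ x, x = J₁ + J₂ + q₀ + 1 := ⟨_, rfl⟩
  obtain ⟨η, hη⟩ : ∃ x, x = min (min (1 / 10) (1 / (4 * (n : ℝ) ^ (2 + 2 * M))))
    (min (η₂ / 2) (1 / (2 * (n : ℝ) ^ (2 * (8 * J₀))))) := ⟨_, rfl⟩
  have hη0 : 0 < η := by rw [hη]; positivity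
  have hηa : η ≤ 1 / 10 := by rw [hη]; exact (min_le_left _ _).trans (min_le_left _ _)
  have hηb : η ≤ 1 / (4 * (n : ℝ) ^ (2 + 2 * M)) := by
    rw [hη]; exact (min_le_left _ _).trans (min_le_right _ _)
  have hηc : η ≤ η₂ / 2 := by rw [hη]; exact (min_le_right _ _).trans (min_le_left _ _)
  have hηd : η ≤ 1 / (2 * (n : ℝ) ^ (2 * (8 * J₀))) := by
    rw [hη]; exact (min_le_right _ _).trans (min_le_right _ _)
  haveI : NeZero (n ^ K) := ⟨by positivity⟩
  obtain ⟨B, hB⟩ := thick_pigeonhole (n ^ K) hδth hη0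
  set D : ℝ → ℤ → Prop := fun s i => ε' < |f r₀ s i - f 0 s i|
  have mD : MSet D := (Adm.const ε').mset_lt ((hf.adm hφ r₀).sub (hf.adm hφ 0)).abs
  set NG : ℕ → ℝ → ℤ → Prop := fun k s i => ¬ Thick δth ((n : ℝ) ^ k * s) (tm n (i - k)) ∨
    ¬ Few (Heavy n μ (Var n f G ε₁ k) (β / 16)) (β / 1000) s i with hNG
  have mT : ∀ k : ℕ, MSet fun s i => ¬ Thick δth ((n : ℝ) ^ k * s) (tm n (i - k)) := fun k =>
    (MSet.comp (MSet_thick n δth) (measurable_const_mul ((n : ℝ) ^ k)) k).not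
  have mF : ∀ k : ℕ, MSet fun s i =>
      ¬ Few (Heavy n μ (Var n f G ε₁ k) (β / 16)) (β / 1000) s i := fun k =>
    ((MSet.heavy _).few _).not
  have mNG : ∀ k, MSet (NG k) := fun k => (mT k).or (mF k)
  have hNGle : ∀ k, mS μ (NG k) ≤ β / 32 := by
    intro k
    have h1 := mS_or_le (μ := μ) (mT k) (mF k)
    rw [mS_not_thick_comp hT] at h1
    have h2 := mS_not_few_le (μ := μ) (P := Heavy n μ (Var n f G ε₁ k) (β / 16))
      (MSet.heavy _) (show 0 < β / 1000 by positivity)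
    have h3 := mS_heavy_le (μ := μ) hn (MSet_Var hφ hf G ε₁ k) (show 0 < β / 16 by positivity)
    have h4 := mS_Var_le (μ := μ) hφ hf G hε₁0 (hfk k)
    have h5 : (G.card : ℝ) * (c / ε₁ ^ 2) ≤ β / 16 * (β / 1000) * (β / 64) := by
      have : (G.card : ℝ) * (c / ε₁ ^ 2) =
          (β / 16 * (β / 1000) * (β / 64)) * (G.card / (G.card + 1)) := by
        rw [hc]; field_simp
      rw [this]
      refine mul_le_of_le_one_right (by positivity) ((div_le_one (by positivity)).mpr (by linarith))
    rw [le_div_iff₀ (by positivity)] at h2 h3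
    have h6 : mS μ (fun s i => ¬ Few (Heavy n μ (Var n f G ε₁ k) (β / 16)) (β / 1000) s i) ≤
        β / 64 := by
      have hp : 0 < β / 16 * (β / 1000) := by positivity
      refine le_of_mul_le_mul_left ?_ hp
      calc _ = (mS μ (fun s i => ¬ Few (Heavy n μ (Var n f G ε₁ k) (β / 16)) (β / 1000) s i) *
            (β / 1000)) * (β / 16) := by ring
        _ ≤ mS μ (Heavy n μ (Var n f G ε₁ k) (β / 16)) * (β / 16) := by gcongr
        _ ≤ _ := h3.trans (h4.trans h5)
    linarith
  have mSum : Adm fun s i => ∑ k ∈ range (2 * B + 2), ind (NG k) s i :=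
    Adm.sum fun k _ => (mNG k).adm
  set E : ℝ → ℤ → Prop := fun s i => (B : ℝ) + 1 ≤ ∑ k ∈ range (2 * B + 2), ind (NG k) s i
  have mE : MSet E := (Adm.const ((B : ℝ) + 1)).mset_le mSum
  have hE : mS μ E ≤ β / 16 := by
    refine (markov mSum (fun s i => sum_nonneg fun k _ => ind_nonneg _ _ _)
      (show (0 : ℝ) < B + 1 by positivity) mE fun s i h => h).trans ?_
    rw [mean_sum fun k _ => (mNG k).adm, div_le_iff₀ (by positivity)]
    refine (sum_le_card_nsmul _ _ _ fun k _ => hNGle k).trans ?_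
    simp only [card_range, nsmul_eq_mul]
    push_cast
    linarith
  have hBad : mS μ (fun s i => ¬ Few (Bad2 n μ M (β / 100)) (β / 1000) s i) ≤ β / 16 := by
    refine (mS_not_few_le (MSet_Bad2 _ _) (by positivity)).trans ?_
    rwa [div_le_iff₀ (by positivity)]
  by_contra! hcon
  have h1 := mS_le_dense (μ := μ) hn mD (show 0 < β / 2 by positivity)
  have h2 := mS_le_most (μ := μ) (P := Dense n μ D (β / 2)) (MSet.dense _)
    (show 0 ≤ β / 4 by positivity)
  have h3 := mS_mono (μ := μ) (P := Most (Dense n μ D (β / 2)) (β / 4))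
    (Q := fun s i => ¬ Few (Bad2 n μ M (β / 100)) (β / 1000) s i ∨ E s i)
    ((MSet.dense _).most _) (((MSet_Bad2 _ _).few _).not.or mE) fun s i hi hmost => by
      by_contra! hno
      obtain ⟨hV, hEs⟩ := hno
      lift i to ℕ using hi
      classical
      set S := (range (2 * B + 2)).filter fun k => ¬ NG k s i with hS
      have hcard : B < S.card := by
        have e : ∑ k ∈ range (2 * B + 2), ind (NG k) s i =
            (((range (2 * B + 2)).filter fun k => NG k s i).card : ℝ) := by
          rw [Finset.card_filter]
          push_cast
          exact sum_congr rfl fun k _ => by by_cases h : NG k s i <;> simp [ind, h]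
        have e' : ((range (2 * B + 2)).filter fun k => NG k s i).card + S.card =
            (range (2 * B + 2)).card := by
          rw [hS]
          convert card_filter_add_card_filter_not (s := range (2 * B + 2)) fun k => NG k s i
        have hlt : (((range (2 * B + 2)).filter fun k => NG k s i).card : ℝ) < B + 1 := by
          rw [← e]; exact not_le.mp hEs
        have hlt' : ((range (2 * B + 2)).filter fun k => NG k s i).card < B + 1 := by
          exact_mod_cast hlt
        rw [card_range] at e'
        omega
      have hS₁ : ∀ k ∈ S, Thick δth ((n : ℝ) ^ k * s) (tm n (i - k)) := fun k hk => by
        have := (mem_filter.mp hk).2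
        by_contra h
        exact this (Or.inl h)
      have hS₂ : ∀ k ∈ S, Few (Heavy n μ (Var n f G ε₁ k) (β / 16)) (β / 1000) s i :=
        fun k hk => by
          have := (mem_filter.mp hk).2
          by_contra h
          exact this (Or.inr h)
      refine not_many_good (η₂ := η₂) (J₀ := J₀) hn hφ hf hr₀ hε' hβ hK hm ?_ hδmin hε₁ hm₁ hG ?_ hηa ?_ ?_ ?_ ?_ ?_ ?_
        hB hmost hV hcard hS₁ hS₂
      · rw [div_lt_iff₀ hηm] at hq₀; linarith
      · rw [hη₂]; field_simp
      · rwa [le_div_iff₀ (by positivity)] at hηb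
      · linarith
      · rw [le_div_iff₀ (by positivity)] at hηd; linarith
      · rw [div_lt_iff₀ hβ] at hJ₂
        have : (J₂ : ℝ) ≤ J₀ := by exact_mod_cast (by omega : J₂ ≤ J₀)
        nlinarith
      · rw [div_lt_iff₀ hη₂0] at hJ₁
        have : (n : ℝ) ^ J₁ ≤ (n : ℝ) ^ J₀ := pow_le_pow_right₀ hn1.le (by omega)
        nlinarith
      · omega
  have h4 := mS_or_le (μ := μ) ((MSet_Bad2 (n := n) (μ := μ) M (β / 100)).few (β / 1000)).not mE
  linarith

/-- Limiting averages along the orbit are invariant under the horocycle flow. -/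
theorem mean_ev_uni (hn : 2 ≤ n)
    (hT : MeasurePreserving (fun x : ℝ => Int.fract ((n : ℝ) * x)) μ μ)
    (hsupp : ∀ᵐ s ∂μ, s ∈ Set.Ico (0 : ℝ) 1) {κ : ℝ} (hκ : 0 < κ) (hdim : ExactDimensional μ κ)
    (hthick : ∀ ε > 0, ∃ δ > 0, mS μ (fun s i => ¬ Thick δ s (tm n i)) ≤ ε)
    {φ : Mat → ℝ} (hφ : IsTest φ) {r₀ : ℝ} (hr₀ : 0 < r₀) :
    mean μ (ev n φ r₀) = mean μ (ev n φ 0) := by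
  obtain ⟨C, hC⟩ := hφ.bdd
  have hC0 : 0 ≤ C := (abs_nonneg _).trans (hC 0)
  have key : ∀ ε > 0, |mean μ (ev n φ r₀) - mean μ (ev n φ 0)| ≤ ε := by
    intro ε hε
    obtain ⟨f, hf, hD⟩ := exists_conv_close hn hT hsupp hκ hdim hthick hφ hr₀
      (half_pos hε) (show 0 < ε / (4 * (C + 1)) by positivity)
    rw [← hf.mean_eq hT hφ, ← hf.mean_eq hT hφ, ← mean_sub (hf.adm hφ _) (hf.adm hφ _)]
    have mD : MSet fun s i => ε / 2 < |f r₀ s i - f 0 s i| :=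
      (Adm.const _).mset_lt ((hf.adm hφ r₀).sub (hf.adm hφ 0)).abs
    refine (abs_mean_le ((hf.adm hφ r₀).sub (hf.adm hφ 0))).trans ?_
    have h1 : mean μ (fun s i => |f r₀ s i - f 0 s i|) ≤
        mean μ (fun s i => ε / 2 + 2 * C * ind (fun s i => ε / 2 < |f r₀ s i - f 0 s i|) s i) := by
      refine mean_mono ((hf.adm hφ r₀).sub (hf.adm hφ 0)).abs
        ((Adm.const _).add (mD.adm.const_mul _)) fun s i => ?_
      by_cases h : ε / 2 < |f r₀ s i - f 0 s i|
      · rw [ind_of h]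
        have a := hf.bdd hC r₀ s i
        have b := hf.bdd hC 0 s i
        have := abs_sub (f r₀ s i) (f 0 s i)
        linarith
      · rw [ind_of_not h]; linarith
    rw [mean_add (Adm.const _) (mD.adm.const_mul _), mean_const, mean_const_mul _ mD.adm] at h1
    refine h1.trans ?_
    have h2 : 2 * C * mS μ (fun s i => ε / 2 < |f r₀ s i - f 0 s i|) ≤
        2 * C * (ε / (4 * (C + 1))) := by gcongr
    have h3 : 2 * C * (ε / (4 * (C + 1))) ≤ ε / 2 := by
      rw [mul_div_assoc', div_le_div_iff₀ (by positivity) (by positivity)]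
      nlinarith
    unfold mS at h2
    linarith
  have := le_of_forall_pos_le_add fun ε hε => (key ε hε).trans_eq (zero_add ε).symm
  exact sub_eq_zero.mp (abs_nonpos_iff.mp this)

end
end CFP

namespace CFP
open Finset Topology

lemma IsTest.const (c : ℝ) : IsTest fun _ => c :=
  ⟨⟨|c|, fun _ => le_rfl⟩, fun _ _ _ => rfl, fun ε hε => ⟨1, one_pos, fun _ _ _ => by
    simpa using hε.le⟩⟩

lemma IsTest.add {φ ψ : Mat → ℝ} (hφ : IsTest φ) (hψ : IsTest ψ) : IsTest fun A => φ A + ψ A := by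
  obtain ⟨C, hC⟩ := hφ.bdd
  obtain ⟨D, hD⟩ := hψ.bdd
  refine ⟨⟨C + D, fun A => (abs_add_le _ _).trans (add_le_add (hC A) (hD A))⟩, fun A γ h => by
    rw [hφ.inv A γ h, hψ.inv A γ h], fun ε hε => ?_⟩
  obtain ⟨η, hη, h⟩ := hφ.cont (ε / 2) (half_pos hε)
  obtain ⟨η', hη', h'⟩ := hψ.cont (ε / 2) (half_pos hε)
  refine ⟨min η η', lt_min hη hη', fun g hg A => ?_⟩
  have a := h g (fun i j => (hg i j).trans (min_le_left _ _)) A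
  have b := h' g (fun i j => (hg i j).trans (min_le_right _ _)) A
  rw [abs_le] at *
  constructor <;> linarith [a.1, a.2, b.1, b.2]

lemma IsTest.mul {φ ψ : Mat → ℝ} (hφ : IsTest φ) (hψ : IsTest ψ) : IsTest fun A => φ A * ψ A := by
  obtain ⟨C, hC⟩ := hφ.bdd
  obtain ⟨D, hD⟩ := hψ.bdd
  have hC0 : 0 ≤ C := (abs_nonneg _).trans (hC 0)
  have hD0 : 0 ≤ D := (abs_nonneg _).trans (hD 0)
  refine ⟨⟨C * D, fun A => ?_⟩, fun A γ h => by
    rw [hφ.inv A γ h, hψ.inv A γ h], fun ε hε => ?_⟩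
  · rw [abs_mul]; exact mul_le_mul (hC A) (hD A) (abs_nonneg _) hC0
  obtain ⟨η, hη, h⟩ := hφ.cont (ε / (2 * (D + 1))) (by positivity)
  obtain ⟨η', hη', h'⟩ := hψ.cont (ε / (2 * (C + 1))) (by positivity)
  refine ⟨min η η', lt_min hη hη', fun g hg A => ?_⟩
  have a := h g (fun i j => (hg i j).trans (min_le_left _ _)) A
  have b := h' g (fun i j => (hg i j).trans (min_le_right _ _)) A
  have e : φ (g * A) * ψ (g * A) - φ A * ψ A =
      (φ (g * A) - φ A) * ψ (g * A) + φ A * (ψ (g * A) - ψ A) := by ring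
  rw [e]
  refine (abs_add_le _ _).trans ?_
  rw [abs_mul, abs_mul]
  have h1 : |φ (g * A) - φ A| * |ψ (g * A)| ≤ ε / (2 * (D + 1)) * D :=
    mul_le_mul a (hD _) (abs_nonneg _) (by positivity)
  have h2 : |φ A| * |ψ (g * A) - ψ A| ≤ C * (ε / (2 * (C + 1))) :=
    mul_le_mul (hC _) b (abs_nonneg _) hC0
  have h3 : ε / (2 * (D + 1)) * D ≤ ε / 2 := by
    rw [div_mul_eq_mul_div, div_le_div_iff₀ (by positivity) (by positivity)]; nlinarith
  have h4 : C * (ε / (2 * (C + 1))) ≤ ε / 2 := by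
    rw [mul_div_assoc', div_le_div_iff₀ (by positivity) (by positivity)]; nlinarith
  linarith

lemma IsTest.const_mul {φ : Mat → ℝ} (c : ℝ) (hφ : IsTest φ) : IsTest fun A => c * φ A :=
  (IsTest.const c).mul hφ

lemma IsTest.sub {φ ψ : Mat → ℝ} (hφ : IsTest φ) (hψ : IsTest ψ) : IsTest fun A => φ A - ψ A := by
  simpa [sub_eq_add_neg] using hφ.add (hψ.const_mul (-1))

lemma IsTest.sq {φ : Mat → ℝ} (hφ : IsTest φ) : IsTest fun A => φ A ^ 2 := by
  simpa [pow_two] using hφ.mul hφ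

/-- Left translates of test functions are test functions. -/
lemma IsTest.translate {φ : Mat → ℝ} (hφ : IsTest φ) {g g' : Mat} (hg : g' * g = 1) :
    IsTest fun A => φ (g * A) := by
  refine ⟨⟨_, fun A => hφ.bdd.choose_spec _⟩, fun A γ h => by
    rw [← Matrix.mul_assoc, hφ.inv _ γ h], fun ε hε => ?_⟩
  obtain ⟨η, hη, h⟩ := hφ.cont ε hε
  set C : ℝ := 1 + ∑ i, ∑ j, (|g i j| + |g' i j|) with hC
  have hC0 : 0 < C := by positivity
  have hle : ∀ i j, |g i j| + |g' i j| ≤ C := fun i j => by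
    have h1 : ∑ j, (|g i j| + |g' i j|) ≤ ∑ i, ∑ j, (|g i j| + |g' i j|) :=
      single_le_sum (f := fun i => ∑ j, (|g i j| + |g' i j|)) (fun _ _ => by positivity)
        (mem_univ i)
    have h2 : |g i j| + |g' i j| ≤ ∑ j, (|g i j| + |g' i j|) :=
      single_le_sum (f := fun j => |g i j| + |g' i j|) (fun _ _ => by positivity) (mem_univ j)
    linarith
  refine ⟨η / (4 * C ^ 2), by positivity, fun x hx A => ?_⟩
  have e : g * (x * A) = (g * x * g') * (g * A) := by
    rw [Matrix.mul_assoc _ g', ← Matrix.mul_assoc g', hg, Matrix.one_mul, Matrix.mul_assoc]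
  rw [e]
  refine h _ (fun i j => ?_) _
  have hgg : g * g' = 1 := mul_eq_one_comm.mp hg
  have e2 : (g * x * g') i j - (1 : Mat) i j = ∑ k, ∑ l, g i l * (x l k - (1 : Mat) l k) * g' k j := by
    have : (g * x * g') i j - (1 : Mat) i j = (g * (x - 1) * g') i j := by
      rw [Matrix.mul_sub, Matrix.sub_mul, Matrix.mul_one, hgg, Matrix.sub_apply]
    rw [this, Matrix.mul_apply]
    refine sum_congr rfl fun k _ => ?_
    rw [Matrix.mul_apply, sum_mul]
    rfl
  rw [e2]
  have hb : ∀ k l, |g i l * (x l k - (1 : Mat) l k) * g' k j| ≤ η / 4 := fun k l => by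
    rw [abs_mul, abs_mul]
    have h1 : |g i l| ≤ C := by linarith [hle i l, abs_nonneg (g' i l)]
    have h2 : |g' k j| ≤ C := by linarith [hle k j, abs_nonneg (g k j)]
    calc _ ≤ C * (η / (4 * C ^ 2)) * C := by
          gcongr
          exact hx l k
      _ = η / 4 := by field_simp
  calc _ ≤ ∑ k : Fin 2, ∑ l : Fin 2, |g i l * (x l k - (1 : Mat) l k) * g' k j| :=
        (abs_sum_le_sum_abs _ _).trans (sum_le_sum fun k _ => abs_sum_le_sum_abs _ _)
    _ ≤ ∑ k : Fin 2, ∑ l : Fin 2, η / 4 := sum_le_sum fun k _ => sum_le_sum fun l _ => hb k l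
    _ = η := by simp [Fin.sum_univ_two]; ring

lemma diag_mul_X (τ s t : ℝ) : X 0 τ * X s t = X s (τ + t) := by
  ext i j
  fin_cases i <;> fin_cases j <;> simp [X, Matrix.mul_apply, Real.exp_add] <;> ring

lemma X_zero_zero : X 0 0 = 1 := by
  ext i j
  fin_cases i <;> fin_cases j <;> simp [X]

lemma diag_mul_uni (τ r : ℝ) : X 0 τ * uni r = uni (r * Real.exp (2 * τ)) * X 0 τ := by
  have h : Real.exp τ = Real.exp (2 * τ) * Real.exp (-τ) := by
    rw [← Real.exp_add]; ring_nf
  ext i j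
  fin_cases i <;> fin_cases j <;> simp [X, uni, Matrix.mul_apply]
  rw [h]; ring

lemma IsTest.diag {φ : Mat → ℝ} (hφ : IsTest φ) (τ : ℝ) : IsTest fun A => φ (X 0 τ * A) :=
  hφ.translate (g' := X 0 (-τ)) (by rw [diag_mul_X, neg_add_cancel, X_zero_zero])

lemma IsTest.uni {φ : Mat → ℝ} (hφ : IsTest φ) (r : ℝ) : IsTest fun A => φ (uni r * A) :=
  hφ.translate (g' := CFP.uni (-r)) (by rw [uni_add, neg_add_cancel, uni_zero])

/-- Weighted limiting average of `φ` along the orbit. -/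
noncomputable def wmean (n : ℕ) (μ : Measure ℝ) (w : ℝ → ℝ) (φ : Mat → ℝ) : ℝ :=
  mean μ fun s i => w s * φ (X s (tm n i))

section
variable {n : ℕ} {μ : Measure ℝ} [IsProbabilityMeasure μ] {w : ℝ → ℝ} {φ ψ : Mat → ℝ}

lemma ev_zero : ev n φ 0 = fun s i => φ (X s (tm n i)) := by
  ext s i
  simp [ev, uni_zero]

lemma adm_orbit (hw : Measurable w) (hw1 : ∀ s, |w s| ≤ 1) (hφ : IsTest φ) :
    Adm fun s i => w s * φ (X s (tm n i)) := by
  have h := adm_ev (n := n) hφ 0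
  rw [ev_zero] at h
  exact Adm.mul (F := fun s _ => w s) ⟨⟨1, fun s _ => hw1 s⟩, fun _ => hw⟩ h

lemma wmean_add (hw : Measurable w) (hw1 : ∀ s, |w s| ≤ 1) (hφ : IsTest φ) (hψ : IsTest ψ) :
    wmean n μ w (fun A => φ A + ψ A) = wmean n μ w φ + wmean n μ w ψ := by
  unfold wmean
  rw [← mean_add (adm_orbit hw hw1 hφ) (adm_orbit hw hw1 hψ)]
  simp only [mul_add]

lemma wmean_const_mul (hw : Measurable w) (hw1 : ∀ s, |w s| ≤ 1) (c : ℝ) (hφ : IsTest φ) :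
    wmean n μ w (fun A => c * φ A) = c * wmean n μ w φ := by
  unfold wmean
  rw [← mean_const_mul c (adm_orbit hw hw1 hφ)]
  simp only [mul_left_comm]

lemma wmean_sub (hw : Measurable w) (hw1 : ∀ s, |w s| ≤ 1) (hφ : IsTest φ) (hψ : IsTest ψ) :
    wmean n μ w (fun A => φ A - ψ A) = wmean n μ w φ - wmean n μ w ψ := by
  unfold wmean
  rw [← mean_sub (adm_orbit hw hw1 hφ) (adm_orbit hw hw1 hψ)]
  simp only [mul_sub]

lemma wmean_diag (hw : Measurable w) (hw1 : ∀ s, |w s| ≤ 1) (hφ : IsTest φ) (l : ℕ) :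
    wmean n μ w (fun A => φ (X 0 (-tm n l) * A)) = wmean n μ w φ := by
  unfold wmean
  rw [← mean_shift (adm_orbit hw hw1 hφ) l]
  simp only [diag_mul_X, tm_sub, neg_add_eq_sub]

lemma wmean_one_mono (hφ : IsTest φ) (hψ : IsTest ψ) (h : ∀ A, φ A ≤ ψ A) :
    wmean n μ 1 φ ≤ wmean n μ 1 ψ :=
  mean_mono (adm_orbit measurable_const (by simp) hφ) (adm_orbit measurable_const (by simp) hψ)
    fun s i => by simpa using h _

lemma abs_wmean_one_mul_le (hφ : IsTest φ) (hψ : IsTest ψ) {ε C : ℝ} (hε : 0 < ε)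
    (hC : ∀ A, |ψ A| ≤ C) :
    |wmean n μ 1 (fun A => φ A * ψ A)| ≤ (wmean n μ 1 (fun A => φ A ^ 2) / ε + ε * C ^ 2) / 2 := by
  have h1 : Measurable (1 : ℝ → ℝ) := measurable_const
  have h2 : ∀ s : ℝ, |(1 : ℝ → ℝ) s| ≤ 1 := by simp
  have key : ∀ σ : ℝ, |σ| = 1 → σ * wmean n μ 1 (fun A => φ A * ψ A) ≤
      (wmean n μ 1 (fun A => φ A ^ 2) / ε + ε * C ^ 2) / 2 := by
    intro σ hσ
    have e : (wmean n μ 1 (fun A => φ A ^ 2) / ε + ε * C ^ 2) / 2 =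
        wmean n μ 1 (fun A => (1 / (2 * ε)) * φ A ^ 2 + ε * C ^ 2 / 2) := by
      rw [wmean_add h1 h2 (hφ.sq.const_mul _) (IsTest.const _), wmean_const_mul h1 h2 _ hφ.sq]
      have : wmean n μ 1 (fun _ => ε * C ^ 2 / 2) = ε * C ^ 2 / 2 := by
        unfold wmean; simp [mean_const]
      rw [this]; ring
    rw [e, ← wmean_const_mul h1 h2 _ (hφ.mul hψ)]
    refine wmean_one_mono ((hφ.mul hψ).const_mul _) ((hφ.sq.const_mul _).add (IsTest.const _))
      fun A => ?_
    have a : (ψ A) ^ 2 ≤ C ^ 2 := by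
      rw [← sq_abs]; exact pow_le_pow_left₀ (abs_nonneg _) (hC A) 2
    have hσ2 : σ ^ 2 = 1 := by rw [← sq_abs, hσ, one_pow]
    have b : 0 ≤ (φ A - σ * ε * ψ A) ^ 2 := sq_nonneg _
    have c : 1 / (2 * ε) * φ A ^ 2 + ε * C ^ 2 / 2 - σ * (φ A * ψ A) =
        (1 / (2 * ε)) * ((φ A - σ * ε * ψ A) ^ 2 + ε ^ 2 * (C ^ 2 - σ ^ 2 * ψ A ^ 2)) := by
      field_simp; ring
    have d : 0 ≤ (1 / (2 * ε)) * ((φ A - σ * ε * ψ A) ^ 2 + ε ^ 2 * (C ^ 2 - σ ^ 2 * ψ A ^ 2)) := by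
      rw [hσ2, one_mul]
      have : 0 ≤ C ^ 2 - ψ A ^ 2 := by linarith
      positivity
    linarith
  rw [abs_le]
  constructor
  · have := key (-1) (by simp)
    linarith
  · have := key 1 (by simp)
    linarith

/-- An approximate density of a weight, almost invariant under the diagonal flow. -/
lemma exists_approx_density (hw : Measurable w) (hw1 : ∀ s, |w s| ≤ 1) {ε : ℝ} (hε : 0 < ε) :
    ∃ ψ, IsTest ψ ∧ (∀ χ, IsTest χ → ∀ C, (∀ A, |χ A| ≤ C) →
      |wmean n μ 1 (fun A => ψ A * χ A) - wmean n μ w χ| ≤ ε * (1 + C ^ 2)) ∧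
      ∀ l : ℕ, wmean n μ 1 (fun A => (ψ (X 0 (-tm n l) * A) - ψ A) ^ 2) ≤ 4 * ε ^ 2 := by
  have h1 : Measurable (1 : ℝ → ℝ) := measurable_const
  have h2 : ∀ s : ℝ, |(1 : ℝ → ℝ) s| ≤ 1 := by simp
  set Q : (Mat → ℝ) → ℝ := fun ψ => wmean n μ 1 (fun A => ψ A ^ 2) - 2 * wmean n μ w ψ with hQ
  have hQ1 : ∀ ψ, IsTest ψ → -1 ≤ Q ψ := by
    intro ψ hψ
    have e : Q ψ = mean μ fun s i => (1 : ℝ → ℝ) s * ψ (X s (tm n i)) ^ 2 -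
        2 * (w s * ψ (X s (tm n i))) := by
      rw [mean_sub (adm_orbit h1 h2 hψ.sq) ((adm_orbit hw hw1 hψ).const_mul 2),
        mean_const_mul _ (adm_orbit hw hw1 hψ)]
      rfl
    rw [e, ← mean_const (μ := μ) (-1)]
    refine mean_mono (Adm.const _) ((adm_orbit h1 h2 hψ.sq).sub
      ((adm_orbit hw hw1 hψ).const_mul 2)) fun s i => ?_
    have : w s ^ 2 ≤ 1 := by
      rw [← sq_abs]; exact pow_le_one₀ (abs_nonneg _) (hw1 s)
    simp only [Pi.one_apply]
    nlinarith [sq_nonneg (ψ (X s (tm n i)) - w s)]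
  have hbdd : BddBelow (Q '' {ψ | IsTest ψ}) := ⟨-1, by rintro _ ⟨ψ, hψ, rfl⟩; exact hQ1 ψ hψ⟩
  have hne : (Q '' {ψ | IsTest ψ}).Nonempty := ⟨_, _, IsTest.const 0, rfl⟩
  obtain ⟨_, ⟨ψ, hψ, rfl⟩, hlt⟩ := exists_lt_of_csInf_lt hne
    (lt_add_of_pos_right (sInf (Q '' {ψ | IsTest ψ})) (show 0 < ε ^ 2 by positivity))
  have hmin : ∀ χ, IsTest χ → Q ψ ≤ Q χ + ε ^ 2 := fun χ hχ => by
    linarith [csInf_le hbdd ⟨χ, hχ, rfl⟩]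
  refine ⟨ψ, hψ, fun χ hχ C hC => ?_, fun l => ?_⟩
  · have hexp : ∀ c : ℝ, Q (fun A => ψ A + c * χ A) = Q ψ + 2 * c *
        (wmean n μ 1 (fun A => ψ A * χ A) - wmean n μ w χ) +
        c ^ 2 * wmean n μ 1 (fun A => χ A ^ 2) := by
      intro c
      simp only [hQ]
      have e : (fun A => (ψ A + c * χ A) ^ 2) =
          fun A => (ψ A ^ 2 + (2 * c) * (ψ A * χ A)) + c ^ 2 * χ A ^ 2 := by
        ext A; ring
      rw [e, wmean_add h1 h2 (hψ.sq.add ((hψ.mul hχ).const_mul _)) (hχ.sq.const_mul _),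
        wmean_add h1 h2 hψ.sq ((hψ.mul hχ).const_mul _), wmean_const_mul h1 h2 _ (hψ.mul hχ),
        wmean_const_mul h1 h2 _ hχ.sq, wmean_add hw hw1 hψ (hχ.const_mul _),
        wmean_const_mul hw hw1 _ hχ]
      ring
    have hχ2 : wmean n μ 1 (fun A => χ A ^ 2) ≤ C ^ 2 := by
      have := wmean_one_mono (n := n) (μ := μ) hχ.sq (IsTest.const (C ^ 2)) fun A => by
        rw [← sq_abs]; exact pow_le_pow_left₀ (abs_nonneg _) (hC A) 2
      refine this.trans_eq ?_
      unfold wmean; simp [mean_const]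
    have a := (hmin _ (hψ.add (hχ.const_mul ε))).trans_eq (congrArg (· + ε ^ 2) (hexp ε))
    have b := (hmin _ (hψ.add (hχ.const_mul (-ε)))).trans_eq (congrArg (· + ε ^ 2) (hexp (-ε)))
    have c : ε ^ 2 * wmean n μ 1 (fun A => χ A ^ 2) ≤ ε ^ 2 * C ^ 2 := by gcongr
    have d : 0 ≤ ε * (1 + C ^ 2) := by positivity
    rw [abs_le]
    constructor <;> refine le_of_mul_le_mul_left ?_ hε <;> nlinarith
  · set ψ' : Mat → ℝ := fun A => ψ (X 0 (-tm n l) * A) with hψ'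
    have hT' : IsTest ψ' := hψ.diag _
    have hQ' : Q ψ' = Q ψ := by
      simp only [hQ]
      rw [wmean_diag hw hw1 hψ l]
      rw [wmean_diag (φ := fun A => ψ A ^ 2) h1 h2 hψ.sq l]
    have hm := hmin _ ((hT'.add hψ).const_mul (1 / 2))
    have e : Q (fun A => 1 / 2 * (ψ' A + ψ A)) = (Q ψ' + Q ψ) / 2 -
        1 / 4 * wmean n μ 1 (fun A => (ψ' A - ψ A) ^ 2) := by
      simp only [hQ]
      have e1 : (fun A => (1 / 2 * (ψ' A + ψ A)) ^ 2) = fun A =>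
          1 / 2 * (ψ' A ^ 2 + ψ A ^ 2) - 1 / 4 * (ψ' A - ψ A) ^ 2 := by
        ext A; ring
      rw [e1, wmean_sub h1 h2 ((hT'.sq.add hψ.sq).const_mul _) ((hT'.sub hψ).sq.const_mul _),
        wmean_const_mul h1 h2 _ (hT'.sq.add hψ.sq), wmean_const_mul h1 h2 _ (hT'.sub hψ).sq,
        wmean_add h1 h2 hT'.sq hψ.sq, wmean_const_mul hw hw1 _ (hT'.add hψ),
        wmean_add hw hw1 hT' hψ]
      ring
    rw [e, hQ'] at hm
    linarith

/-- If unweighted averages are invariant under a unipotent shear, so are weighted ones. -/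
theorem wmean_uni (hn : 2 ≤ n) (hw : Measurable w) (hw1 : ∀ s, |w s| ≤ 1) {r : ℝ}
    (hU : ∀ φ, IsTest φ → wmean n μ 1 (fun A => φ (uni r * A)) = wmean n μ 1 φ) (hφ : IsTest φ) :
    wmean n μ w (fun A => φ (uni r * A)) = wmean n μ w φ := by
  have h1 : Measurable (1 : ℝ → ℝ) := measurable_const
  have h2 : ∀ s : ℝ, |(1 : ℝ → ℝ) s| ≤ 1 := by simp
  have hn1 : (1 : ℝ) < n := by exact_mod_cast hn
  obtain ⟨C, hC⟩ := hφ.bdd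
  have key : ∀ ε > 0, |wmean n μ w (fun A => φ (uni r * A)) - wmean n μ w φ| ≤
      ε * (2 * (1 + C ^ 2) + (27 + C ^ 2) / 2) := by
    intro ε hε
    obtain ⟨ψ, hψ, hd, hinv⟩ := exists_approx_density (n := n) (μ := μ) hw hw1 hε
    obtain ⟨η, hη, hmod⟩ := hψ.cont ε hε
    obtain ⟨l, hl⟩ := pow_unbounded_of_one_lt (|r| / η) hn1
    have hl' : |r * Real.exp (2 * (-tm n l))| ≤ η := by
      have : Real.exp (2 * (-tm n l)) = ((n : ℝ) ^ l)⁻¹ := by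
        rw [mul_neg, Real.exp_neg, exp_tm hn, zpow_natCast]
      rw [this, abs_mul, abs_of_pos (a := ((n : ℝ) ^ l)⁻¹) (by positivity), ← div_eq_mul_inv,
        div_le_iff₀ (by positivity)]
      rw [div_lt_iff₀ hη] at hl
      linarith
    set P : Mat → ℝ := fun A => (ψ (X 0 (-tm n l) * A) - ψ A) ^ 2 with hP
    have hPt : IsTest P := ((hψ.diag _).sub hψ).sq
    have hψu := hψ.uni r
    have hφu := hφ.uni r
    have hvar : wmean n μ 1 (fun A => (ψ A - ψ (uni r * A)) ^ 2) ≤ 27 * ε ^ 2 := by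
      have e : wmean n μ 1 (fun A => 3 * ((P A + P (uni r * A)) + ε ^ 2)) ≤ 27 * ε ^ 2 := by
        rw [wmean_const_mul h1 h2 _ ((hPt.add (hPt.uni r)).add (IsTest.const _)),
          wmean_add h1 h2 (hPt.add (hPt.uni r)) (IsTest.const _),
          wmean_add h1 h2 hPt (hPt.uni r), hU P hPt]
        have : wmean n μ 1 (fun _ => ε ^ 2) = ε ^ 2 := by
          unfold wmean; simp [mean_const]
        rw [this]
        have := hinv l
        linarith
      refine le_trans (wmean_one_mono (hψ.sub hψu).sq
        (((hPt.add (hPt.uni r)).add (IsTest.const _)).const_mul 3) fun A => ?_) e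
      have hm := hmod _ (near_uni hl') (X 0 (-tm n l) * A)
      rw [← Matrix.mul_assoc, ← diag_mul_uni, Matrix.mul_assoc] at hm
      have hm2 := sq_le_sq' (abs_le.mp hm).1 (abs_le.mp hm).2
      simp only [hP]
      set a := ψ (X 0 (-tm n l) * A)
      set b := ψ (X 0 (-tm n l) * (uni r * A))
      set c := ψ (uni r * A)
      nlinarith [sq_nonneg ((a - ψ A) - (b - a)), sq_nonneg ((a - ψ A) - (c - b)),
        sq_nonneg ((b - a) - (c - b)), sq_nonneg ((a - ψ A) + (b - a)),
        sq_nonneg ((a - ψ A) - (b - c)), sq_nonneg ((b - a) - (b - c)),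
        sq_nonneg ((a - ψ A) + (b - c)), sq_nonneg ((b - a) + (b - c))]
    have a1 := hd _ hφu C fun A => hC _
    have a2 := hd _ hφ C hC
    have a3 := abs_wmean_one_mul_le (n := n) (μ := μ) (hψ.sub hψu) hφu hε fun A => hC _
    have e3 : wmean n μ 1 (fun A => (ψ A - ψ (uni r * A)) * φ (uni r * A)) =
        wmean n μ 1 (fun A => ψ A * φ (uni r * A)) - wmean n μ 1 (fun A => ψ A * φ A) := by
      rw [← hU _ (hψ.mul hφ), ← wmean_sub h1 h2 (hψ.mul hφu) (hψu.mul hφu)]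
      simp only [sub_mul]
    have a4 : wmean n μ 1 (fun A => (ψ A - ψ (uni r * A)) ^ 2) / ε ≤ 27 * ε := by
      rw [div_le_iff₀ hε]; linarith
    rw [e3] at a3
    rw [abs_le] at *
    constructor <;> linarith [a1.1, a1.2, a2.1, a2.2, a3.1, a3.2]
  have hpos : 0 < 2 * (1 + C ^ 2) + (27 + C ^ 2) / 2 := by positivity
  have := le_of_forall_pos_le_add fun ε hε => ((key (ε / (2 * (1 + C ^ 2) + (27 + C ^ 2) / 2))
    (by positivity)).trans_eq (div_mul_cancel₀ ε hpos.ne')).trans_eq (zero_add ε).symm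
  exact sub_eq_zero.mp (abs_nonpos_iff.mp this)

end
end CFP

namespace CFP
open Finset Topology

/-- A finite pattern holds at the beginning of the expansion on some open interval. -/
lemma exists_pattern_interval (k : ℕ) (b : Fin k → ℕ) (hb : ∀ i, 0 < b i) :
    ∃ c d : ℝ, 0 ≤ c ∧ c < d ∧ d ≤ 1 ∧ ∀ y ∈ Set.Ioo c d, ∀ i : Fin k,
      ⌊(gaussMap^[i] y)⁻¹⌋ = (b i : ℤ) := by
  induction k with
  | zero => exact ⟨0, 1, le_rfl, one_pos, le_rfl, fun y _ i => i.elim0⟩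
  | succ k ih =>
    obtain ⟨c, d, hc, hcd, hd, h⟩ := ih (fun i => b i.succ) fun i => hb _
    have hb0 : (1 : ℝ) ≤ b 0 := by exact_mod_cast hb 0
    have hd0 : 0 < (b 0 : ℝ) + d := by linarith
    have hc0 : 0 < (b 0 : ℝ) + c := by linarith
    refine ⟨(b 0 + d)⁻¹, (b 0 + c)⁻¹, (inv_pos.mpr hd0).le, by gcongr,
      inv_le_one_of_one_le₀ (by linarith), fun y hy i => ?_⟩
    have hy0 : 0 < y := (inv_pos.mpr hd0).trans hy.1
    have h1 : y⁻¹ < b 0 + d := by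
      rw [inv_lt_comm₀ hy0 hd0]; exact hy.1
    have h2 : b 0 + c < y⁻¹ := by
      rw [lt_inv_comm₀ hc0 hy0]; exact hy.2
    have hfl : ⌊y⁻¹⌋ = (b 0 : ℤ) := by
      rw [Int.floor_eq_iff]
      push_cast
      constructor <;> linarith
    refine Fin.cases (by simpa using hfl) (fun j => ?_) i
    have hG : gaussMap y ∈ Set.Ioo c d := by
      have : gaussMap y = y⁻¹ - b 0 := by
        rw [gaussMap, Int.fract, hfl]; push_cast; rfl
      rw [this]
      constructor <;> linarith
    simpa [Function.iterate_succ_apply] using h _ hG j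

lemma gaussMap_step {θ : ℝ} (hθ : 1 < θ) (c : ℤ) : gaussMap (Int.fract (c + 1 / θ)) = Int.fract θ := by
  have h0 : 0 < θ := by linarith
  have : Int.fract ((c : ℝ) + 1 / θ) = 1 / θ := by
    rw [Int.fract_intCast_add, Int.fract_eq_self]
    exact ⟨by positivity, by rw [div_lt_one h0]; exact hθ⟩
  rw [this, gaussMap, one_div, inv_inv]

lemma mobius_step {s θ : ℝ} {k k' m m' : ℤ} (hθ : 1 < θ)
    (h : s * (k * θ + k') = m * θ + m') (c : ℤ) :
    s * (k' * (c + 1 / θ) + ((k - c * k' : ℤ) : ℝ)) = m' * (c + 1 / θ) + ((m - c * m' : ℤ) : ℝ) := by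
  have h0 : θ ≠ 0 := by linarith
  push_cast
  have : s * ((k * θ + k') / θ) = (m * θ + m') / θ := by rw [← h]; ring
  field_simp at this ⊢
  linarith

/-- The orbit of a unimodular fractional linear image of `θ` reaches `θ`. -/
lemma exists_iterate_gaussMap (N : ℕ) : ∀ {k k' m m' : ℤ} {s θ : ℝ}, k' = N → 0 < k' → k' < k →
    (m * k' - m' * k = 1 ∨ m * k' - m' * k = -1) → 1 < θ →
    s * (k * θ + k') = m * θ + m' → ∃ j : ℕ, gaussMap^[j] (Int.fract s) = Int.fract θ := by
  have base : ∀ {s θ : ℝ} {m m' : ℤ}, 1 < θ → m' = 1 → s * θ = m * θ + m' →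
      gaussMap^[1] (Int.fract s) = Int.fract θ := by
    rintro s θ m _ hθ rfl h
    have h0 : θ ≠ 0 := by linarith
    have : s = m + 1 / θ := by field_simp; push_cast at h; linarith
    rw [this]
    exact gaussMap_step hθ m
  have peel : ∀ {s θ : ℝ} {j : ℕ} (c : ℤ), 1 < θ →
      gaussMap^[j] (Int.fract s) = Int.fract (c + 1 / θ) →
      gaussMap^[j + 1] (Int.fract s) = Int.fract θ := by
    intro s θ j c hθ h
    rw [Function.iterate_succ_apply', h, gaussMap_step hθ]
  have big : ∀ {θ : ℝ} {c : ℤ}, 1 < θ → 1 ≤ c → 1 < (c : ℝ) + 1 / θ := by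
    intro θ c hθ hc
    have : (1 : ℝ) ≤ c := by exact_mod_cast hc
    have : 0 < 1 / θ := by positivity
    linarith
  induction N using Nat.strong_induction_on with
  | _ N ih =>
  intro k k' m m' s θ hN hk' hk hdet hθ h
  rcases eq_or_lt_of_le (show 1 ≤ k' from hk') with h1 | h1
  · subst h1
    rcases hdet with hd | hd
    · have h2 := mobius_step hθ h k
      have h3 := base (m := m') (m' := m - k * m') (big hθ (by omega : 1 ≤ k)) (by linarith)
        (by simpa using h2)
      exact ⟨_, peel k hθ h3⟩
    · have h2 := mobius_step hθ h (k - 1)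
      have hb := big hθ (by omega : 1 ≤ k - 1)
      have h3 := mobius_step (k := 1) (k' := 1) (m := m') (m' := m - (k - 1) * m') hb
        (by have e : k - (k - 1) * 1 = 1 := by ring
            rw [e] at h2; exact h2) 1
      have h4 := base (m := m - (k - 1) * m') (m' := m' - 1 * (m - (k - 1) * m'))
        (big hb le_rfl) (by linarith) (by simpa using h3)
      exact ⟨_, peel _ hθ (peel _ hb h4)⟩
  · have h2 := mobius_step hθ h (k / k')
    have e : k - k / k' * k' = k % k' := by rw [Int.emod_def]; ring
    have h3 := Int.emod_nonneg k (by omega : k' ≠ 0)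
    have h4 := Int.emod_lt_of_pos k hk'
    have hc : 1 ≤ k / k' := by rw [Int.le_ediv_iff_mul_le hk']; omega
    have h5 : 0 < k % k' := by
      refine lt_of_le_of_ne h3 fun h5 => ?_
      have hdvd : k' ∣ k := Int.dvd_of_emod_eq_zero h5.symm
      have : k' ∣ 1 := by
        rcases hdet with hd | hd
        · rw [← hd]; exact dvd_sub (dvd_mul_left _ _) (hdvd.mul_left _)
        · rw [← dvd_neg, ← hd]; exact dvd_sub (dvd_mul_left _ _) (hdvd.mul_left _)
      have := Int.le_of_dvd one_pos this
      omega
    rw [e] at h2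
    have hdet' : m' * (k % k') - (m - k / k' * m') * k' = 1 ∨
        m' * (k % k') - (m - k / k' * m') * k' = -1 := by
      rw [← e]
      rcases hdet with hd | hd
      · right; linear_combination -hd
      · left; linear_combination -hd
    obtain ⟨j, hj⟩ := ih (k % k').toNat (by omega)
      (by omega : k % k' = ((k % k').toNat : ℤ)) h5 h4 hdet' (big hθ hc) h2
    exact ⟨_, peel _ hθ hj⟩

/-- Sum of the absolute values of the entries. -/
def size (Y : Mat) : ℝ := ∑ i, ∑ j, |Y i j|

/-- A Lipschitz function positive exactly on the matrices of size less than `T` lying in a certain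
open cone. -/
noncomputable def bump (θ₁ θ₂ T : ℝ) (Y : Mat) : ℝ :=
  max 0 (min (min (Y 1 1) (Y 1 0 - Y 1 1))
    (min (min (-Y 0 1 - θ₁ * Y 0 0) (Y 0 1 + θ₂ * Y 0 0)) (T - size Y)))

lemma size_eq (Y : Mat) : size Y = |Y 0 0| + |Y 0 1| + (|Y 1 0| + |Y 1 1|) := by
  simp [size, Fin.sum_univ_two]

lemma bump_nonneg (θ₁ θ₂ T : ℝ) (Y : Mat) : 0 ≤ bump θ₁ θ₂ T Y := le_max_left _ _

lemma bump_pos_iff {θ₁ θ₂ T : ℝ} {Y : Mat} : 0 < bump θ₁ θ₂ T Y ↔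
    0 < Y 1 1 ∧ Y 1 1 < Y 1 0 ∧ 0 < -Y 0 1 - θ₁ * Y 0 0 ∧ 0 < Y 0 1 + θ₂ * Y 0 0 ∧ size Y < T := by
  simp [bump, and_assoc]

lemma bump_le {θ₁ θ₂ T : ℝ} (hT : 0 ≤ T) (Y : Mat) : bump θ₁ θ₂ T Y ≤ T := by
  refine max_le hT ((min_le_right _ _).trans ((min_le_right _ _).trans ?_))
  have : 0 ≤ size Y := by unfold size; positivity
  linarith

lemma bump_eq_zero {θ₁ θ₂ T : ℝ} {Y : Mat} (h : T ≤ size Y) : bump θ₁ θ₂ T Y = 0 :=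
  le_antisymm (not_lt.mp fun h' => absurd (bump_pos_iff.mp h').2.2.2.2 (not_lt.mpr h))
    (bump_nonneg _ _ _ _)

lemma continuous_bump (θ₁ θ₂ T : ℝ) : Continuous (bump θ₁ θ₂ T) := by
  unfold bump size
  fun_prop

lemma bump_lipschitz {θ₁ θ₂ T : ℝ} (h₁ : |θ₁| ≤ 2) (h₂ : |θ₂| ≤ 2) (Y Z : Mat) :
    |bump θ₁ θ₂ T Y - bump θ₁ θ₂ T Z| ≤ 2 * size (Y - Z) := by
  have hmin : ∀ {a b c d e : ℝ}, |a - c| ≤ e → |b - d| ≤ e → |min a b - min c d| ≤ e :=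
    fun h h' => (abs_min_sub_min_le_max _ _ _ _).trans (max_le h h')
  have hmax : ∀ {a b c d e : ℝ}, |a - c| ≤ e → |b - d| ≤ e → |max a b - max c d| ≤ e :=
    fun h h' => (abs_max_sub_max_le_max _ _ _ _).trans (max_le h h')
  have e : size (Y - Z) = |Y 0 0 - Z 0 0| + |Y 0 1 - Z 0 1| + (|Y 1 0 - Z 1 0| + |Y 1 1 - Z 1 1|) :=
    size_eq _
  have p00 := abs_nonneg (Y 0 0 - Z 0 0)
  have p01 := abs_nonneg (Y 0 1 - Z 0 1)
  have p10 := abs_nonneg (Y 1 0 - Z 1 0)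
  have p11 := abs_nonneg (Y 1 1 - Z 1 1)
  unfold bump
  refine hmax (by rw [e]; simp; positivity) (hmin (hmin ?_ ?_) (hmin (hmin ?_ ?_) ?_))
  · linarith
  · have : Y 1 0 - Y 1 1 - (Z 1 0 - Z 1 1) = (Y 1 0 - Z 1 0) - (Y 1 1 - Z 1 1) := by ring
    rw [this]
    refine (abs_sub _ _).trans ?_
    linarith
  · have : -Y 0 1 - θ₁ * Y 0 0 - (-Z 0 1 - θ₁ * Z 0 0) =
        -(Y 0 1 - Z 0 1) - θ₁ * (Y 0 0 - Z 0 0) := by ring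
    rw [this]
    refine (abs_sub _ _).trans ?_
    rw [abs_neg, abs_mul]
    nlinarith
  · have : Y 0 1 + θ₂ * Y 0 0 - (Z 0 1 + θ₂ * Z 0 0) =
        (Y 0 1 - Z 0 1) + θ₂ * (Y 0 0 - Z 0 0) := by ring
    rw [this]
    refine (abs_add_le _ _).trans ?_
    rw [abs_mul]
    nlinarith
  · have : T - size Y - (T - size Z) = size Z - size Y := by ring
    rw [this, size_eq Z, size_eq Y, e]
    have a := fun x y : ℝ => abs_sub_abs_le_abs_sub x y
    have a00 := a (Y 0 0) (Z 0 0)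
    have a01 := a (Y 0 1) (Z 0 1)
    have a10 := a (Y 1 0) (Z 1 0)
    have a11 := a (Y 1 1) (Z 1 1)
    have b00 := a (Z 0 0) (Y 0 0)
    have b01 := a (Z 0 1) (Y 0 1)
    have b10 := a (Z 1 0) (Y 1 0)
    have b11 := a (Z 1 1) (Y 1 1)
    rw [abs_sub_comm] at b00 b01 b10 b11
    rw [abs_le]
    constructor <;> linarith

lemma size_near {g : Mat} {η : ℝ} (hg : Near η g) (Y : Mat) : size (g * Y - Y) ≤ 2 * η * size Y := by
  have h : ∀ i j, |(g * Y - Y) i j| ≤ η * (|Y 0 j| + |Y 1 j|) := by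
    intro i j
    have : (g * Y - Y) i j = (g i 0 - (1 : Mat) i 0) * Y 0 j + (g i 1 - (1 : Mat) i 1) * Y 1 j := by
      have : g * Y - Y = (g - 1) * Y := by rw [Matrix.sub_mul, Matrix.one_mul]
      rw [this, Matrix.mul_apply, Fin.sum_univ_two]; rfl
    rw [this]
    refine (abs_add_le _ _).trans ?_
    rw [abs_mul, abs_mul, mul_add]
    have := hg i 0
    have := hg i 1
    gcongr
  rw [size_eq, size_eq]
  linarith [h 0 0, h 0 1, h 1 0, h 1 1]

lemma bump_near {θ₁ θ₂ T ε : ℝ} (h₁ : |θ₁| ≤ 2) (h₂ : |θ₂| ≤ 2) (hT : 0 ≤ T) (hε : 0 < ε) :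
    ∃ η > 0, ∀ g, Near η g → ∀ Y, |bump θ₁ θ₂ T (g * Y) - bump θ₁ θ₂ T Y| ≤ ε := by
  refine ⟨min (1 / 4) (ε / (8 * (T + 1))), by positivity, fun g hg Y => ?_⟩
  set η := min (1 / 4) (ε / (8 * (T + 1))) with hη
  have hη1 : η ≤ 1 / 4 := min_le_left _ _
  have hη2 : η * (8 * (T + 1)) ≤ ε := by
    rw [← le_div_iff₀ (by positivity)]; exact min_le_right _ _
  have hη0 : 0 ≤ η := by rw [hη]; positivity
  have hs := size_near hg Y
  have hY : 0 ≤ size Y := by unfold size; positivity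
  rcases le_or_gt (size Y) (2 * T) with h | h
  · refine (bump_lipschitz h₁ h₂ _ _).trans ?_
    nlinarith
  · have h3 : T ≤ size (g * Y) := by
      have : size Y ≤ size (g * Y) + size (g * Y - Y) := by
        have a := fun i j => abs_sub_abs_le_abs_sub (Y i j) ((g * Y) i j)
        rw [size_eq Y, size_eq (g * Y), size_eq (g * Y - Y)]
        simp only [Matrix.sub_apply]
        have a00 := a 0 0
        have a01 := a 0 1
        have a10 := a 1 0
        have a11 := a 1 1
        rw [abs_sub_comm (Y _ _)] at a00 a01 a10 a11
        linarith
      nlinarith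
    rw [bump_eq_zero h3, bump_eq_zero (by linarith)]
    simpa using hε.le

/-- The invariant function induced by `bump`. -/
noncomputable def sbump (θ₁ θ₂ T : ℝ) (Y : Mat) : ℝ :=
  ⨆ σ : Matrix.SpecialLinearGroup (Fin 2) ℤ, bump θ₁ θ₂ T (Y * toR σ)

lemma bump_le_sbump {θ₁ θ₂ T : ℝ} (hT : 0 ≤ T) (Y : Mat) (σ : Matrix.SpecialLinearGroup (Fin 2) ℤ) :
    bump θ₁ θ₂ T (Y * toR σ) ≤ sbump θ₁ θ₂ T Y :=
  le_ciSup (f := fun σ : Matrix.SpecialLinearGroup (Fin 2) ℤ => bump θ₁ θ₂ T (Y * toR σ))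
    ⟨T, by rintro _ ⟨σ, rfl⟩; exact bump_le hT _⟩ σ

lemma sbump_nonneg {θ₁ θ₂ T : ℝ} (hT : 0 ≤ T) (Y : Mat) : 0 ≤ sbump θ₁ θ₂ T Y :=
  (bump_nonneg _ _ _ _).trans (bump_le_sbump hT Y 1)

lemma isTest_sbump {θ₁ θ₂ T : ℝ} (h₁ : |θ₁| ≤ 2) (h₂ : |θ₂| ≤ 2) (hT : 0 ≤ T) :
    IsTest (sbump θ₁ θ₂ T) := by
  refine ⟨⟨T, fun A => ?_⟩, fun A γ hγ => ?_, fun ε hε => ?_⟩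
  · rw [abs_of_nonneg (sbump_nonneg hT A)]
    exact ciSup_le fun σ => bump_le hT _
  · unfold sbump
    let γ' : Matrix.SpecialLinearGroup (Fin 2) ℤ := ⟨γ, hγ⟩
    refine (Equiv.mulLeft γ').iSup_congr fun σ => ?_
    rw [Equiv.coe_mulLeft, Matrix.SpecialLinearGroup.coe_mul, toR_mul, Matrix.mul_assoc]
  · obtain ⟨η, hη, h⟩ := bump_near h₁ h₂ hT hε
    refine ⟨η, hη, fun g hg A => ?_⟩
    rw [abs_sub_le_iff, sub_le_iff_le_add, sub_le_iff_le_add]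
    constructor
    · refine ciSup_le fun σ => ?_
      have a := (abs_le.mp (h g hg (A * toR σ))).2
      have b := bump_le_sbump (θ₁ := θ₁) (θ₂ := θ₂) hT A σ
      rw [Matrix.mul_assoc]
      linarith
    · refine ciSup_le fun σ => ?_
      have a := (abs_le.mp (h g hg (A * toR σ))).1
      have b := bump_le_sbump (θ₁ := θ₁) (θ₂ := θ₂) hT (g * A) σ
      rw [Matrix.mul_assoc] at b
      linarith

/-- Positivity of `sbump` along the orbit forces the pattern. -/
lemma exists_iterate_of_sbump_pos {θ₁ θ₂ T s t : ℝ} (h₁ : 1 ≤ θ₁) (h₁₂ : θ₁ < θ₂)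
    (hs : s ∈ Set.Ico (0 : ℝ) 1) (h : 0 < sbump θ₁ θ₂ T (X s t)) :
    ∃ (j : ℕ) (θ : ℝ), θ ∈ Set.Ioo θ₁ θ₂ ∧ gaussMap^[j] s = Int.fract θ := by
  obtain ⟨σ, hσ⟩ := exists_lt_of_lt_ciSup h
  obtain ⟨a1, a2, a3, a4, -⟩ := bump_pos_iff.mp hσ
  have hdet : (σ : ZMat) 0 0 * (σ : ZMat) 1 1 - (σ : ZMat) 0 1 * (σ : ZMat) 1 0 = 1 := by
    rw [← Matrix.det_fin_two]; exact σ.2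
  set m := (σ : ZMat) 0 0
  set m' := (σ : ZMat) 0 1
  set k := (σ : ZMat) 1 0
  set k' := (σ : ZMat) 1 1
  have e00 : (X s t * toR σ) 0 0 = Real.exp t * (m - k * s) := by
    simp [X, Matrix.mul_apply, Fin.sum_univ_two, m, k]; ring
  have e01 : (X s t * toR σ) 0 1 = Real.exp t * (m' - k' * s) := by
    simp [X, Matrix.mul_apply, Fin.sum_univ_two, m', k']; ring
  have e10 : (X s t * toR σ) 1 0 = Real.exp (-t) * k := by
    simp [X, Matrix.mul_apply, Fin.sum_univ_two, k]
  have e11 : (X s t * toR σ) 1 1 = Real.exp (-t) * k' := by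
    simp [X, Matrix.mul_apply, Fin.sum_univ_two, k']
  rw [e11] at a1
  rw [e11, e10] at a2
  rw [e01, e00] at a3 a4
  have hp := Real.exp_pos t
  have b1 : 0 < k' := by exact_mod_cast (pos_iff_pos_of_mul_pos a1).mp (Real.exp_pos _)
  have b2 : k' < k := by exact_mod_cast lt_of_mul_lt_mul_left a2 (Real.exp_pos _).le
  have b3 : 0 < -(m' - k' * s) - θ₁ * (m - k * s) := by
    refine pos_of_mul_pos_right (a := Real.exp t) ?_ hp.le
    linarith
  have b4 : 0 < (m' - k' * s) + θ₂ * (m - k * s) := by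
    refine pos_of_mul_pos_right (a := Real.exp t) ?_ hp.le
    linarith
  have hx : 0 < (m : ℝ) - k * s := by
    refine pos_of_mul_pos_right (a := θ₂ - θ₁) ?_ (by linarith)
    linarith
  set θ := -(m' - k' * s) / (m - k * s) with hθ
  have hθ1 : θ₁ < θ := by rw [hθ, lt_div_iff₀ hx]; linarith
  have hθ2 : θ < θ₂ := by rw [hθ, div_lt_iff₀ hx]; linarith
  have heq : s * (k * θ + k') = m * θ + m' := by
    have : θ * (m - k * s) = -(m' - k' * s) := by rw [hθ, div_mul_cancel₀ _ hx.ne']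
    linarith
  obtain ⟨j, hj⟩ := exists_iterate_gaussMap k'.toNat (by omega) b1 b2 (Or.inl hdet)
    (h₁.trans_lt hθ1) heq
  rw [Int.fract_eq_self.mpr hs] at hj
  exact ⟨j, θ, ⟨hθ1, hθ2⟩, hj⟩

end CFP

namespace CFP
open Finset Topology

lemma exists_bottom_row {W : Mat} (hW : W.det = 1) : ∃ σ : Matrix.SpecialLinearGroup (Fin 2) ℤ,
    0 < (W * toR σ) 1 1 ∧ (W * toR σ) 1 1 < (W * toR σ) 1 0 := by
  have e : ∀ (a b c d : ℤ) (h : (!![a, b; c, d] : ZMat).det = 1),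
      (W * toR (⟨_, h⟩ : Matrix.SpecialLinearGroup (Fin 2) ℤ)) 1 1 = W 1 0 * b + W 1 1 * d ∧
      (W * toR (⟨_, h⟩ : Matrix.SpecialLinearGroup (Fin 2) ℤ)) 1 0 = W 1 0 * a + W 1 1 * c := by
    intro a b c d h
    simp [Matrix.mul_apply, Fin.sum_univ_two]
  rw [Matrix.det_fin_two] at hW
  rcases lt_trichotomy (W 1 1) 0 with h | h | h
  · obtain ⟨k, hk⟩ := exists_nat_gt ((W 1 0 - W 1 1) / (-W 1 1))
    rw [div_lt_iff₀ (by linarith)] at hk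
    refine ⟨⟨!![-1, 0; -k, -1], by simp [Matrix.det_fin_two]⟩, ?_⟩
    rw [(e _ _ _ _ _).1, (e _ _ _ _ _).2]
    push_cast
    constructor <;> linarith
  · rcases lt_or_gt_of_ne (show W 1 0 ≠ 0 by rintro h0; rw [h, h0] at hW; simp at hW) with h0 | h0
    · refine ⟨⟨!![-2, -1; -1, -1], by simp [Matrix.det_fin_two]⟩, ?_⟩
      rw [(e _ _ _ _ _).1, (e _ _ _ _ _).2, h]
      push_cast
      constructor <;> linarith
    · refine ⟨⟨!![2, 1; 1, 1], by simp [Matrix.det_fin_two]⟩, ?_⟩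
      rw [(e _ _ _ _ _).1, (e _ _ _ _ _).2, h]
      push_cast
      constructor <;> linarith
  · obtain ⟨k, hk⟩ := exists_nat_gt ((W 1 1 - W 1 0) / W 1 1)
    rw [div_lt_iff₀ h] at hk
    refine ⟨⟨!![1, 0; k, 1], by simp [Matrix.det_fin_two]⟩, ?_⟩
    rw [(e _ _ _ _ _).1, (e _ _ _ _ _).2]
    push_cast
    constructor <;> linarith

lemma exists_bump_pos {θ₁ θ₂ : ℝ} (h₁ : 1 ≤ θ₁) (h₁₂ : θ₁ < θ₂) {W : Mat} (hW : W.det = 1) :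
    ∃ (σ : Matrix.SpecialLinearGroup (Fin 2) ℤ) (r : ℝ) (T : ℕ),
      0 < bump θ₁ θ₂ T (uni r * (W * toR σ)) := by
  obtain ⟨σ, hq', hq⟩ := exists_bottom_row hW
  have hdet : (W * toR σ).det = 1 := by
    rw [Matrix.det_mul, hW, toR_det, σ.2]; simp
  obtain ⟨V, hV⟩ : ∃ V, V = W * toR σ := ⟨_, rfl⟩
  rw [← hV] at hq hq' hdet
  rw [Matrix.det_fin_two] at hdet
  have hq0 : 0 < V 1 0 := hq'.trans hq
  set θ := (θ₁ + θ₂) / 2 with hθ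
  have hθ0 : 0 < θ := by linarith
  have hden : 0 < θ * V 1 0 + V 1 1 := by positivity
  set ξ := 1 / (θ * V 1 0 + V 1 1) with hξ
  have hξ0 : 0 < ξ := by positivity
  have hξ1 : ξ * (θ * V 1 0 + V 1 1) = 1 := by rw [hξ]; field_simp
  set r := (V 0 0 - ξ) / V 1 0 with hr
  have hr1 : r * V 1 0 = V 0 0 - ξ := by rw [hr]; field_simp
  obtain ⟨T, hT⟩ := exists_nat_gt (size (uni r * V))
  have e00 : (uni r * V) 0 0 = ξ := by
    simp [uni, Matrix.mul_apply, Fin.sum_univ_two]; linarith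
  have e01 : (uni r * V) 0 1 = -(θ * ξ) := by
    have : (uni r * V) 0 1 = V 0 1 - r * V 1 1 := by
      simp [uni, Matrix.mul_apply, Fin.sum_univ_two]; ring
    rw [this]
    refine mul_right_cancel₀ hq0.ne' ?_
    linear_combination (-V 1 1) * hr1 - hdet + hξ1
  have e10 : (uni r * V) 1 0 = V 1 0 := by
    simp [uni, Matrix.mul_apply, Fin.sum_univ_two]
  have e11 : (uni r * V) 1 1 = V 1 1 := by
    simp [uni, Matrix.mul_apply, Fin.sum_univ_two]
  refine ⟨σ, r, T, hV ▸ (bump_pos_iff (Y := uni r * V)).mpr ?_⟩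
  rw [e00, e01, e10, e11]
  refine ⟨hq', hq, ?_, ?_, hT⟩ <;> nlinarith

lemma isCompact_bounded_det_one (C : ℝ) :
    IsCompact {W : Mat | W.det = 1 ∧ ∀ i j, |W i j| ≤ C} := by
  have h : IsCompact {W : Mat | ∀ i j, |W i j| ≤ C} := by
    have := isCompact_univ_pi (X := fun _ : Fin 2 => Fin 2 → ℝ)
      (s := fun _ => Set.univ.pi fun _ => Set.Icc (-C) C)
      fun _ => isCompact_univ_pi fun _ => isCompact_Icc
    have e : (Set.univ.pi fun _ => Set.univ.pi fun _ => Set.Icc (-C) C) =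
        {W : Fin 2 → Fin 2 → ℝ | ∀ i j, |W i j| ≤ C} := by
      ext W
      simp only [Set.mem_pi, Set.mem_univ, true_imp_iff, Set.mem_Icc, Set.mem_ofPred_eq, abs_le]
    rw [e] at this
    exact this
  have hc : IsClosed {W : Mat | W.det = 1} :=
    isClosed_eq (Continuous.matrix_det continuous_id) continuous_const
  exact h.inter_left hc

/-- On thick lattices, some positive combination of translates of the functions `sbump` is at least
one. -/
lemma exists_finite_cover {θ₁ θ₂ δ : ℝ} (h₁ : 1 ≤ θ₁) (h₁₂ : θ₁ < θ₂) (hδ : 0 < δ) :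
    ∃ (S : Finset Mat) (r : Mat → ℝ) (T : Mat → ℕ) (c : Mat → ℝ), (∀ W ∈ S, 0 ≤ c W) ∧
      ∀ s t, Thick δ s t → 1 ≤ ∑ W ∈ S, c W * sbump θ₁ θ₂ (T W) (uni (r W) * X s t) := by
  have hpos : ∀ W : Mat, ∃ (σ : Matrix.SpecialLinearGroup (Fin 2) ℤ) (r : ℝ) (T : ℕ),
      W.det = 1 → 0 < bump θ₁ θ₂ T (uni r * (W * toR σ)) := fun W => by
    by_cases hW : W.det = 1
    · obtain ⟨σ, r, T, h⟩ := exists_bump_pos h₁ h₁₂ hW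
      exact ⟨σ, r, T, fun _ => h⟩
    · exact ⟨1, 0, 0, fun h => absurd h hW⟩
  choose σ r T h using hpos
  obtain ⟨f, hf⟩ : ∃ f : Mat → Mat → ℝ, ∀ W V,
    f W V = bump θ₁ θ₂ (T W) (uni (r W) * (V * toR (σ W))) := ⟨_, fun _ _ => rfl⟩
  have hcont : ∀ W, Continuous (f W) := fun W => by
    rw [funext (hf W)]
    exact (continuous_bump _ _ _).comp (by fun_prop)
  have hpos : ∀ W : Mat, W.det = 1 → 0 < f W W := fun W hW => by rw [hf]; exact h W hW
  obtain ⟨S, hS, hcov⟩ := (isCompact_bounded_det_one (1 + 2 / δ)).elim_nhds_subcover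
    (fun W => {V | f W W / 2 < f W V}) fun W hW =>
      (hcont W).continuousAt.eventually (lt_mem_nhds (half_lt_self (hpos W hW.1)))
  have hc : ∀ W ∈ S, 0 ≤ 2 / f W W := fun W hW => (div_pos two_pos (hpos W (hS W hW).1)).le
  refine ⟨S, r, T, fun W => 2 / f W W, hc, fun s t hst => ?_⟩
  obtain ⟨γ, hγ, hb⟩ := exists_bounded_basis hδ hst
  have hmem : X s t * toR γ ∈ {W : Mat | W.det = 1 ∧ ∀ i j, |W i j| ≤ 1 + 2 / δ} :=
    ⟨by rw [Matrix.det_mul, det_X, toR_det, hγ]; simp, hb⟩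
  obtain ⟨W, hWS, hW⟩ := Set.mem_iUnion₂.mp (hcov hmem)
  have hw : f W W / 2 < f W (X s t * toR γ) := hW
  let γ' : Matrix.SpecialLinearGroup (Fin 2) ℤ := ⟨γ, hγ⟩
  have hle : f W (X s t * toR γ) ≤ sbump θ₁ θ₂ (T W) (uni (r W) * X s t) := by
    have := bump_le_sbump (θ₁ := θ₁) (θ₂ := θ₂) (Nat.cast_nonneg (T W)) (uni (r W) * X s t)
      (γ' * σ W)
    rw [Matrix.SpecialLinearGroup.coe_mul, toR_mul] at this
    rw [hf]
    simpa only [Matrix.mul_assoc] using this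
  have h0 := hpos W (hS W hWS).1
  refine le_trans ?_ (Finset.single_le_sum (f := fun W =>
    2 / f W W * sbump θ₁ θ₂ (T W) (uni (r W) * X s t))
    (fun W hW => mul_nonneg (hc W hW) (sbump_nonneg (Nat.cast_nonneg _) _)) hWS)
  calc (1 : ℝ) = 2 / f W W * (f W W / 2) := by field_simp
    _ ≤ 2 / f W W * sbump θ₁ θ₂ (T W) (uni (r W) * X s t) := by
      gcongr
      exact hw.le.trans hle

end CFP

namespace CFP
open Finset Topology
variable {n : ℕ} {μ : Measure ℝ} [IsProbabilityMeasure μ]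

/-- Almost every orbit enters the open set where some `sbump` is positive. -/
lemma measure_never_zero (hn : 2 ≤ n) {θ₁ θ₂ : ℝ} (h₁ : 1 ≤ θ₁) (h₁₂ : θ₁ < θ₂) (h₂ : θ₂ ≤ 2)
    (hthick : ∀ ε > 0, ∃ δ > 0, mS μ (fun s i => ¬ Thick δ s (tm n i)) ≤ ε)
    (hU : ∀ r φ, IsTest φ → wmean n μ 1 (fun A => φ (uni r * A)) = wmean n μ 1 φ) :
    ∀ᵐ s ∂μ, ∃ T i : ℕ, 0 < sbump θ₁ θ₂ T (X s (tm n i)) := by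
  have a₁ : |θ₁| ≤ 2 := abs_le.mpr ⟨by linarith, by linarith⟩
  have a₂ : |θ₂| ≤ 2 := abs_le.mpr ⟨by linarith, by linarith⟩
  have ht : ∀ T : ℕ, IsTest (sbump θ₁ θ₂ T) := fun T => isTest_sbump a₁ a₂ (Nat.cast_nonneg T)
  set B : Set ℝ := {s | ∀ T i : ℕ, sbump θ₁ θ₂ T (X s (tm n i)) = 0} with hB
  have hBm : MeasurableSet B := by
    simp only [hB, Set.ofPred_forall]
    refine MeasurableSet.iInter fun T => MeasurableSet.iInter fun i => ?_
    have := (ht T).continuous 0 (tm n i)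
    simp only [uni_zero, Matrix.one_mul] at this
    exact this.measurable (measurableSet_singleton 0)
  set w : ℝ → ℝ := B.indicator 1 with hw
  have hwm : Measurable w := measurable_one.indicator hBm
  have hw0 : ∀ s, 0 ≤ w s := fun s => Set.indicator_nonneg (fun _ _ => zero_le_one) s
  have hw1 : ∀ s, |w s| ≤ 1 := fun s => by
    rw [abs_of_nonneg (hw0 s)]
    exact Set.indicator_le_self' (fun _ _ => zero_le_one) s
  have hwA : Adm fun s _ => w s := ⟨⟨1, fun s _ => hw1 s⟩, fun _ => hwm⟩
  have hzero : ∀ T : ℕ, wmean n μ w (sbump θ₁ θ₂ T) = 0 := by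
    intro T
    have h0 : Adm fun (_ : ℝ) (_ : ℤ) => (0 : ℝ) := Adm.const 0
    refine le_antisymm ?_ (mean_nonneg (adm_orbit hwm hw1 (ht T)) fun s i =>
      mul_nonneg (hw0 s) (sbump_nonneg (Nat.cast_nonneg _) _))
    rw [← mean_const (μ := μ) 0]
    refine mean_mono' (adm_orbit hwm hw1 (ht T)) h0 fun s i hi => ?_
    by_cases hs : s ∈ B
    · have := hs T i.toNat
      rw [Int.toNat_of_nonneg hi] at this
      rw [this, mul_zero]
    · rw [hw, Set.indicator_of_notMem hs, zero_mul]
  have hμB : μ.real B = mean μ fun s _ => w s := by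
    have e : avg μ (fun s _ => w s) = avg μ (fun _ _ => μ.real B) := by
      ext I
      simp only [avg, hw]
      congr 1
      refine sum_congr rfl fun i _ => ?_
      rw [integral_indicator_one hBm]
      simp
    unfold mean
    rw [e]
    exact (mean_const _).symm
  have hle : ∀ ε > 0, μ.real B ≤ ε := by
    intro ε hε
    obtain ⟨δ, hδ, hd⟩ := hthick ε hε
    obtain ⟨S, r, T, c, hc, hS⟩ := exists_finite_cover h₁ h₁₂ hδ
    have hadm : ∀ W, Adm fun s i => c W * (w s * sbump θ₁ θ₂ (T W) (uni (r W) * X s (tm n i))) :=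
      fun W => (adm_orbit (φ := fun A => sbump θ₁ θ₂ (T W) (uni (r W) * A)) hwm hw1
        ((ht _).uni _)).const_mul _
    have hsum : mean μ (fun s i => ∑ W ∈ S,
        c W * (w s * sbump θ₁ θ₂ (T W) (uni (r W) * X s (tm n i)))) = 0 := by
      rw [mean_sum fun W _ => hadm W]
      refine sum_eq_zero fun W _ => ?_
      rw [mean_const_mul _ (adm_orbit (φ := fun A => sbump θ₁ θ₂ (T W) (uni (r W) * A)) hwm hw1
        ((ht _).uni _))]
      have := wmean_uni hn hwm hw1 (hU (r W)) (ht (T W))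
      rw [hzero] at this
      unfold wmean at this
      rw [this, mul_zero]
    have hnt := (MSet_thick n δ).not
    have hSA := Adm.sum (t := S) fun W _ => hadm W
    rw [hμB]
    refine le_trans (mean_mono hwA (hnt.adm.add hSA) fun s i => ?_) ?_
    · by_cases hst : Thick δ s (tm n i)
      · have h1 := hS s _ hst
        have h2 : w s * 1 ≤ w s * ∑ W ∈ S, c W * sbump θ₁ θ₂ (T W) (uni (r W) * X s (tm n i)) :=
          mul_le_mul_of_nonneg_left h1 (hw0 s)
        rw [mul_sum] at h2
        simp only [mul_left_comm (w s)] at h2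
        have h3 := ind_nonneg (fun s i => ¬ Thick δ s (tm n i)) s i
        linarith
      · rw [ind_of (P := fun s i => ¬ Thick δ s (tm n i)) hst]
        have h2 : 0 ≤ ∑ W ∈ S, c W * (w s * sbump θ₁ θ₂ (T W) (uni (r W) * X s (tm n i))) :=
          sum_nonneg fun W hW => mul_nonneg (hc W hW)
            (mul_nonneg (hw0 s) (sbump_nonneg (Nat.cast_nonneg _) _))
        have := (abs_le.mp (hw1 s)).2
        linarith
    · rw [mean_add hnt.adm hSA, hsum, add_zero]
      exact hd
  have hB0 : μ B = 0 := by
    have : μ.real B = 0 := le_antisymm (le_of_forall_pos_le_add fun ε hε => by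
      simpa using hle ε hε) measureReal_nonneg
    rwa [measureReal_eq_zero_iff] at this
  have hae : ∀ᵐ s ∂μ, s ∉ B := measure_eq_zero_iff_ae_notMem.mp hB0
  filter_upwards [hae] with s hs
  simp only [hB, Set.mem_ofPred_eq, not_forall] at hs
  obtain ⟨T, i, h⟩ := hs
  exact ⟨T, i, lt_of_le_of_ne (sbump_nonneg (Nat.cast_nonneg _) _) (Ne.symm h)⟩

theorem ae_containsAllPatterns (hn : 2 ≤ n) (hsupp : ∀ᵐ s ∂μ, s ∈ Set.Ico (0 : ℝ) 1)
    (hthick : ∀ ε > 0, ∃ δ > 0, mS μ (fun s i => ¬ Thick δ s (tm n i)) ≤ ε)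
    (hU : ∀ r φ, IsTest φ → wmean n μ 1 (fun A => φ (uni r * A)) = wmean n μ 1 φ) :
    ∀ᵐ s ∂μ, ContainsAllPatterns s := by
  unfold ContainsAllPatterns
  refine ae_all_iff.mpr fun k => ae_all_iff.mpr fun b => ?_
  by_cases hb : ∀ i, 0 < b i
  swap
  · exact Eventually.of_forall fun s h => absurd h hb
  obtain ⟨c, d, hc, hcd, hd, hpat⟩ := exists_pattern_interval k b hb
  filter_upwards [hsupp, measure_never_zero hn (θ₁ := 1 + c) (θ₂ := 1 + d) (by linarith)
    (by linarith) (by linarith) hthick hU] with s hs ⟨T, i, h⟩ _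
  obtain ⟨j, θ, hθ, hj⟩ := exists_iterate_of_sbump_pos (by linarith) (by linarith) hs h
  refine ⟨j, fun l => ?_⟩
  have hfr : Int.fract θ = θ - 1 := by
    have : ⌊θ⌋ = 1 := by
      rw [Int.floor_eq_iff]
      push_cast
      constructor <;> linarith [hθ.1, hθ.2]
    rw [Int.fract, this, Int.cast_one]
  have h := hpat (θ - 1) ⟨by linarith [hθ.1], by linarith [hθ.2]⟩ l
  rw [← hfr, ← hj, ← Function.iterate_add_apply, add_comm] at h
  exact h

end CFP

namespace CFP
open Finset Topology

lemma setIntegral_le_of_steps {f : ℝ → ℝ} (hf : ∀ t, 0 ≤ f t) {h : ℝ} (hh : 0 < h) {p : ℕ → ℝ}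
    (hfp : ∀ (i : ℕ) t, t ∈ Set.Ioc (i * h) ((i + 1) * h) → f t ≤ p i) (I : ℕ) :
    ∫ t in Set.Ioc 0 (I * h), f t ≤ h * ∑ i ∈ range I, p i := by
  set g : ℕ → ℝ → ℝ := fun i => (Set.Ioc (i * h) ((i + 1) * h)).indicator fun _ => p i with hg
  have hp : ∀ i, 0 ≤ p i := fun i =>
    (hf ((i + 1) * h)).trans (hfp i _ ⟨by nlinarith, le_rfl⟩)
  have hintg : ∀ i, Integrable (g i) (volume.restrict (Set.Ioc 0 (I * h))) := fun i =>
    (integrable_const (p i)).indicator measurableSet_Ioc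
  refine (integral_mono_of_nonneg (g := fun t => ∑ i ∈ range I, g i t)
    (Eventually.of_forall hf) (integrable_finsetSum _ fun i _ => hintg i) ?_).trans ?_
  · refine (ae_restrict_iff' measurableSet_Ioc).mpr (Eventually.of_forall fun t ht => ?_)
    have ht0 : 0 < t / h := div_pos ht.1 hh
    have h1 : 0 < ⌈t / h⌉₊ := Nat.ceil_pos.mpr ht0
    obtain ⟨i, hi⟩ : ∃ i, ⌈t / h⌉₊ = i + 1 := ⟨⌈t / h⌉₊ - 1, by omega⟩
    have hlt : (i : ℝ) < t / h := Nat.lt_ceil.mp (by omega)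
    have hle : t / h ≤ (i + 1 : ℕ) := hi ▸ Nat.le_ceil _
    have hI : ⌈t / h⌉₊ ≤ I := Nat.ceil_le.mpr (by rw [div_le_iff₀ hh]; exact ht.2)
    rw [lt_div_iff₀ hh] at hlt
    rw [div_le_iff₀ hh] at hle
    push_cast at hle
    have hmem : t ∈ Set.Ioc (i * h) ((i + 1) * h) := ⟨hlt, hle⟩
    refine (hfp i t hmem).trans ?_
    have : p i = g i t := by rw [hg]; simp only [Set.indicator_of_mem hmem]
    rw [this]
    exact single_le_sum (f := fun i => g i t)
      (fun j _ => Set.indicator_nonneg (fun _ _ => hp j) t) (mem_range.mpr (by omega))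
  · rw [integral_finsetSum _ fun i _ => hintg i, mul_sum]
    refine sum_le_sum fun i _ => ?_
    rw [hg]
    simp only
    rw [integral_indicator_const _ measurableSet_Ioc, smul_eq_mul]
    refine mul_le_mul_of_nonneg_right ?_ (hp i)
    rw [measureReal_restrict_apply measurableSet_Ioc]
    refine (measureReal_mono Set.inter_subset_left (by simp)).trans ?_
    rw [Real.volume_real_Ioc_of_le (by nlinarith)]
    linarith

lemma Thick.mono_time {δ s t u h : ℝ} (hst : Thick δ s t) (hut : u ≤ t) (hth : t ≤ u + h) :
    Thick (δ * Real.exp (-h)) s u := by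
  intro m k hmk
  have h1 := hst m k hmk
  have hh : Real.exp (-h) ≤ 1 := Real.exp_le_one_iff.mpr (by linarith)
  have e1 : Real.exp t * Real.exp (-h) ≤ Real.exp u := by
    rw [← Real.exp_add]; exact Real.exp_le_exp.mpr (by linarith)
  have e2 : Real.exp (-t) ≤ Real.exp (-u) := Real.exp_le_exp.mpr (by linarith)
  have hp := Real.exp_pos (-h)
  simp only [abs_mul, Real.abs_exp] at h1 ⊢
  refine (mul_le_mul_of_nonneg_right h1 hp.le).trans ?_
  rw [max_mul_of_nonneg _ _ hp.le]
  refine max_le_max ?_ ?_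
  · rw [mul_right_comm]
    gcongr
  · calc Real.exp (-t) * |(k : ℝ)| * Real.exp (-h) ≤ Real.exp (-t) * |(k : ℝ)| :=
        mul_le_of_le_one_right (by positivity) hh
      _ ≤ _ := by gcongr

variable {n : ℕ} {μ : Measure ℝ} [IsProbabilityMeasure μ]

lemma mS_not_thick_of_no_escape (hn : 2 ≤ n) (hnoescape : ∀ ε : ℝ, 0 < ε → ∃ δ : ℝ, 0 < δ ∧
      (1 - ε : ℝ) ≤ Filter.liminf (fun T : ℝ =>
        (1 / T) * ∫ t in Set.Ioc (0 : ℝ) T, (μ {s : ℝ | Thick δ s t}).toReal) Filter.atTop) :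
    ∀ ε > 0, ∃ δ > 0, mS μ (fun s i => ¬ Thick δ s (tm n i)) ≤ ε := by
  intro ε hε
  obtain ⟨δ, hδ, hlim⟩ := hnoescape (ε / 2) (half_pos hε)
  have hh : 0 < Real.log n / 2 := half_pos (Real.log_pos (by exact_mod_cast hn))
  have hn0 : ∀ t, 0 ≤ (μ {s : ℝ | Thick δ s t}).toReal := fun t => ENNReal.toReal_nonneg
  set h := Real.log n / 2 with hdef
  refine ⟨δ * Real.exp (-h), by positivity, ?_⟩
  have hev := eventually_lt_of_lt_liminf (show 1 - ε < _ from lt_of_lt_of_le (by linarith) hlim)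
    (isBoundedUnder_of_eventually_ge (a := 0) (by
      filter_upwards [eventually_gt_atTop 0] with T hT
      exact mul_nonneg (by positivity) (integral_nonneg hn0)))
  have htend : Tendsto (fun I : ℕ => (I : ℝ) * h) atTop atTop :=
    tendsto_natCast_atTop_atTop.atTop_mul_const hh
  have hM := MSet_thick n (δ * Real.exp (-h))
  rw [mS_not hM]
  suffices 1 - ε ≤ mS μ (fun s i => Thick (δ * Real.exp (-h)) s (tm n i)) by linarith
  rw [← mean_const (μ := μ) (1 - ε)]
  refine mean_le_of_avg (Adm.const _) hM.adm ?_
  filter_upwards [htend.eventually hev, eventually_gt_atTop 0] with I hI hI0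
  have hI0' : (0 : ℝ) < I := by exact_mod_cast hI0
  have hstep := setIntegral_le_of_steps hn0 hh
    (p := fun i => μ.real {s | Thick (δ * Real.exp (-h)) s (tm n (i : ℕ))}) (fun i t ht => by
      refine measureReal_mono fun s hs => Thick.mono_time hs ?_ ?_
      · rw [tm]; push_cast; exact ht.1.le
      · rw [tm]; push_cast; rw [← hdef]; have := ht.2; linarith) I
  simp only [avg, integral_ind hM]
  have e : (∑ i ∈ range I, ∫ _, (1 - ε) ∂μ) / (I : ℝ) = 1 - ε := by
    simp
    field_simp
  rw [e, le_div_iff₀ hI0']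
  rw [one_div, inv_mul_eq_div, lt_div_iff₀ (by positivity)] at hI
  refine le_of_mul_le_mul_right (a := h) ?_ hh
  linarith

lemma wmean_one_uni
    (hU : ∀ φ r, IsTest φ → 0 < r → mean μ (ev n φ r) = mean μ (ev n φ 0)) (r : ℝ) (φ : Mat → ℝ)
    (hφ : IsTest φ) : wmean n μ 1 (fun A => φ (uni r * A)) = wmean n μ 1 φ := by
  have hpos : ∀ r φ, IsTest φ → 0 < r →
      wmean n μ 1 (fun A => φ (uni r * A)) = wmean n μ 1 φ := by
    intro r φ hφ hr
    have := hU φ r hφ hr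
    rw [ev_zero, show ev n φ r = fun s i => φ (uni r * X s (tm n i)) from rfl] at this
    unfold wmean
    simpa only [Pi.one_apply, one_mul] using this
  rcases lt_trichotomy r 0 with hr | rfl | hr
  · have := hpos (-r) _ (hφ.uni r) (by linarith)
    simp only [← Matrix.mul_assoc, uni_add, add_neg_cancel, uni_zero, Matrix.one_mul] at this
    exact this.symm
  · simp [uni_zero]
  · exact hpos r φ hφ hr

end CFP

/-- let `μ` be a probability measure on `[0,1)` invariant and ergodic under
`x ↦ n·x mod 1` and exact dimensional of dimension `κ > 0`.  Assume there is no escape of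
mass on average for the lattices `Λ_{t,s} = a_t u_s ℤ²`.  Then for `μ`-almost every `s` the
continued fraction expansion of `s` contains all patterns. -/
theorem stmt2 (n : ℕ) (hn : 2 ≤ n) (μ : Measure ℝ) [IsProbabilityMeasure μ]
    (hsupp : μ (Set.Ico (0 : ℝ) 1) = 1)
    (herg : Ergodic (fun x : ℝ => Int.fract ((n : ℝ) * x)) μ)
    (κ : ℝ) (hκ : 0 < κ) (hdim : ExactDimensional μ κ)
    (hnoescape : ∀ ε : ℝ, 0 < ε → ∃ δ : ℝ, 0 < δ ∧
      (1 - ε : ℝ) ≤ Filter.liminf (fun T : ℝ =>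
        (1 / T) * ∫ t in Set.Ioc (0 : ℝ) T,
          (μ {s : ℝ | ∀ m k : ℤ, ¬(m = 0 ∧ k = 0) →
            δ ≤ max |Real.exp t * ((m : ℝ) - (k : ℝ) * s)|
                    |Real.exp (-t) * (k : ℝ)|}).toReal) Filter.atTop) :
    ∀ᵐ s ∂μ, ContainsAllPatterns s := by
  have hthick := CFP.mS_not_thick_of_no_escape hn hnoescape
  have hsupp' := CFP.measure_Ico_of hsupp
  exact CFP.ae_containsAllPatterns hn hsupp' hthick (CFP.wmean_one_uni fun φ r hφ hr =>
    CFP.mean_ev_uni hn herg.toMeasurePreserving hsupp' hκ hdim hthick hφ hr)
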